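/- Let q, r ∈ ℤ with q > 0, and let (X, ℬ, μ, T) be an invertible measure preserving system such that T^q is ergodic. Then for every A ∈ ℬ, every ε > 0 and every k ∈ {1, 2, 3}, the set {n ∈ ℕ : μ(A ∩ T^{−(qn+r)}A ∩ T^{−2(qn+r)}A ∩ … ∩ T^{−k(qn+r)}A) > μ(A)^{k+1} − ε} is syndetic. -/

import Mathlib

open MeasureTheory Filter

/-- For an invertible map `T` with inverse `S`, `zpreimage T S n A` is the preimage of `A`
under `T^n` (allowing negative integer exponents). -/
def zpreimage {X : Type*} (T S : X → X) (n : ℤ) (A : Set X) : Set X :=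
  if 0 ≤ n then T^[n.toNat] ⁻¹' A else S^[(-n).toNat] ⁻¹' A

/-- A set of naturals is syndetic if it has bounded gaps. -/
def Syndetic (S : Set ℕ) : Prop :=
  ∃ L : ℕ, 0 < L ∧ ∀ a : ℕ, ∃ n ∈ S, a ≤ n ∧ n < a + L

namespace Recurrence

set_option linter.unusedSectionVars false
open scoped Topology ComplexConjugate BigOperators

section Averages

/-- Cesàro convergence to zero of a real sequence. -/
def CesN (b : ℕ → ℝ) : Prop :=
  Tendsto (fun N : ℕ => (∑ n ∈ Finset.range N, b n) / N) atTop (𝓝 0)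

/-- The uniform averages of `b` are asymptotically bounded by `c`. -/
def UB {E : Type*} [SeminormedAddCommGroup E] (b : ℕ → E) (c : ℝ) : Prop :=
  ∀ ε > 0, ∃ N₀ : ℕ, ∀ N ≥ N₀, ∀ a : ℕ, ‖∑ i ∈ Finset.range N, b (a + i)‖ ≤ (c + ε) * N

theorem CesN.mono {b c : ℕ → ℝ} (hc : CesN c) (h0 : ∀ n, 0 ≤ b n) (h : ∀ n, b n ≤ c n) :
    CesN b := by
  refine squeeze_zero (fun N => ?_) (fun N => ?_) hc
  · exact div_nonneg (Finset.sum_nonneg fun i _ => h0 i) (Nat.cast_nonneg _)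
  · gcongr; exact h _

theorem CesN.const_mul {b : ℕ → ℝ} (hb : CesN b) (c : ℝ) : CesN (fun n => c * b n) := by
  have := Tendsto.const_mul c hb
  simp only [mul_zero] at this
  refine this.congr fun N => ?_
  rw [← Finset.mul_sum, mul_div_assoc]

theorem CesN.mul_index {b : ℕ → ℝ} (hb : CesN b) (h0 : ∀ n, 0 ≤ b n) {j : ℕ} (hj : 0 < j) :
    CesN (fun n => b (j * n)) := by
  have h1 : Tendsto (fun N : ℕ => j * N) atTop atTop :=
    tendsto_id.const_mul_atTop' hj
  have h2 := (Tendsto.comp hb h1).const_mul (j : ℝ)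
  simp only [mul_zero] at h2
  refine squeeze_zero (fun N => ?_) (fun N => ?_) h2
  · exact div_nonneg (Finset.sum_nonneg fun i _ => h0 _) (Nat.cast_nonneg _)
  · have h3 : ∑ n ∈ Finset.range N, b (j * n) ≤ ∑ n ∈ Finset.range (j * N), b n := by
      rw [← Finset.sum_image (f := b) (s := Finset.range N) (g := fun n => j * n)]
      · refine Finset.sum_le_sum_of_subset_of_nonneg ?_ fun i _ _ => h0 i
        intro i hi
        simp only [Finset.mem_image, Finset.mem_range] at hi ⊢
        obtain ⟨n, hn, rfl⟩ := hi
        exact Nat.mul_lt_mul_of_pos_left hn hj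
      · intro x _ y _ hxy
        exact Nat.eq_of_mul_eq_mul_left hj hxy
    rcases Nat.eq_zero_or_pos N with rfl | hN
    · simp
    · have hj' : (0 : ℝ) < j := by exact_mod_cast hj
      have hN' : (0 : ℝ) < N := by exact_mod_cast hN
      simp only [Function.comp, Nat.cast_mul]
      rw [mul_div_assoc', mul_div_mul_left _ _ hj'.ne']
      gcongr

theorem CesN.sqrt {b : ℕ → ℝ} (hb : CesN b) (h0 : ∀ n, 0 ≤ b n) :
    CesN (fun n => √(b n)) := by
  have h2 := (Real.continuous_sqrt.tendsto 0).comp hb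
  simp only [Real.sqrt_zero] at h2
  refine squeeze_zero (fun N => ?_) (fun N => ?_) h2
  · exact div_nonneg (Finset.sum_nonneg fun i _ => Real.sqrt_nonneg _) (Nat.cast_nonneg _)
  · apply Real.le_sqrt_of_sq_le
    rcases Nat.eq_zero_or_pos N with rfl | hN
    · simp
    · have hN' : (0 : ℝ) < N := by exact_mod_cast hN
      rw [div_pow, div_le_div_iff₀ (by positivity) hN']
      have h3 := Finset.sum_mul_sq_le_sq_mul_sq (Finset.range N) (fun n => √(b n)) (fun _ => 1)
      simp only [mul_one, one_pow, Finset.sum_const, Finset.card_range, nsmul_eq_mul] at h3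
      have h4 : ∑ n ∈ Finset.range N, √(b n) ^ 2 = ∑ n ∈ Finset.range N, b n :=
        Finset.sum_congr rfl fun n _ => Real.sq_sqrt (h0 n)
      rw [h4] at h3
      nlinarith

theorem CesN.of_sq {b : ℕ → ℝ} (hb : CesN fun n => b n ^ 2) (h0 : ∀ n, 0 ≤ b n) : CesN b := by
  have := hb.sqrt fun n => sq_nonneg _
  refine this.mono h0 fun n => ?_
  rw [Real.sqrt_sq (h0 n)]

variable {E : Type*} [SeminormedAddCommGroup E]

theorem UB.mono {b : ℕ → E} {c c' : ℝ} (h : UB b c) (hc : c ≤ c') : UB b c' := by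
  intro ε hε
  obtain ⟨N₀, h⟩ := h ε hε
  refine ⟨N₀, fun N hN a => (h N hN a).trans ?_⟩
  gcongr

theorem UB.add {b b' : ℕ → E} {c c' : ℝ} (h : UB b c) (h' : UB b' c') :
    UB (fun n => b n + b' n) (c + c') := by
  intro ε hε
  obtain ⟨N₀, h⟩ := h (ε / 2) (by positivity)
  obtain ⟨N₁, h'⟩ := h' (ε / 2) (by positivity)
  refine ⟨max N₀ N₁, fun N hN a => ?_⟩
  rw [Finset.sum_add_distrib]
  refine (norm_add_le _ _).trans ?_
  have h1 := h N (le_of_max_le_left hN) a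
  have h2 := h' N (le_of_max_le_right hN) a
  nlinarith

theorem UB.of_norm_le {b : ℕ → E} {c : ℝ} (h : ∀ n, ‖b n‖ ≤ c) : UB b c := by
  intro ε hε
  refine ⟨0, fun N _ a => (norm_sum_le _ _).trans ?_⟩
  calc ∑ i ∈ Finset.range N, ‖b (a + i)‖ ≤ ∑ i ∈ Finset.range N, (c + ε) :=
        Finset.sum_le_sum fun i _ => (h _).trans (by linarith)
    _ = (c + ε) * N := by simp; ring

theorem UB.of_approx {b : ℕ → E} {c : ℝ} (h : ∀ ε > 0, ∃ b' : ℕ → E, UB b' (c + ε) ∧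
    ∀ n, ‖b n - b' n‖ ≤ ε) : UB b c := by
  intro ε hε
  obtain ⟨b', hb', hbb⟩ := h (ε / 3) (by positivity)
  have h1 := hb'.add (UB.of_norm_le hbb)
  simp only [add_sub_cancel] at h1
  obtain ⟨N₀, h2⟩ := h1 (ε / 3) (by positivity)
  refine ⟨N₀, fun N hN a => (h2 N hN a).trans (le_of_eq (by ring))⟩

theorem UB.of_forall_gt {b : ℕ → E} {c : ℝ} (h : ∀ ε > 0, UB b (c + ε)) : UB b c :=
  UB.of_approx fun ε hε => ⟨b, h ε hε, fun n => by simp [hε.le]⟩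

theorem UB.clm {b : ℕ → E} {c : ℝ} (hb : UB b c) {F : Type*} [SeminormedAddCommGroup F]
    (L : E →+ F) {C : ℝ} (hC : 0 ≤ C) (hL : ∀ x, ‖L x‖ ≤ C * ‖x‖) :
    UB (fun n => L (b n)) (C * c) := by
  intro ε hε
  obtain ⟨N₀, h⟩ := hb (ε / (C + 1)) (by positivity)
  refine ⟨N₀, fun N hN a => ?_⟩
  rw [← map_sum]
  refine (hL _).trans ((mul_le_mul_of_nonneg_left (h N hN a) hC).trans ?_)
  rw [← mul_assoc]
  gcongr
  rw [mul_add]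
  gcongr
  rw [mul_div_assoc', div_le_iff₀ (by positivity)]
  nlinarith

theorem UB.const_mul {b : ℕ → ℂ} {c : ℝ} (hb : UB b c) (w : ℂ) :
    UB (fun n => w * b n) (‖w‖ * c) :=
  hb.clm (AddMonoidHom.mulLeft w) (norm_nonneg w) fun x => by simp

theorem UB.zero_of_le {b : ℕ → E} (h : ∀ ε > 0, UB b ε) : UB b 0 :=
  UB.of_forall_gt fun ε hε => by simpa using h ε hε

end Averages

section VanDerCorput

variable {H : Type*} [NormedAddCommGroup H] [InnerProductSpace ℂ H]

theorem UB.inner_left {u : ℕ → H} {c : ℝ} (hu : UB u c) (v : H) :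
    UB (fun n => inner ℂ v (u n)) (‖v‖ * c) :=
  hu.clm (innerSL ℂ v : H →+ ℂ) (norm_nonneg v) fun x => norm_inner_le_norm v x

theorem norm_sum_shift_sub_le {u : ℕ → H} (hu : ∀ n, ‖u n‖ ≤ 1) (N a k : ℕ) :
    ‖∑ i ∈ Finset.range N, u (a + k + i) - ∑ i ∈ Finset.range N, u (a + i)‖ ≤ 2 * k := by
  induction k with
  | zero => simp
  | succ k ih =>
    have h1 : ∑ i ∈ Finset.range N, u (a + (k + 1) + i) - ∑ i ∈ Finset.range N, u (a + k + i)
        = u (a + k + N) - u (a + k) := by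
      have h2 := Finset.sum_range_succ (fun i => u (a + k + i)) N
      have h3 := Finset.sum_range_succ' (fun i => u (a + k + i)) N
      rw [h3] at h2
      have h4 : ∀ i, u (a + k + (i + 1)) = u (a + (k + 1) + i) := fun i => by
        congr 1; ring
      simp only [h4, add_zero] at h2
      rw [sub_eq_sub_iff_add_eq_add, h2]; abel
    calc _ ≤ ‖∑ i ∈ Finset.range N, u (a + (k + 1) + i) - ∑ i ∈ Finset.range N, u (a + k + i)‖
          + ‖∑ i ∈ Finset.range N, u (a + k + i) - ∑ i ∈ Finset.range N, u (a + i)‖ :=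
          norm_sub_le_norm_sub_add_norm_sub _ _ _
      _ ≤ (1 + 1) + 2 * k := by
          rw [h1]
          gcongr
          exact (norm_sub_le _ _).trans (add_le_add (hu _) (hu _))
      _ = _ := by push_cast; ring

theorem norm_inner_window_le {u : ℕ → H} {γ : ℕ → ℝ} {N : ℕ} {ε : ℝ} {K : ℕ}
    (h : ∀ k < K, ∀ a, ‖∑ i ∈ Finset.range N, inner ℂ (u (a + i)) (u (a + i + k))‖
      ≤ (γ k + ε) * N) {k l : ℕ} (hk : k < K) (hl : l < K) (a : ℕ) :
    ‖∑ i ∈ Finset.range N, inner ℂ (u (a + i + k)) (u (a + i + l))‖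
      ≤ (γ (Nat.dist k l) + ε) * N := by
  rcases le_total k l with hkl | hkl
  · have := h (l - k) (by omega) (a + k)
    rw [Nat.dist_eq_sub_of_le hkl]
    have e1 : ∀ i, a + i + k + (l - k) = a + i + l := fun i => by omega
    have e2 : ∀ i, a + k + i = a + i + k := fun i => by omega
    simpa only [e2, e1] using this
  · have := h (k - l) (by omega) (a + l)
    rw [Nat.dist_eq_sub_of_le_right hkl, ← RCLike.norm_conj, map_sum]
    simp only [inner_conj_symm]
    have e1 : ∀ i, a + i + l + (k - l) = a + i + k := fun i => by omega
    have e2 : ∀ i, a + l + i = a + i + l := fun i => by omega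
    simpa only [e2, e1] using this

theorem sum_dist_le {γ : ℕ → ℝ} (hγ : ∀ k, 0 ≤ γ k) {K k : ℕ} (hk : k < K) :
    ∑ l ∈ Finset.range K, γ (Nat.dist k l) ≤ 2 * ∑ j ∈ Finset.range K, γ j := by
  rw [← Finset.sum_filter_add_sum_filter_not _ (fun l => l ≤ k), two_mul]
  refine add_le_add ?_ ?_
  · rw [← Finset.sum_image (g := fun l => Nat.dist k l) (f := γ)]
    · refine Finset.sum_le_sum_of_subset_of_nonneg ?_ fun i _ _ => hγ i
      intro i
      simp only [Finset.mem_image, Finset.mem_filter, Finset.mem_range]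
      rintro ⟨l, ⟨h1, h2⟩, rfl⟩
      unfold Nat.dist; omega
    · intro x hx y hy hxy
      simp only [Finset.coe_filter, Finset.mem_range, Set.mem_ofPred_eq] at hx hy
      simp only [Nat.dist] at hxy; omega
  · rw [← Finset.sum_image (g := fun l => Nat.dist k l) (f := γ)]
    · refine Finset.sum_le_sum_of_subset_of_nonneg ?_ fun i _ _ => hγ i
      intro i
      simp only [Finset.mem_image, Finset.mem_filter, Finset.mem_range]
      rintro ⟨l, ⟨h1, h2⟩, rfl⟩
      unfold Nat.dist; omega
    · intro x hx y hy hxy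
      simp only [Finset.coe_filter, Finset.mem_range, Set.mem_ofPred_eq] at hx hy
      simp only [Nat.dist] at hxy; omega

theorem norm_sq_window_le {u : ℕ → H} {γ : ℕ → ℝ} (hγ : ∀ k, 0 ≤ γ k) {N : ℕ} {ε : ℝ} {K : ℕ}
    (h : ∀ k < K, ∀ a, ‖∑ i ∈ Finset.range N, inner ℂ (u (a + i)) (u (a + i + k))‖
      ≤ (γ k + ε) * N) (a : ℕ) :
    ∑ i ∈ Finset.range N, ‖∑ k ∈ Finset.range K, u (a + i + k)‖ ^ 2
      ≤ (2 * K * ∑ j ∈ Finset.range K, γ j + K ^ 2 * ε) * N := by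
  have h1 : ∀ i, ‖∑ k ∈ Finset.range K, u (a + i + k)‖ ^ 2 = RCLike.re
      (∑ k ∈ Finset.range K, ∑ l ∈ Finset.range K, inner ℂ (u (a + i + k)) (u (a + i + l))) := by
    intro i
    rw [← inner_self_eq_norm_sq (𝕜 := ℂ), sum_inner]
    simp only [inner_sum]
  simp only [h1]
  rw [← map_sum, Finset.sum_comm]
  refine (RCLike.re_le_norm _).trans ?_
  calc _ ≤ ∑ k ∈ Finset.range K, ∑ l ∈ Finset.range K, (γ (Nat.dist k l) + ε) * N := by
        refine (norm_sum_le _ _).trans (Finset.sum_le_sum fun k hk => ?_)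
        rw [Finset.sum_comm]
        refine (norm_sum_le _ _).trans (Finset.sum_le_sum fun l hl => ?_)
        exact norm_inner_window_le h (Finset.mem_range.1 hk) (Finset.mem_range.1 hl) a
    _ = (∑ k ∈ Finset.range K, (∑ l ∈ Finset.range K, γ (Nat.dist k l) + K * ε)) * N := by
        simp only [Finset.sum_mul, add_mul, Finset.sum_add_distrib, Finset.sum_const,
          Finset.card_range, nsmul_eq_mul]
        ring
    _ ≤ (∑ k ∈ Finset.range K, (2 * ∑ j ∈ Finset.range K, γ j + K * ε)) * N := by
        gcongr with k hk
        exact sum_dist_le hγ (Finset.mem_range.1 hk)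
    _ = _ := by
        simp only [Finset.sum_const, Finset.card_range, nsmul_eq_mul]
        ring

theorem van_der_corput {u : ℕ → H} (hu : ∀ n, ‖u n‖ ≤ 1) {γ : ℕ → ℝ} (hγ : ∀ k, 0 ≤ γ k)
    (hγ0 : 1 ≤ γ 0) (h : ∀ k, 0 < k → UB (fun n => inner ℂ (u n) (u (n + k))) (γ k))
    {K : ℕ} (hK : 0 < K) :
    UB u (√(2 / K * ∑ k ∈ Finset.range K, γ k)) := by
  have hall : ∀ k, UB (fun n => inner ℂ (u n) (u (n + k))) (γ k) := by
    intro k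
    rcases Nat.eq_zero_or_pos k with rfl | hk
    · refine UB.of_norm_le fun n => (norm_inner_le_norm _ _).trans ?_
      calc _ ≤ (1 : ℝ) * 1 := mul_le_mul (hu _) (hu _) (norm_nonneg _) zero_le_one
        _ ≤ _ := by simpa using hγ0
    · exact h k hk
  intro ε hε
  choose N₀ hN₀ using fun k => hall k ((ε / 2) ^ 2) (by positivity)
  have hK' : (0 : ℝ) < K := by exact_mod_cast hK
  refine ⟨max ((Finset.range K).sup N₀) ⌈4 * K / ε⌉₊, fun N hN a => ?_⟩
  have hN1 : ∀ k < K, N₀ k ≤ N := fun k hk =>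
    (Finset.le_sup (f := N₀) (Finset.mem_range.2 hk)).trans (le_of_max_le_left hN)
  have hN2 : 4 * K / ε ≤ N := (Nat.le_ceil _).trans (by exact_mod_cast le_of_max_le_right hN)
  have hw := norm_sq_window_le hγ (N := N) (fun k hk a => hN₀ k N (hN1 k hk) a) a
  set Γ := ∑ j ∈ Finset.range K, γ j with hΓ
  have hΓ0 : 0 ≤ Γ := Finset.sum_nonneg fun k _ => hγ k
  set W := ∑ i ∈ Finset.range N, ∑ k ∈ Finset.range K, u (a + i + k) with hW
  have hW1 : ‖W‖ ^ 2 ≤ N * ((2 * K * Γ + K ^ 2 * (ε / 2) ^ 2) * N) := by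
    refine le_trans ?_ (mul_le_mul_of_nonneg_left hw (Nat.cast_nonneg _))
    have := Finset.sum_mul_sq_le_sq_mul_sq (Finset.range N) (fun _ => (1 : ℝ))
      (fun i => ‖∑ k ∈ Finset.range K, u (a + i + k)‖)
    simp only [one_mul, one_pow, Finset.sum_const, Finset.card_range, nsmul_eq_mul, mul_one] at this
    refine le_trans ?_ this
    gcongr
    exact norm_sum_le _ _
  have hW2 : ‖W‖ ≤ (K * N) * (√(2 / K * Γ) + ε / 2) := by
    refine (sq_le_sq₀ (norm_nonneg _) (by positivity)).1 ?_
    refine hW1.trans ?_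
    rw [mul_pow, add_sq, Real.sq_sqrt (by positivity)]
    have : (N : ℝ) * ((2 * K * Γ + K ^ 2 * (ε / 2) ^ 2) * N) =
        (K * N) ^ 2 * (2 / K * Γ + (ε / 2) ^ 2) := by
      field_simp
    rw [this]
    gcongr
    have : 0 ≤ 2 * √(2 / K * Γ) * (ε / 2) := by positivity
    linarith
  have hS : ‖(K : ℂ) • ∑ i ∈ Finset.range N, u (a + i)‖ ≤ ‖W‖ + 2 * K * K := by
    have h1 : (K : ℂ) • ∑ i ∈ Finset.range N, u (a + i) = W -
        ∑ k ∈ Finset.range K, (∑ i ∈ Finset.range N, u (a + k + i)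
          - ∑ i ∈ Finset.range N, u (a + i)) := by
      rw [hW, Finset.sum_comm, Finset.sum_sub_distrib]
      simp only [Finset.sum_const, Finset.card_range, add_right_comm a, ← Nat.cast_smul_eq_nsmul ℂ]
      abel
    rw [h1]
    refine (norm_sub_le _ _).trans ?_
    gcongr
    calc _ ≤ ∑ k ∈ Finset.range K, 2 * (K : ℝ) := by
          refine (norm_sum_le _ _).trans (Finset.sum_le_sum fun k hk => ?_)
          refine (norm_sum_shift_sub_le hu N a k).trans ?_
          have : (k : ℝ) ≤ K := by exact_mod_cast (Finset.mem_range.1 hk).le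
          linarith
      _ = _ := by simp; ring
  rw [norm_smul, Complex.norm_natCast] at hS
  have h4 : (K : ℝ) * ‖∑ i ∈ Finset.range N, u (a + i)‖ ≤ K * ((√(2 / K * Γ) + ε) * N) := by
    have h5 : 2 * (K : ℝ) ≤ ε / 2 * N := by
      rw [div_le_iff₀ hε] at hN2
      linarith
    have h6 := mul_le_mul_of_nonneg_left h5 hK'.le
    nlinarith
  exact le_of_mul_le_mul_left h4 hK'

theorem van_der_corput_zero {u : ℕ → H} (hu : ∀ n, ‖u n‖ ≤ 1) {γ : ℕ → ℝ} (hγ : ∀ k, 0 ≤ γ k)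
    (h : ∀ k, 0 < k → UB (fun n => inner ℂ (u n) (u (n + k))) (γ k)) (hC : CesN γ) :
    UB u 0 := by
  set γ' : ℕ → ℝ := fun k => γ k + if k = 0 then 1 else 0 with hγ'
  have hsum : ∀ K, 0 < K → ∑ k ∈ Finset.range K, γ' k = ∑ k ∈ Finset.range K, γ k + 1 := by
    intro K hK
    simp only [hγ', Finset.sum_add_distrib, Finset.sum_ite_eq', Finset.mem_range, hK, if_true]
  have h1 : ∀ K, 0 < K → UB u (√(2 / K * ∑ k ∈ Finset.range K, γ' k)) := by
    intro K hK
    refine van_der_corput hu (fun k => ?_) ?_ (fun k hk => (h k hk).mono ?_) hK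
    · simp only [hγ']; split_ifs <;> linarith [hγ k]
    · simp only [hγ', if_true]; linarith [hγ 0]
    · simp only [hγ']; split_ifs <;> linarith
  have h2 : Tendsto (fun K : ℕ => √(2 * ((∑ k ∈ Finset.range K, γ k) / K + 1 / K)))
      atTop (𝓝 0) := by
    have h3 := (Tendsto.add hC tendsto_one_div_atTop_nhds_zero_nat).const_mul 2
    rw [add_zero, mul_zero] at h3
    have := (Real.continuous_sqrt.tendsto 0).comp h3
    rw [Real.sqrt_zero] at this
    exact this
  refine UB.zero_of_le fun ε hε => ?_
  obtain ⟨K, hK, hK0⟩ := ((h2.eventually_lt_const hε).and (eventually_gt_atTop 0)).exists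
  refine (h1 K hK0).mono (le_trans (le_of_eq ?_) hK.le)
  rw [hsum K hK0]
  congr 1
  ring

end VanDerCorput

section Bounded

variable {X Y : Type*} [MeasurableSpace X] [MeasurableSpace Y]

/-- Measurable complex functions bounded everywhere by `C`. -/
structure Bd (C : ℝ) (f : X → ℂ) : Prop where
  meas : Measurable f
  bdd : ∀ x, ‖f x‖ ≤ C

theorem Bd.mono {C C' : ℝ} {f : X → ℂ} (h : Bd C f) (hC : C ≤ C') : Bd C' f :=
  ⟨h.meas, fun x => (h.bdd x).trans hC⟩

theorem Bd.gmul {C C' : ℝ} {f g : X → ℂ} (hf : Bd C f) (hg : Bd C' g) :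
    Bd (C * C') (fun x => f x * g x) :=
  ⟨hf.meas.mul hg.meas, fun x => by
    rw [norm_mul]
    exact mul_le_mul (hf.bdd x) (hg.bdd x) (norm_nonneg _) ((norm_nonneg _).trans (hf.bdd x))⟩

theorem Bd.mul {f g : X → ℂ} (hf : Bd 1 f) (hg : Bd 1 g) : Bd 1 (fun x => f x * g x) := by
  simpa using hf.gmul hg

theorem Bd.conj {C : ℝ} {f : X → ℂ} (hf : Bd C f) : Bd C (fun x => conj (f x)) :=
  ⟨Complex.continuous_conj.measurable.comp hf.meas, fun x => by
    rw [RCLike.norm_conj]; exact hf.bdd x⟩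

theorem Bd.comp {C : ℝ} {f : X → ℂ} (hf : Bd C f) {φ : Y → X} (hφ : Measurable φ) :
    Bd C (fun y => f (φ y)) :=
  ⟨hf.meas.comp hφ, fun _ => hf.bdd _⟩

theorem Bd.add {C C' : ℝ} {f g : X → ℂ} (hf : Bd C f) (hg : Bd C' g) :
    Bd (C + C') (fun x => f x + g x) :=
  ⟨hf.meas.add hg.meas, fun x => (norm_add_le _ _).trans (add_le_add (hf.bdd x) (hg.bdd x))⟩

theorem Bd.sub {C C' : ℝ} {f g : X → ℂ} (hf : Bd C f) (hg : Bd C' g) :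
    Bd (C + C') (fun x => f x - g x) :=
  ⟨hf.meas.sub hg.meas, fun x => (norm_sub_le _ _).trans (add_le_add (hf.bdd x) (hg.bdd x))⟩

theorem Bd.const (c : ℂ) : Bd ‖c‖ (fun _ : X => c) := ⟨measurable_const, fun _ => le_rfl⟩

theorem Bd.one : Bd 1 (fun _ : X => (1 : ℂ)) := ⟨measurable_const, fun _ => by simp⟩

theorem Bd.const_mul {C : ℝ} {f : X → ℂ} (hf : Bd C f) (c : ℂ) :
    Bd (‖c‖ * C) (fun x => c * f x) :=
  (Bd.const c).gmul hf

theorem Bd.pow {f : X → ℂ} (hf : Bd 1 f) (n : ℕ) : Bd 1 (fun x => f x ^ n) :=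
  ⟨hf.meas.pow_const n, fun x => by rw [norm_pow]; exact pow_le_one₀ (norm_nonneg _) (hf.bdd x)⟩

theorem Bd.sum {ι : Type*} (s : Finset ι) {C : ι → ℝ} {f : ι → X → ℂ}
    (h : ∀ i ∈ s, Bd (C i) (f i)) : Bd (∑ i ∈ s, C i) (fun x => ∑ i ∈ s, f i x) :=
  ⟨Finset.measurable_sum _ fun i hi => (h i hi).meas, fun x =>
    (norm_sum_le _ _).trans (Finset.sum_le_sum fun i hi => (h i hi).bdd x)⟩

variable {μ : Measure X} [IsProbabilityMeasure μ]

theorem Bd.integrable {C : ℝ} {f : X → ℂ} (hf : Bd C f) : Integrable f μ :=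
  Integrable.of_bound hf.meas.aestronglyMeasurable C (ae_of_all _ hf.bdd)

theorem Bd.memLp {C : ℝ} {f : X → ℂ} (hf : Bd C f) (p : ENNReal) : MemLp f p μ :=
  MemLp.of_bound hf.meas.aestronglyMeasurable C (ae_of_all _ hf.bdd)

theorem Bd.norm_integral_le {C : ℝ} {f : X → ℂ} (hf : Bd C f) : ‖∫ x, f x ∂μ‖ ≤ C := by
  simpa using norm_integral_le_of_norm_le_const (μ := μ) (ae_of_all _ hf.bdd)

theorem Bd.integrable_norm_sq {C : ℝ} {f : X → ℂ} (hf : Bd C f) :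
    Integrable (fun x => ‖f x‖ ^ 2) μ :=
  (hf.memLp 2).integrable_norm_pow (by norm_num)

/-- An `a.e.` bounded measurable function can be modified to be bounded everywhere. -/
theorem exists_bd_of_ae {f : X → ℂ} (hf : AEStronglyMeasurable f μ) {C : ℝ} (hC : 0 ≤ C)
    (h : ∀ᵐ x ∂μ, ‖f x‖ ≤ C) : ∃ g, Bd C g ∧ f =ᵐ[μ] g := by
  classical
  set f' := hf.mk f with hf'
  have hm : Measurable f' := hf.stronglyMeasurable_mk.measurable
  refine ⟨fun x => if ‖f' x‖ ≤ C then f' x else 0, ⟨?_, fun x => ?_⟩, ?_⟩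
  · exact Measurable.ite (measurableSet_le hm.norm measurable_const) hm measurable_const
  · split_ifs with h
    · exact h
    · simpa using hC
  · filter_upwards [h, hf.ae_eq_mk] with x hx hx2
    rw [← hf'] at hx2
    rw [hx2] at hx
    simp [hx, hx2]

end Bounded

section L2

variable {X : Type*} [MeasurableSpace X] {μ : Measure X}

theorem inner_toLp {f g : X → ℂ} (hf : MemLp f 2 μ) (hg : MemLp g 2 μ) :
    inner ℂ (hf.toLp f) (hg.toLp g) = ∫ x, conj (f x) * g x ∂μ := by
  rw [L2.inner_def]
  refine integral_congr_ae ?_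
  filter_upwards [hf.coeFn_toLp, hg.coeFn_toLp] with x h1 h2
  rw [h1, h2]
  simp [mul_comm]

theorem norm_toLp_sq {f : X → ℂ} (hf : MemLp f 2 μ) :
    ‖hf.toLp f‖ ^ 2 = ∫ x, ‖f x‖ ^ 2 ∂μ := by
  have h := inner_toLp hf hf
  have h1 : ∀ x, conj (f x) * f x = ((‖f x‖ ^ 2 : ℝ) : ℂ) := fun x => by
    rw [mul_comm, Complex.mul_conj, Complex.normSq_eq_norm_sq]
  simp only [h1, integral_complex_ofReal] at h
  rw [inner_self_eq_norm_sq_to_K] at h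
  apply Complex.ofReal_injective
  push_cast
  exact h

theorem norm_lp_sq (f : Lp ℂ 2 μ) : ‖f‖ ^ 2 = ∫ x, ‖f x‖ ^ 2 ∂μ := by
  conv_lhs => rw [← Lp.toLp_coeFn f (Lp.memLp f)]
  exact norm_toLp_sq _

theorem sq_norm_integral_mul_le {f g : X → ℂ} (hf : MemLp f 2 μ) (hg : MemLp g 2 μ) :
    ‖∫ x, f x * g x ∂μ‖ ^ 2 ≤ (∫ x, ‖f x‖ ^ 2 ∂μ) * ∫ x, ‖g x‖ ^ 2 ∂μ := by
  have hf' : MemLp (fun x => conj (f x)) 2 μ := hf.star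
  have h := norm_inner_le_norm (𝕜 := ℂ) (hf'.toLp _) (hg.toLp g)
  rw [inner_toLp] at h
  simp only [Complex.conj_conj] at h
  calc _ ≤ (‖hf'.toLp _‖ * ‖hg.toLp g‖) ^ 2 := by gcongr
    _ = _ := by rw [mul_pow, norm_toLp_sq, norm_toLp_sq]; simp

theorem sq_integral_norm_le [IsProbabilityMeasure μ] {f : X → ℂ} (hf : MemLp f 2 μ) :
    (∫ x, ‖f x‖ ∂μ) ^ 2 ≤ ∫ x, ‖f x‖ ^ 2 ∂μ := by
  have h1 : MemLp (fun x => ((‖f x‖ : ℝ) : ℂ)) 2 μ := hf.norm.ofReal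
  have h2 : MemLp (fun _ : X => (1 : ℂ)) 2 μ := memLp_const 1
  have := sq_norm_integral_mul_le h1 h2
  simp only [mul_one, integral_complex_ofReal] at this
  simpa using this

theorem integral_norm_le_sqrt [IsProbabilityMeasure μ] {f : X → ℂ} (hf : MemLp f 2 μ) :
    (∫ x, ‖f x‖ ∂μ) ≤ √(∫ x, ‖f x‖ ^ 2 ∂μ) :=
  Real.le_sqrt_of_sq_le (sq_integral_norm_le hf)

end L2

section WeightedKoopman

variable {X : Type*} [MeasurableSpace X] {μ : Measure X}

theorem memLp_mul_lp {w : X → ℂ} (hw : Bd 1 w) (f : Lp ℂ 2 μ) :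
    MemLp (fun x => w x * f x) 2 μ :=
  (Lp.memLp f).of_le (hw.meas.aestronglyMeasurable.mul (Lp.aestronglyMeasurable f))
    (ae_of_all _ fun x => by
      rw [norm_mul]
      exact mul_le_of_le_one_left (norm_nonneg _) (hw.bdd x))

/-- Multiplication by a bounded measurable function on `L²`. -/
noncomputable def mulL2 {w : X → ℂ} (hw : Bd 1 w) : Lp ℂ 2 μ →L[ℂ] Lp ℂ 2 μ :=
  LinearMap.mkContinuous
    { toFun := fun f => (memLp_mul_lp hw f).toLp
      map_add' := fun f g => by
        rw [← MemLp.toLp_add]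
        refine MemLp.toLp_congr _ _ ?_
        filter_upwards [Lp.coeFn_add f g] with x hx
        rw [hx]
        simp only [Pi.add_apply, mul_add]
      map_smul' := fun c f => by
        rw [RingHom.id_apply, ← MemLp.toLp_const_smul]
        refine MemLp.toLp_congr _ _ ?_
        filter_upwards [Lp.coeFn_smul c f] with x hx
        rw [hx]
        simp only [Pi.smul_apply, smul_eq_mul]; ring } 1 (fun f => by
      rw [one_mul]
      refine Lp.norm_le_norm_of_ae_le ?_
      simp only [LinearMap.coe_mk, AddHom.coe_mk]
      filter_upwards [(memLp_mul_lp hw f).coeFn_toLp] with x hx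
      rw [hx, norm_mul]
      exact mul_le_of_le_one_left (norm_nonneg _) (hw.bdd x))

theorem coeFn_mulL2 {w : X → ℂ} (hw : Bd 1 w) (f : Lp ℂ 2 μ) :
    mulL2 hw f =ᵐ[μ] fun x => w x * f x := MemLp.coeFn_toLp (memLp_mul_lp hw f)

theorem norm_mulL2_le {w : X → ℂ} (hw : Bd 1 w) : ‖mulL2 (μ := μ) hw‖ ≤ 1 :=
  LinearMap.mkContinuous_norm_le _ zero_le_one _

/-- The operator `f ↦ w · f ∘ T` on `L²`. -/
noncomputable def wKoopman {T : X → X} (hT : MeasurePreserving T μ μ) {w : X → ℂ} (hw : Bd 1 w) :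
    Lp ℂ 2 μ →L[ℂ] Lp ℂ 2 μ :=
  mulL2 hw ∘L (Lp.compMeasurePreservingₗᵢ ℂ T hT).toContinuousLinearMap

theorem coeFn_wKoopman {T : X → X} (hT : MeasurePreserving T μ μ) {w : X → ℂ} (hw : Bd 1 w)
    (f : Lp ℂ 2 μ) : wKoopman hT hw f =ᵐ[μ] fun x => w x * f (T x) := by
  refine (coeFn_mulL2 hw _).trans ?_
  filter_upwards [Lp.coeFn_compMeasurePreserving f hT] with x hx
  exact congrArg (w x * ·) hx

theorem norm_wKoopman_le {T : X → X} (hT : MeasurePreserving T μ μ) {w : X → ℂ} (hw : Bd 1 w) :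
    ‖wKoopman hT hw‖ ≤ 1 := by
  refine (ContinuousLinearMap.opNorm_comp_le _ _).trans ?_
  exact mul_le_one₀ (norm_mulL2_le hw) (norm_nonneg _)
      (LinearIsometry.norm_toContinuousLinearMap_le _)

/-- Iterates of `f ↦ w · f ∘ T`. -/
def wIter (T : X → X) (w : X → ℂ) (G : X → ℂ) : ℕ → X → ℂ
  | 0 => G
  | n + 1 => fun x => w x * wIter T w G n (T x)

theorem Bd.wIter {T : X → X} (hT : Measurable T) {w G : X → ℂ} (hw : Bd 1 w) (hG : Bd 1 G)
    (n : ℕ) : Bd 1 (wIter T w G n) := by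
  induction n with
  | zero => exact hG
  | succ n ih => exact hw.mul (ih.comp hT)

theorem wIter_one (T : X → X) (G : X → ℂ) (n : ℕ) :
    wIter T (fun _ => 1) G n = fun x => G (T^[n] x) := by
  induction n with
  | zero => rfl
  | succ n ih => funext x; simp [wIter, ih]

variable [IsProbabilityMeasure μ]

theorem wKoopman_iterate {T : X → X} (hT : MeasurePreserving T μ μ) {w G : X → ℂ} (hw : Bd 1 w)
    (hG : Bd 1 G) (n : ℕ) : (wKoopman hT hw)^[n] ((hG.memLp (μ := μ) 2).toLp G)
      = ((hw.wIter hT.measurable hG n).memLp (μ := μ) 2).toLp _ := by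
  induction n with
  | zero => rfl
  | succ n ih =>
    rw [Function.iterate_succ_apply', ih]
    refine Lp.ext ((coeFn_wKoopman hT hw _).trans ?_)
    refine EventuallyEq.trans ?_ (MemLp.coeFn_toLp _).symm
    have := hT.quasiMeasurePreserving.ae_eq_comp
      (((hw.wIter hT.measurable hG n).memLp (μ := μ) 2).coeFn_toLp)
    filter_upwards [this] with x hx
    simp only [Function.comp] at hx
    rw [hx]; rfl

theorem ae_norm_le_of_tendsto_lp {f : ℕ → Lp ℂ 2 μ} {g : Lp ℂ 2 μ} {C : ℝ}
    (h : Tendsto f atTop (𝓝 g)) (hf : ∀ n, ∀ᵐ x ∂μ, ‖f n x‖ ≤ C) : ∀ᵐ x ∂μ, ‖g x‖ ≤ C := by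
  obtain ⟨ns, -, hns⟩ := (tendstoInMeasure_of_tendsto_Lp h).exists_seq_tendsto_ae
  filter_upwards [hns, ae_all_iff.2 hf] with x h1 h2
  exact le_of_tendsto h1.norm (Eventually.of_forall fun n => h2 _)

/-- Mean ergodic theorem for `f ↦ w · f ∘ T`, in terms of bounded functions. -/
theorem mean_ergodic {T : X → X} (hT : MeasurePreserving T μ μ) {w G : X → ℂ} (hw : Bd 1 w)
    (hG : Bd 1 G) : ∃ J : X → ℂ, Bd 1 J ∧ (∀ᵐ x ∂μ, w x * J (T x) = J x) ∧
      Tendsto (fun N : ℕ => ∫ x, ‖(N : ℂ)⁻¹ * ∑ n ∈ Finset.range N, wIter T w G n x - J x‖ ^ 2 ∂μ)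
        atTop (𝓝 0) := by
  set V := wKoopman hT hw with hV
  set v := (hG.memLp (μ := μ) 2).toLp G with hv
  have h := V.tendsto_birkhoffAverage_orthogonalProjection (norm_wKoopman_le hT hw) v
  obtain ⟨p, hp, h⟩ : ∃ p, V p = p ∧ Tendsto (birkhoffAverage ℂ V _root_.id · v) atTop (𝓝 p) :=
    ⟨_, ((V.eqLocus (1 : Lp ℂ 2 μ →L[ℂ] Lp ℂ 2 μ)).orthogonalProjectionOnto v).2, h⟩
  have hBd : ∀ N : ℕ, Bd 1 (fun x => (N : ℂ)⁻¹ * ∑ n ∈ Finset.range N, wIter T w G n x) := by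
    intro N
    have := (Bd.sum (Finset.range N) fun i _ => hw.wIter hT.measurable hG i).const_mul (N : ℂ)⁻¹
    refine this.mono ?_
    simp only [norm_inv, Complex.norm_natCast, Finset.sum_const, Finset.card_range, nsmul_eq_mul,
      mul_one]
    exact inv_mul_le_one
  have hb : ∀ N, birkhoffAverage ℂ V _root_.id N v = ((hBd N).memLp (μ := μ) 2).toLp _ := by
    intro N
    rw [birkhoffAverage, birkhoffSum]
    have hit : ∀ n, V^[n] v = ((hw.wIter hT.measurable hG n).memLp (μ := μ) 2).toLp _ :=
      wKoopman_iterate hT hw hG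
    simp only [_root_.id, hit]
    refine Lp.ext ((Lp.coeFn_smul _ _).trans ?_)
    refine EventuallyEq.trans ?_ (MemLp.coeFn_toLp _).symm
    have h1 := Lp.coeFn_finsetSum (E := ℂ) (p := 2) (μ := μ) (Finset.range N) (fun n =>
      ((hw.wIter hT.measurable hG n).memLp (μ := μ) 2).toLp _)
    have h2 := ae_all_iff.2 fun n =>
      ((hw.wIter hT.measurable hG n).memLp (μ := μ) 2).coeFn_toLp
    filter_upwards [h1, h2] with x h1 h2
    simp only [Pi.smul_apply, h1, smul_eq_mul, Finset.sum_apply, h2]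
  simp only [hb] at h
  have hp1 : ∀ᵐ x ∂μ, ‖p x‖ ≤ 1 := ae_norm_le_of_tendsto_lp h fun N => by
    filter_upwards [((hBd N).memLp (μ := μ) 2).coeFn_toLp] with x hx
    rw [hx]; exact (hBd N).bdd x
  obtain ⟨J, hJ, hpJ⟩ := exists_bd_of_ae (Lp.aestronglyMeasurable p) zero_le_one hp1
  refine ⟨J, hJ, ?_, ?_⟩
  · have h1 := coeFn_wKoopman hT hw p
    rw [← hV, hp] at h1
    filter_upwards [h1, hpJ, hT.quasiMeasurePreserving.ae_eq_comp hpJ] with x h1 h2 h3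
    simp only [Function.comp] at h3
    rw [← h2, ← h3, ← h1]
  · have h1 := (tendsto_iff_norm_sub_tendsto_zero.1 h).pow 2
    rw [zero_pow two_ne_zero] at h1
    refine h1.congr fun N => ?_
    rw [norm_lp_sq]
    refine integral_congr_ae ?_
    filter_upwards [Lp.coeFn_sub (((hBd N).memLp (μ := μ) 2).toLp _) p, hpJ,
      ((hBd N).memLp (μ := μ) 2).coeFn_toLp] with x h1 h2 h3
    rw [h1, Pi.sub_apply, h2, h3]

end WeightedKoopman

theorem van_der_corput_lim {H : Type*} [NormedAddCommGroup H] [InnerProductSpace ℂ H]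
    {u : ℕ → H} (hu : ∀ n, ‖u n‖ ≤ 1) {γ : ℕ → ℝ} (hγ : ∀ k, 0 ≤ γ k)
    (h : ∀ k, 0 < k → UB (fun n => inner ℂ (u n) (u (n + k))) (γ k)) {w : ℝ}
    (hC : ∀ ε > 0, ∀ᶠ K : ℕ in atTop, (∑ k ∈ Finset.range K, γ k) / K ≤ w + ε) :
    UB u (√(2 * w)) := by
  set γ' : ℕ → ℝ := fun k => γ k + if k = 0 then 1 else 0 with hγ'
  have hsum : ∀ K, 0 < K → ∑ k ∈ Finset.range K, γ' k = ∑ k ∈ Finset.range K, γ k + 1 := by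
    intro K hK
    simp only [hγ', Finset.sum_add_distrib, Finset.sum_ite_eq', Finset.mem_range, hK, if_true]
  have h1 : ∀ K, 0 < K → UB u (√(2 / K * ∑ k ∈ Finset.range K, γ' k)) := by
    intro K hK
    refine van_der_corput hu (fun k => ?_) ?_ (fun k hk => (h k hk).mono ?_) hK
    · simp only [hγ']; split_ifs <;> linarith [hγ k]
    · simp only [hγ', if_true]; linarith [hγ 0]
    · simp only [hγ']; split_ifs <;> linarith
  refine UB.of_forall_gt fun ε hε => ?_
  obtain ⟨K, hK, hK0, hK1⟩ := ((hC (ε ^ 2 / 4) (by positivity)).and ((eventually_gt_atTop 0).and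
    (tendsto_one_div_atTop_nhds_zero_nat.eventually_lt_const
      (show (0 : ℝ) < ε ^ 2 / 4 by positivity)))).exists
  refine (h1 K hK0).mono ?_
  rw [hsum K hK0]
  have e : 2 / (K : ℝ) * (∑ k ∈ Finset.range K, γ k + 1)
      = 2 * ((∑ k ∈ Finset.range K, γ k) / K + 1 / K) := by ring
  have h0 : 0 ≤ (∑ k ∈ Finset.range K, γ k) / K :=
    div_nonneg (Finset.sum_nonneg fun k _ => hγ k) (Nat.cast_nonneg _)
  have h2 : 2 * ((∑ k ∈ Finset.range K, γ k) / K + 1 / K) ≤ 2 * w + ε ^ 2 := by linarith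
  rw [e]
  rcases le_total 0 w with hw | hw
  · refine Real.sqrt_le_iff.2 ⟨by positivity, h2.trans ?_⟩
    have h3 := Real.sq_sqrt (show 0 ≤ 2 * w by positivity)
    nlinarith [Real.sqrt_nonneg (2 * w)]
  · refine Real.sqrt_le_iff.2 ⟨by positivity, h2.trans ?_⟩
    rw [Real.sqrt_eq_zero_of_nonpos (by linarith)]
    linarith

section Action

variable {X : Type*} [MeasurableSpace X] {μ : Measure X} [IsProbabilityMeasure μ]

/-- A measure preserving action of the integers. -/
structure ZAct (τ : ℤ → X → X) (μ : Measure X) : Prop where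
  zero : ∀ x, τ 0 x = x
  add : ∀ m n x, τ (m + n) x = τ m (τ n x)
  mp : ∀ n, MeasurePreserving (τ n) μ μ

/-- The multiplicative derivative of `f` along `τ k`. -/
noncomputable def D (τ : ℤ → X → X) (k : ℤ) (f : X → ℂ) (x : X) : ℂ := f (τ k x) * conj (f x)

variable {τ : ℤ → X → X}

theorem ZAct.meas (hτ : ZAct τ μ) (n : ℤ) : Measurable (τ n) := (hτ.mp n).measurable

theorem ZAct.iterate (hτ : ZAct τ μ) (q : ℤ) (n : ℕ) (x : X) : (τ q)^[n] x = τ (q * n) x := by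
  induction n generalizing x with
  | zero => simp [hτ.zero]
  | succ n ih =>
    rw [Function.iterate_succ_apply, ih, ← hτ.add]
    congr 1; push_cast; ring

theorem integral_comp_mp {Y : Type*} [MeasurableSpace Y] {ν : Measure Y} {T : X → Y}
    (hT : MeasurePreserving T μ ν) {C : ℝ} {F : Y → ℂ} (hF : Bd C F) :
    ∫ x, F (T x) ∂μ = ∫ y, F y ∂ν := by
  rw [← hT.map_eq, integral_map hT.aemeasurable hF.meas.aestronglyMeasurable]

theorem integral_comp_mp_real {Y : Type*} [MeasurableSpace Y] {ν : Measure Y} {T : X → Y}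
    (hT : MeasurePreserving T μ ν) {F : Y → ℝ} (hF : Measurable F) :
    ∫ x, F (T x) ∂μ = ∫ y, F y ∂ν := by
  rw [← hT.map_eq, integral_map hT.aemeasurable hF.aestronglyMeasurable]

theorem ZAct.integral_comp (hτ : ZAct τ μ) (n : ℤ) {C : ℝ} {F : X → ℂ} (hF : Bd C F) :
    ∫ x, F (τ n x) ∂μ = ∫ x, F x ∂μ := integral_comp_mp (hτ.mp n) hF

theorem Bd.D (hτ : ZAct τ μ) (k : ℤ) {f : X → ℂ} (hf : Bd 1 f) : Bd 1 (D τ k f) :=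
  (hf.comp (hτ.meas k)).mul hf.conj

/-- `L²` convergence of ergodic averages, uniform over starting points. -/
theorem ZAct.ergodic_avg (hτ : ZAct τ μ) {q : ℕ} (hq : Ergodic (τ q) μ) {G : X → ℂ}
    (hG : Bd 1 G) : Tendsto (fun N : ℕ => ∫ x, ‖(N : ℂ)⁻¹ * ∑ n ∈ Finset.range N, G (τ (q * n) x)
      - ∫ y, G y ∂μ‖ ^ 2 ∂μ) atTop (𝓝 0) := by
  obtain ⟨J, hJ, hJT, hlim⟩ := mean_ergodic (hτ.mp q) Bd.one hG
  have hJT' : J ∘ τ q =ᵐ[μ] J := by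
    filter_upwards [hJT] with x hx
    simpa using hx
  simp only [wIter_one, hτ.iterate] at hlim
  obtain ⟨c, hc⟩ := hq.ae_eq_const_of_ae_eq_comp_ae hJ.meas.aestronglyMeasurable hJT'
  have hBd : ∀ N : ℕ, Bd 1 (fun x => (N : ℂ)⁻¹ * ∑ n ∈ Finset.range N, G (τ (q * n) x)) := by
    intro N
    refine ((Bd.sum (Finset.range N) fun i _ => hG.comp (hτ.meas (q * i))).const_mul
      (N : ℂ)⁻¹).mono ?_
    simp only [norm_inv, Complex.norm_natCast, Finset.sum_const, Finset.card_range, nsmul_eq_mul,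
      mul_one]
    exact inv_mul_le_one
  have h1 : Tendsto (fun N : ℕ => ‖∫ y, G y ∂μ - c‖) atTop (𝓝 0) := by
    have h2 := (Real.continuous_sqrt.tendsto 0).comp hlim
    rw [Real.sqrt_zero] at h2
    refine squeeze_zero' (Eventually.of_forall fun N => norm_nonneg _) ?_ h2
    filter_upwards [eventually_gt_atTop 0] with N hN
    have hN' : (N : ℂ) ≠ 0 := by exact_mod_cast hN.ne'
    have h3 : ∫ y, G y ∂μ - c =
        ∫ x, ((N : ℂ)⁻¹ * ∑ n ∈ Finset.range N, G (τ (q * n) x) - J x) ∂μ := by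
      rw [integral_sub (hBd N).integrable hJ.integrable, integral_const_mul,
        integral_finsetSum _ fun i _ => (hG.comp (hτ.meas _)).integrable]
      simp only [hτ.integral_comp _ hG, Finset.sum_const, Finset.card_range, nsmul_eq_mul]
      rw [inv_mul_cancel_left₀ hN', integral_congr_ae hc]
      simp
    rw [h3]
    refine (norm_integral_le_integral_norm _).trans ?_
    exact integral_norm_le_sqrt (((hBd N).sub hJ).memLp 2)
  have h2 : ∫ y, G y ∂μ = c := by
    have := tendsto_nhds_unique h1 tendsto_const_nhds
    rw [eq_comm, norm_eq_zero, sub_eq_zero] at this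
    exact this
  refine hlim.congr fun N => integral_congr_ae ?_
  filter_upwards [hc] with x hx
  rw [hx, h2]; rfl

theorem ZAct.ub_correlation (hτ : ZAct τ μ) {q : ℕ} (hq : Ergodic (τ q) μ) (r : ℤ) {F G : X → ℂ}
    (hF : Bd 1 F) (hG : Bd 1 G) :
    UB (fun n : ℕ => ∫ x, F x * G (τ (q * n + r) x) ∂μ - (∫ x, F x ∂μ) * ∫ x, G x ∂μ) 0 := by
  intro ε hε
  have h := (Real.continuous_sqrt.tendsto 0).comp (hτ.ergodic_avg hq hG)
  rw [Real.sqrt_zero] at h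
  obtain ⟨N₀, hN₀⟩ := eventually_atTop.1 ((h.eventually_lt_const hε).and (eventually_gt_atTop 0))
  refine ⟨N₀, fun N hN a => ?_⟩
  obtain ⟨h1, hN0⟩ := hN₀ N hN
  have hN' : (N : ℂ) ≠ 0 := by exact_mod_cast hN0.ne'
  set c := ∫ y, G y ∂μ with hc
  set A : X → ℂ := fun x => (N : ℂ)⁻¹ * ∑ n ∈ Finset.range N, G (τ (q * n) x) with hA
  have hABd : Bd 1 A := by
    refine ((Bd.sum (Finset.range N) fun i _ => hG.comp (hτ.meas (q * i))).const_mul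
      (N : ℂ)⁻¹).mono ?_
    simp only [norm_inv, Complex.norm_natCast, Finset.sum_const, Finset.card_range, nsmul_eq_mul,
      mul_one]
    exact inv_mul_le_one
  have hAc := hABd.sub (Bd.const (X := X) c)
  set j : ℤ := q * a + r with hj
  have e : ∑ i ∈ Finset.range N, (∫ x, F x * G (τ (q * ((a + i : ℕ) : ℤ) + r) x) ∂μ
      - (∫ x, F x ∂μ) * c) = N * ∫ x, F x * (A (τ j x) - c) ∂μ := by
    simp only [mul_sub]
    rw [integral_sub (hF.mul (hABd.comp (hτ.meas j))).integrable (hF.gmul (Bd.const c)).integrable,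
      integral_mul_const, mul_sub, Finset.sum_sub_distrib, Finset.sum_const, Finset.card_range,
      nsmul_eq_mul]
    congr 1
    have : ∀ x, F x * A (τ j x) = (N : ℂ)⁻¹ * ∑ n ∈ Finset.range N,
        F x * G (τ (q * ((a + n : ℕ) : ℤ) + r) x) := by
      intro x
      simp only [hA, ← hτ.add, Finset.mul_sum, hj]
      refine Finset.sum_congr rfl fun n _ => ?_
      rw [mul_left_comm]
      congr 4; push_cast; ring
    simp only [this]
    rw [integral_const_mul, integral_finsetSum _ fun i _ => (hF.mul
        (hG.comp (hτ.meas _))).integrable,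
      mul_inv_cancel_left₀ hN']
  rw [e, norm_mul, Complex.norm_natCast, zero_add, mul_comm]
  gcongr
  refine le_trans ?_ h1.le
  refine (norm_integral_le_integral_norm _).trans ?_
  calc ∫ x, ‖F x * (A (τ j x) - c)‖ ∂μ ≤ ∫ x, ‖A (τ j x) - c‖ ∂μ := by
        refine integral_mono (hF.gmul (hAc.comp (hτ.meas j))).integrable.norm
          (hAc.comp (hτ.meas j)).integrable.norm fun x => ?_
        simp only [norm_mul]
        exact mul_le_of_le_one_left (norm_nonneg _) (hF.bdd x)
    _ = ∫ x, ‖A x - c‖ ∂μ := integral_comp_mp_real (hτ.mp j) hAc.meas.norm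
    _ ≤ _ := integral_norm_le_sqrt (hAc.memLp 2)

/-- The triple correlation bound obtained from the van der Corput inequality. -/
theorem ZAct.ub_triple (hτ : ZAct τ μ) {q : ℕ} (hq : Ergodic (τ q) μ) (r : ℤ)
    {F₁ F₂ F₃ : X → ℂ} (h₁ : Bd 1 F₁) (h₂ : Bd 1 F₂) (h₃ : Bd 1 F₃) {w : ℝ}
    (hw : ∀ ε > 0, ∀ᶠ K : ℕ in atTop, (∑ k ∈ Finset.range K,
      ‖∫ x, D τ (q * k) F₂ x ∂μ‖ * ‖∫ x, D τ (2 * (q * k)) F₃ x ∂μ‖) / K ≤ w + ε) :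
    UB (fun n : ℕ => ∫ x, F₁ x * F₂ (τ (q * n + r) x) * F₃ (τ (2 * (q * n + r)) x) ∂μ)
      (√(2 * w)) := by
  set f : ℕ → X → ℂ := fun n x => F₂ (τ (q * n + r) x) * F₃ (τ (2 * (q * n + r)) x) with hf
  have hfB : ∀ n, Bd 1 (f n) := fun n => (h₂.comp (hτ.meas _)).mul (h₃.comp (hτ.meas _))
  set u : ℕ → Lp ℂ 2 μ := fun n => ((hfB n).memLp 2).toLp _ with hu
  have hu1 : ∀ {g : X → ℂ} (hg : Bd 1 g), ‖(hg.memLp (μ := μ) 2).toLp g‖ ≤ 1 := by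
    intro g hg
    rw [← sq_le_one_iff₀ (norm_nonneg _), norm_toLp_sq]
    calc ∫ x, ‖g x‖ ^ 2 ∂μ ≤ ∫ x, 1 ∂μ := by
          refine integral_mono hg.integrable_norm_sq (integrable_const _) fun x => ?_
          exact pow_le_one₀ (norm_nonneg _) (hg.bdd x)
      _ = 1 := by simp
  have hvdc := van_der_corput_lim (u := u) (fun n => hu1 (hfB n))
    (γ := fun k => ‖∫ x, D τ (q * k) F₂ x ∂μ‖ * ‖∫ x, D τ (2 * (q * k)) F₃ x ∂μ‖)
    (fun k => by positivity) (fun k hk => ?_) hw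
  · have h := hvdc.inner_left ((h₁.conj.memLp (μ := μ) 2).toLp _)
    simp only [hu, inner_toLp, Complex.conj_conj, hf, ← mul_assoc] at h
    refine h.mono (mul_le_of_le_one_left (Real.sqrt_nonneg _) (hu1 h₁.conj))
  · have h := hτ.ub_correlation hq r (h₂.D hτ (q * k)) (h₃.D hτ (2 * (q * k)))
    have h' := h.add (UB.of_norm_le (b := fun n : ℕ => (∫ x, D τ (q * k) F₂ x ∂μ) *
      ∫ x, D τ (2 * (q * k)) F₃ x ∂μ) (fun n => (norm_mul _ _).le))
    simp only [sub_add_cancel, zero_add] at h'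
    convert h' using 2 with n
    simp only [hu]
    rw [inner_toLp, ← hτ.integral_comp (q * n + r) ((h₂.D hτ (q * k)).mul
      ((h₃.D hτ (2 * (q * k))).comp (hτ.meas _)))]
    refine integral_congr_ae (ae_of_all _ fun x => ?_)
    simp only [hf, D, ← hτ.add, map_mul]
    have e1 : (q * ((n + k : ℕ) : ℤ) + r) = q * k + (q * n + r) := by push_cast; ring
    have e2 : (q : ℤ) * n + r + (q * n + r) = 2 * (q * n + r) := by ring
    have e3 : 2 * ((q : ℤ) * k + (q * n + r)) = 2 * (q * k) + (q * n + r + (q * n + r)) := by ring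
    rw [e1, e3, e2]
    ring

end Action

section CompactGroup

variable {Z : Type*} [CommGroup Z] [TopologicalSpace Z] [IsTopologicalGroup Z] [CompactSpace Z]
  [T2Space Z] [SecondCountableTopology Z] [MeasurableSpace Z] [BorelSpace Z]

/-- A continuous character as a continuous complex function. -/
noncomputable def charC (ξ : Z →ₜ* Circle) : C(Z, ℂ) :=
  ⟨fun z => (ξ z : ℂ), continuous_subtype_val.comp ξ.continuous⟩

/-- Continuous characters separate points from the identity. -/
def SepChar (Z : Type*) [CommGroup Z] [TopologicalSpace Z] : Prop :=
  ∀ z : Z, z ≠ 1 → ∃ ξ : Z →ₜ* Circle, ξ z ≠ 1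

theorem conj_circle (c : Circle) : conj (c : ℂ) = ((c⁻¹ : Circle) : ℂ) :=
  (Circle.coe_inv_eq_conj c).symm

/-- The star algebra spanned by the continuous characters. -/
noncomputable def charAlg (Z : Type*) [CommGroup Z] [TopologicalSpace Z] [IsTopologicalGroup Z]
    [CompactSpace Z] : StarSubalgebra ℂ C(Z, ℂ) where
  carrier := Submodule.span ℂ (Set.range (charC (Z := Z)))
  mul_mem' := by
    intro a b ha hb
    have := Submodule.mul_mem_mul ha hb
    rw [Submodule.span_mul_span] at this
    refine Submodule.span_mono ?_ this
    rintro _ ⟨_, ⟨ξ, rfl⟩, _, ⟨ξ', rfl⟩, rfl⟩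
    exact ⟨ξ * ξ', by ext z; simp [charC]⟩
  add_mem' := fun ha hb => Submodule.add_mem _ ha hb
  algebraMap_mem' := by
    intro c
    have : algebraMap ℂ C(Z, ℂ) c = c • charC 1 := by ext z; simp [charC]
    rw [this]
    exact Submodule.smul_mem _ _ (Submodule.subset_span ⟨1, rfl⟩)
  star_mem' := by
    intro a ha
    simp only [SetLike.mem_coe] at ha ⊢
    induction ha using Submodule.span_induction with
    | mem x hx =>
      obtain ⟨ξ, rfl⟩ := hx
      refine Submodule.subset_span ⟨ξ⁻¹, ?_⟩
      ext z
      exact (conj_circle (ξ z)).symm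
    | zero => simp
    | add x y _ _ hx hy => rw [star_add]; exact Submodule.add_mem _ hx hy
    | smul c x _ hx => rw [star_smul]; exact Submodule.smul_mem _ _ hx

theorem exists_span_char_near (hsep : SepChar Z) (η : C(Z, ℂ)) {ε : ℝ} (hε : 0 < ε) :
    ∃ p ∈ Submodule.span ℂ (Set.range (charC (Z := Z))), ‖η - p‖ < ε := by
  have h := ContinuousMap.starSubalgebra_topologicalClosure_eq_top_of_separatesPoints
      (charAlg Z) (by
    intro x y hxy
    obtain ⟨ξ, hξ⟩ := hsep (x * y⁻¹) (by rwa [ne_eq, mul_inv_eq_one])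
    refine ⟨charC ξ, ⟨charC ξ, Submodule.subset_span ⟨ξ, rfl⟩, rfl⟩, fun h => hξ ?_⟩
    rw [map_mul, map_inv, mul_inv_eq_one]
    exact Circle.ext h)
  have h1 : η ∈ closure ((charAlg Z : Set C(Z, ℂ))) := by
    rw [← StarSubalgebra.topologicalClosure_coe, h]; trivial
  obtain ⟨p, hp, hd⟩ := Metric.mem_closure_iff.1 h1 ε hε
  exact ⟨p, hp, by rwa [dist_eq_norm] at hd⟩

theorem ub_weight (hsep : SepChar Z) {b : ℕ → ℂ} {C : ℝ} (hb : ∀ n, ‖b n‖ ≤ C) {z : ℕ → Z}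
    (h : ∀ ξ : Z →ₜ* Circle, UB (fun n => (ξ (z n) : ℂ) * b n) 0) (η : C(Z, ℂ)) :
    UB (fun n => η (z n) * b n) 0 := by
  have hC : 0 ≤ C := (norm_nonneg _).trans (hb 0)
  refine UB.of_approx fun ε hε => ?_
  obtain ⟨p, hp, hd⟩ := exists_span_char_near hsep η (show 0 < ε / (C + 1) by positivity)
  refine ⟨fun n => p (z n) * b n, ?_, fun n => ?_⟩
  · refine UB.mono (c := 0) ?_ (by linarith)
    clear hd
    induction hp using Submodule.span_induction with
    | mem x hx => obtain ⟨ξ, rfl⟩ := hx; exact h ξ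
    | zero => exact UB.of_norm_le fun n => by simp
    | add x y _ _ hx hy =>
      have := hx.add hy
      simpa only [ContinuousMap.add_apply, add_mul, add_zero] using this
    | smul c x _ hx =>
      have := hx.const_mul c
      simpa only [ContinuousMap.smul_apply, smul_eq_mul, mul_zero, mul_assoc] using this
  · rw [← sub_mul, norm_mul]
    have h1 : ‖η (z n) - p (z n)‖ ≤ ε / (C + 1) := ((η - p).norm_coe_le_norm (z n)).trans hd.le
    calc _ ≤ ε / (C + 1) * C := mul_le_mul h1 (hb n) (norm_nonneg _) (by positivity)
      _ ≤ ε := by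
        rw [div_mul_eq_mul_div, div_le_iff₀ (by positivity)]
        nlinarith

variable {m : Measure Z} [IsProbabilityMeasure m] [m.IsMulLeftInvariant]

theorem bd_charC (ξ : Z →ₜ* Circle) : Bd 1 (fun z => (ξ z : ℂ)) :=
  ⟨(charC ξ).continuous.measurable, fun z => (Circle.norm_coe (ξ z)).le⟩

theorem bd_continuous (η : C(Z, ℂ)) : Bd ‖η‖ η := ⟨η.continuous.measurable, η.norm_coe_le_norm⟩

theorem integral_char_eq_zero {ξ : Z →ₜ* Circle} (hξ : ξ ≠ 1) : ∫ z, (ξ z : ℂ) ∂m = 0 := by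
  obtain ⟨w, hw⟩ : ∃ w, ξ w ≠ 1 := by
    by_contra! h
    exact hξ (by ext z; simp [h z])
  have h1 := integral_mul_left_eq_self (μ := m) (fun z => (ξ z : ℂ)) w
  simp only [map_mul, Circle.coe_mul, integral_const_mul] at h1
  have h2 : ((ξ w : ℂ) - 1) * ∫ z, (ξ z : ℂ) ∂m = 0 := by rw [sub_mul, h1]; ring
  rcases mul_eq_zero.1 h2 with h3 | h3
  · exact absurd (Circle.ext (by rw [Circle.coe_one]; exact sub_eq_zero.1 h3)) hw
  · exact h3

theorem ub_geometric {w : Circle} (hw : w ≠ 1) : UB (fun n : ℕ => (w : ℂ) ^ n) 0 := by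
  have hw' : (w : ℂ) - 1 ≠ 0 :=
      fun h => hw (Circle.ext (by rw [Circle.coe_one]; exact sub_eq_zero.1 h))
  have hpos : 0 < ‖(w : ℂ) - 1‖ := norm_pos_iff.2 hw'
  intro ε hε
  refine ⟨⌈2 / ‖(w : ℂ) - 1‖ / ε⌉₊, fun N hN a => ?_⟩
  have hN' : 2 / ‖(w : ℂ) - 1‖ / ε ≤ N := (Nat.le_ceil _).trans (by exact_mod_cast hN)
  simp only [pow_add]
  rw [← Finset.mul_sum, geom_sum_eq (sub_ne_zero.1 hw'), norm_mul, norm_pow, Circle.norm_coe,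
    one_pow, one_mul, norm_div, zero_add]
  refine le_trans ?_ ((div_le_iff₀' hε).1 hN')
  gcongr
  refine (norm_sub_le _ _).trans ?_
  rw [norm_pow, Circle.norm_coe, one_pow, norm_one]; norm_num

theorem equidistribution (hsep : SepChar Z) {β : Z} (hβ : ∀ ξ : Z →ₜ* Circle, ξ ≠ 1 → ξ β ≠ 1)
    (γ : Z) (η : C(Z, ℂ)) : UB (fun n : ℕ => η (β ^ n * γ) - ∫ z, η z ∂m) 0 := by
  have key : ∀ p ∈ Submodule.span ℂ (Set.range (charC (Z := Z))),
      UB (fun n : ℕ => p (β ^ n * γ) - ∫ z, p z ∂m) 0 := by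
    intro p hp
    induction hp using Submodule.span_induction with
    | mem x hx =>
      obtain ⟨ξ, rfl⟩ := hx
      by_cases hξ : ξ = 1
      · subst hξ
        exact UB.of_norm_le fun n => by simp [charC]
      · have h1 : ∫ z, charC ξ z ∂m = 0 := integral_char_eq_zero hξ
        rw [h1]
        have h2 := (ub_geometric (hβ ξ hξ)).const_mul (ξ γ : ℂ)
        rw [mul_zero] at h2
        convert h2 using 2 with n
        simp [charC, mul_comm]
    | zero => exact UB.of_norm_le fun n => by simp
    | add x y _ _ hx hy =>
      have := hx.add hy
      simp only [ContinuousMap.add_apply]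
      rw [integral_add (bd_continuous x).integrable (bd_continuous y).integrable]
      rw [add_zero] at this
      convert this using 2 with n
      ring
    | smul c x _ hx =>
      have := hx.const_mul c
      simp only [ContinuousMap.smul_apply, smul_eq_mul, integral_const_mul]
      rw [mul_zero] at this
      convert this using 2 with n
      ring
  refine UB.of_approx fun ε hε => ?_
  obtain ⟨p, hp, hd⟩ := exists_span_char_near hsep η (show 0 < ε / 2 by positivity)
  refine ⟨_, (key p hp).mono (by linarith), fun n => ?_⟩
  have h1 : ∀ z, ‖η z - p z‖ ≤ ε / 2 := fun z => ((η - p).norm_coe_le_norm z).trans hd.le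
  have h2 : ‖∫ z, (η z - p z) ∂m‖ ≤ ε / 2 := by
    simpa using norm_integral_le_of_norm_le_const (μ := m) (ae_of_all _ h1)
  rw [integral_sub (bd_continuous η).integrable (bd_continuous p).integrable] at h2
  have e : η (β ^ n * γ) - ∫ z, η z ∂m - (p (β ^ n * γ) - ∫ z, p z ∂m) =
    (η (β ^ n * γ) - p (β ^ n * γ)) - (∫ z, η z ∂m - ∫ z, p z ∂m) := by ring
  rw [e]
  refine (norm_sub_le _ _).trans ?_
  linarith [h1 (β ^ n * γ)]

theorem translation_mp (s : Z) : MeasurePreserving (fun z => s * z) m m :=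
  measurePreserving_mul_left m s

/-- Continuity of translations in `L¹`. -/
theorem translation_continuity {C : ℝ} {φ : Z → ℂ} (hφ : Bd C φ) {ε : ℝ} (hε : 0 < ε) :
    ∀ᶠ s in 𝓝 (1 : Z), ∫ z, ‖φ (s * z) - φ z‖ ∂m ≤ ε := by
  obtain ⟨g, -, hg, hgc, hgi⟩ := (hφ.integrable (μ := m)).exists_hasCompactSupport_integral_sub_le
    (show 0 < ε / 3 by positivity)
  have huc : ∀ᶠ s in 𝓝 (1 : Z), ∀ z, ‖g (s * z) - g z‖ ≤ ε / 3 := by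
    have h1 : ∀ z ∈ (Set.univ : Set Z), ∀ᶠ p : Z × Z in 𝓝 (1 : Z) ×ˢ 𝓝 z,
        ‖g (p.1 * p.2) - g p.2‖ < ε / 3 := by
      intro z _
      rw [← nhds_prod_eq]
      have hc : Continuous fun p : Z × Z => ‖g (p.1 * p.2) - g p.2‖ := by fun_prop
      refine hc.continuousAt.eventually_lt_const ?_
      simpa using (by positivity : 0 < ε / 3)
    have h2 := isCompact_univ.eventually_forall_of_forall_eventually (x₀ := (1 : Z))
      (P := fun s z => ‖g (s * z) - g z‖ < ε / 3) (fun z hz => by rw [nhds_prod_eq]; exact h1 z hz)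
    filter_upwards [h2] with s hs z
    exact (hs z trivial).le
  filter_upwards [huc] with s hs
  have hi1 : Integrable (fun z => φ (s * z)) m := (hφ.comp (measurable_const_mul s)).integrable
  have hi2 : Integrable (fun z => g (s * z)) m :=
      (translation_mp s).integrable_comp_of_integrable hgi
  have hi := hφ.integrable (μ := m)
  calc ∫ z, ‖φ (s * z) - φ z‖ ∂m
      ≤ ∫ z, (‖φ (s * z) - g (s * z)‖ + ‖φ z - g z‖ + ‖g (s * z) - g z‖) ∂m := by
        refine integral_mono (hi1.sub hi).norm (((hi1.sub hi2).norm.add (hi.sub hgi).norm).add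
          (hi2.sub hgi).norm) fun z => ?_
        have : φ (s * z) - φ z = (φ (s * z) - g (s * z)) - (φ z - g z) + (g (s * z) - g z) :=
            by ring
        simp only
        rw [this]
        exact (norm_add_le _ _).trans (add_le_add (norm_sub_le _ _) le_rfl)
    _ = ∫ z, ‖φ (s * z) - g (s * z)‖ ∂m + ∫ z, ‖φ z - g z‖ ∂m + ∫ z, ‖g (s * z) - g z‖ ∂m := by
        have j1 : Integrable (fun z => ‖φ (s * z) - g (s * z)‖) m := (hi1.sub hi2).norm
        have j2 : Integrable (fun z => ‖φ z - g z‖) m := (hi.sub hgi).norm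
        have j3 : Integrable (fun z => ‖g (s * z) - g z‖) m := (hi2.sub hgi).norm
        have j12 : Integrable (fun z => ‖φ (s * z) - g (s * z)‖ + ‖φ z - g z‖) m := j1.add j2
        rw [integral_add j12 j3, integral_add j1 j2]
    _ ≤ ε / 3 + ε / 3 + ε / 3 := by
        refine add_le_add (add_le_add ?_ hg) ?_
        · rw [integral_mul_left_eq_self (fun z => ‖φ z - g z‖) s]; exact hg
        · calc _ ≤ ∫ z, ε / 3 ∂m := integral_mono (hi2.sub hgi).norm (integrable_const _) hs
            _ = ε / 3 := by simp
    _ = ε := by ring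

/-- The autocorrelation function of `φ`. -/
noncomputable def autoCorr (m : Measure Z) (φ : Z → ℂ) (s : Z) : ℂ := ∫ z, φ (s * z) * conj (φ z) ∂m

theorem norm_autoCorr_le {φ : Z → ℂ} (hφ : Bd 1 φ) (s : Z) : ‖autoCorr m φ s‖ ≤ 1 :=
  ((hφ.comp (measurable_const_mul s)).mul hφ.conj).norm_integral_le

theorem continuous_autoCorr {φ : Z → ℂ} (hφ : Bd 1 φ) : Continuous (autoCorr m φ) := by
  refine continuous_iff_continuousAt.2 fun s₀ => ?_
  rw [ContinuousAt, Metric.tendsto_nhds]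
  intro ε hε
  have h1 : Tendsto (fun s : Z => s * s₀⁻¹) (𝓝 s₀) (𝓝 1) := by
    have : Continuous fun s : Z => s * s₀⁻¹ := by fun_prop
    simpa using this.tendsto s₀
  filter_upwards [h1.eventually (translation_continuity (m := m) hφ (half_pos hε))] with s hs
  have hB : ∀ s : Z, Bd 1 (fun z => φ (s * z) * conj (φ z)) := fun s =>
    (hφ.comp (measurable_const_mul s)).mul hφ.conj
  rw [dist_eq_norm, autoCorr, autoCorr, ← integral_sub (hB s).integrable (hB s₀).integrable]
  refine (norm_integral_le_integral_norm _).trans_lt (lt_of_le_of_lt ?_ (half_lt_self hε))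
  refine le_trans ?_ hs
  rw [← integral_mul_left_eq_self (μ := m) (fun z => ‖φ (s * s₀⁻¹ * z) - φ z‖) s₀]
  refine integral_mono ((hB s).integrable.sub (hB s₀).integrable).norm
    (((hφ.comp (measurable_const_mul _)).sub hφ).comp (measurable_const_mul s₀)).integrable.norm
    fun z => ?_
  simp only [inv_mul_cancel_right, ← mul_assoc]
  rw [← sub_mul, norm_mul, RCLike.norm_conj]
  exact mul_le_of_le_one_right (norm_nonneg _) (hφ.bdd z)

/-- The `L²` mass of the autocorrelation function. -/
noncomputable def autoMass (m : Measure Z) (φ : Z → ℂ) : ℝ := ∫ s, ‖autoCorr m φ s‖ ^ 2 ∂m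

theorem autoMass_nonneg (φ : Z → ℂ) : 0 ≤ autoMass m φ := integral_nonneg fun _ => by positivity

theorem tendsto_avg_autoCorr (hsep : SepChar Z) {β : Z}
    (hβ : ∀ ξ : Z →ₜ* Circle, ξ ≠ 1 → ξ β ≠ 1) {φ : Z → ℂ} (hφ : Bd 1 φ) :
    ∀ ε > 0, ∀ᶠ N : ℕ in atTop,
      (∑ n ∈ Finset.range N, ‖autoCorr m φ (β ^ n)‖ ^ 2) / N ≤ autoMass m φ + ε := by
  intro ε hε
  set η : C(Z, ℂ) := ⟨fun s => ((‖autoCorr m φ s‖ ^ 2 : ℝ) : ℂ), by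
    have := continuous_autoCorr (m := m) hφ
    fun_prop⟩ with hη
  obtain ⟨N₀, h⟩ := equidistribution (m := m) hsep hβ 1 η ε hε
  filter_upwards [eventually_ge_atTop N₀, eventually_gt_atTop 0] with N hN hN0
  have h1 := h N hN 0
  have hN0' : (0 : ℝ) < N := by exact_mod_cast hN0
  simp only [hη, ContinuousMap.coe_mk, mul_one, zero_add, integral_complex_ofReal] at h1
  rw [div_le_iff₀ hN0']
  have h2 : ∑ n ∈ Finset.range N, (((‖autoCorr m φ (β ^ n)‖ ^ 2 : ℝ) : ℂ) -
      ((∫ s, ‖autoCorr m φ s‖ ^ 2 ∂m : ℝ) : ℂ)) =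
      ((∑ n ∈ Finset.range N, ‖autoCorr m φ (β ^ n)‖ ^ 2 - N * autoMass m φ : ℝ) : ℂ) := by
    simp [Finset.sum_sub_distrib, autoMass]
  rw [h2, Complex.norm_real] at h1
  have := (le_abs_self _).trans h1
  linarith

end CompactGroup

open ProbabilityTheory

section Kronecker

variable {X : Type*} [MeasurableSpace X] {μ : Measure X} [IsProbabilityMeasure μ]
  {Z : Type*} [CommGroup Z] [TopologicalSpace Z] [IsTopologicalGroup Z] [CompactSpace Z]
  [T2Space Z] [SecondCountableTopology Z] [MeasurableSpace Z] [BorelSpace Z]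
  {m : Measure Z} [IsProbabilityMeasure m] [m.IsMulLeftInvariant]
  {τ : ℤ → X → X} {q : ℕ} {π : X → Z} {α : Z} {κ : Kernel Z X} [IsMarkovKernel κ]

/-- Fibre averages of a function with respect to a disintegration. -/
noncomputable def CE (κ : Kernel Z X) (F : X → ℂ) (z : Z) : ℂ := ∫ x, F x ∂(κ z)

/-- A compact group rotation factor of an action, with disintegration `κ`, which is characteristic
for weak mixing. -/
structure Kron (τ : ℤ → X → X) (μ : Measure X) (q : ℕ) (π : X → Z) (m : Measure Z) (α : Z)
    (κ : Kernel Z X) : Prop extends ZAct τ μ where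
  qpos : 0 < q
  erg : Ergodic (τ q) μ
  sep : SepChar Z
  pi : MeasurePreserving π μ m
  rot : ∀ᵐ x ∂μ, π (τ 1 x) = α * π x
  disint : μ.map (fun x => (π x, x)) = m ⊗ₘ κ
  weak : ∀ F : X → ℂ, Bd 1 F → (∀ᵐ z ∂m, CE κ F z = 0) →
    CesN (fun n => ‖∫ x, D τ n F x ∂μ‖ ^ 2)

theorem Bd.CE {C : ℝ} {F : X → ℂ} (hF : Bd C F) : Bd C (CE κ F) :=
  ⟨(StronglyMeasurable.integral_kernel hF.meas.stronglyMeasurable).measurable, fun _ =>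
    hF.norm_integral_le⟩

theorem CE_conj (F : X → ℂ) (z : Z) : CE κ (fun x => conj (F x)) z = conj (CE κ F z) :=
  integral_conj

theorem Kron.rot_pow (hK : Kron τ μ q π m α κ) (n : ℤ) : ∀ᵐ x ∂μ, π (τ n x) = α ^ n * π x := by
  have hnat : ∀ n : ℕ, ∀ᵐ x ∂μ, π (τ n x) = α ^ n * π x := by
    intro n
    induction n with
    | zero => simp [hK.zero]
    | succ n ih =>
      filter_upwards [ih, (hK.mp n).quasiMeasurePreserving.ae hK.rot] with x h1 h2
      have : ((n + 1 : ℕ) : ℤ) = 1 + n := by push_cast; ring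
      rw [this, hK.add, h2, h1, pow_succ', mul_assoc]
  obtain ⟨k, rfl | rfl⟩ := n.eq_nat_or_neg
  · simpa using hnat k
  · filter_upwards [(hK.mp (-k)).quasiMeasurePreserving.ae (hnat k)] with x h
    rw [← hK.add, add_neg_cancel, hK.zero] at h
    rw [h, zpow_neg, zpow_natCast, inv_mul_cancel_left]

theorem Kron.integral_disint (hK : Kron τ μ q π m α κ) {C : ℝ} {h : Z × X → ℂ} (hh : Bd C h) :
    ∫ x, h (π x, x) ∂μ = ∫ z, ∫ x, h (z, x) ∂(κ z) ∂m := by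
  have hm : Measurable fun x => (π x, x) := hK.pi.measurable.prodMk measurable_id
  rw [← Measure.integral_compProd hh.integrable, ← hK.disint,
    integral_map hm.aemeasurable hh.meas.aestronglyMeasurable]

theorem Kron.ae_fiber (hK : Kron τ μ q π m α κ) : ∀ᵐ z ∂m, ∀ᵐ x ∂(κ z), π x = z := by
  refine Measure.ae_ae_of_ae_compProd (p := fun p : Z × X => π p.2 = p.1) ?_
  have hm : Measurable fun x => (π x, x) := hK.pi.measurable.prodMk measurable_id
  have hs : MeasurableSet {p : Z × X | π p.2 = p.1} :=
    measurableSet_eq_fun (hK.pi.measurable.comp measurable_snd) measurable_fst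
  rw [← hK.disint]
  exact (ae_map_iff hm.aemeasurable hs).2 (ae_of_all _ fun x => rfl)

theorem Kron.ae_disint (hK : Kron τ μ q π m α κ) {p : X → Prop} (hp : ∀ᵐ x ∂μ, p x) :
    ∀ᵐ z ∂m, ∀ᵐ x ∂(κ z), p x := by
  obtain ⟨s, hs, hsm, hs0⟩ := exists_measurable_superset_of_null hp
  refine Measure.ae_ae_of_ae_compProd (p := fun w : Z × X => p w.2) ?_
  have hm : Measurable fun x => (π x, x) := hK.pi.measurable.prodMk measurable_id
  have : ∀ᵐ w ∂(m ⊗ₘ κ), w.2 ∉ s := by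
    have hs' : MeasurableSet {w : Z × X | w.2 ∉ s} := measurable_snd hsm.compl
    rw [← hK.disint]
    exact (ae_map_iff hm.aemeasurable hs').2 (measure_eq_zero_iff_ae_notMem.1 hs0)
  filter_upwards [this] with w hw
  by_contra h
  exact hw (hs h)

theorem Kron.integral_pi_mul (hK : Kron τ μ q π m α κ) {C C' : ℝ} {φ : Z → ℂ} (hφ : Bd C φ)
    {F : X → ℂ} (hF : Bd C' F) : ∫ x, φ (π x) * F x ∂μ = ∫ z, φ z * CE κ F z ∂m := by
  have h : Bd (C * C') (fun p : Z × X => φ p.1 * F p.2) :=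
    (hφ.comp measurable_fst).gmul (hF.comp measurable_snd)
  rw [hK.integral_disint h]
  simp only [integral_const_mul, CE]

theorem Kron.integral_CE (hK : Kron τ μ q π m α κ) {C : ℝ}
    {F : X → ℂ} (hF : Bd C F) : ∫ z, CE κ F z ∂m = ∫ x, F x ∂μ := by
  simpa using (hK.integral_pi_mul Bd.one hF).symm

theorem Kron.CE_pi_mul (hK : Kron τ μ q π m α κ) (φ : Z → ℂ) (F : X → ℂ) :
    ∀ᵐ z ∂m, CE κ (fun x => φ (π x) * F x) z = φ z * CE κ F z := by
  filter_upwards [hK.ae_fiber] with z hz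
  rw [CE, CE, ← integral_const_mul]
  refine integral_congr_ae ?_
  filter_upwards [hz] with x hx
  rw [hx]

theorem Kron.CE_pi (hK : Kron τ μ q π m α κ) (φ : Z → ℂ) :
    ∀ᵐ z ∂m, CE κ (fun x => φ (π x)) z = φ z := by
  filter_upwards [hK.CE_pi_mul φ (fun _ => 1)] with z hz
  simpa [CE] using hz

theorem Kron.CE_congr (hK : Kron τ μ q π m α κ) {F G : X → ℂ} (h : F =ᵐ[μ] G) :
    CE κ F =ᵐ[m] CE κ G := by
  filter_upwards [hK.ae_disint h] with z hz
  exact integral_congr_ae hz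

theorem Kron.CE_sub_self (hK : Kron τ μ q π m α κ) {C : ℝ} {F : X → ℂ} (hF : Bd C F) :
    ∀ᵐ z ∂m, CE κ (fun x => F x - CE κ F (π x)) z = 0 := by
  filter_upwards [hK.CE_pi (CE κ F)] with z hz
  have h1 : Integrable (fun x => CE κ F (π x)) (κ z) :=
    (hF.CE.comp hK.pi.measurable).integrable
  rw [CE, integral_sub hF.integrable h1]
  change CE κ F z - CE κ _ z = 0
  rw [hz, sub_self]

theorem Kron.char_ne (hK : Kron τ μ q π m α κ) {ξ : Z →ₜ* Circle} (hξ : ξ ≠ 1) :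
    ξ (α ^ q) ≠ 1 := by
  intro h
  have h1 : (fun x => (ξ (π x) : ℂ)) ∘ τ q =ᵐ[μ] fun x => (ξ (π x) : ℂ) := by
    filter_upwards [hK.rot_pow q] with x hx
    rw [zpow_natCast] at hx
    simp only [Function.comp, hx, map_mul ξ, h, one_mul]
  obtain ⟨c, hc⟩ := hK.erg.ae_eq_const_of_ae_eq_comp_ae
    ((bd_charC ξ).comp hK.pi.measurable).meas.aestronglyMeasurable h1
  have h2 : ∫ x, (ξ (π x) : ℂ) ∂μ = 0 := by
    rw [integral_comp_mp hK.pi (bd_charC ξ), integral_char_eq_zero hξ]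
  rw [integral_congr_ae hc] at h2
  simp only [Function.const_apply, integral_const, probReal_univ, one_smul] at h2
  obtain ⟨x, hx⟩ := hc.exists
  have hx' : (ξ (π x) : ℂ) = c := hx
  have : ‖c‖ = 1 := by rw [← hx']; exact Circle.norm_coe _
  rw [h2, norm_zero] at this
  exact zero_ne_one this

theorem Kron.char_ne' (hK : Kron τ μ q π m α κ) {ξ : Z →ₜ* Circle} (hξ : ξ ≠ 1) :
    ξ α ≠ 1 := fun h => hK.char_ne hξ (by rw [map_pow, h, one_pow])

theorem Kron.norm_integral_D_sq_le (hK : Kron τ μ q π m α κ) {F : X → ℂ} (hF : Bd 1 F) (n : ℕ) :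
    ‖∫ x, D τ n F x ∂μ‖ ^ 2 ≤ 2 * ‖autoCorr m (CE κ F) (α ^ n)‖ ^ 2 +
      2 * ‖∫ x, D τ n (fun x => F x - CE κ F (π x)) x ∂μ‖ ^ 2 := by
  set φ := CE κ F with hφ
  have hφB : Bd 1 φ := hF.CE
  have hφπ := hφB.comp hK.pi.measurable
  have hF0 := hF.sub hφπ
  have hCE0 := hK.CE_sub_self hF
  rw [← hφ] at hCE0
  set F0 : X → ℂ := fun x => F x - φ (π x) with hF0d
  have hzero : ∀ ψ : Z → ℂ, Bd 1 ψ → ∫ x, ψ (π x) * F0 x ∂μ = 0 := by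
    intro ψ hψ
    rw [hK.integral_pi_mul hψ hF0]
    refine (integral_congr_ae ?_).trans (integral_zero _ _)
    filter_upwards [hCE0] with z hz
    rw [hz, mul_zero]
  have hm : ∀ n : ℤ, Bd 1 (fun z => φ (α ^ n * z)) := fun n => hφB.comp (measurable_const_mul _)
  have c1 : ∫ x, φ (π (τ n x)) * conj (F0 x) ∂μ = 0 := by
    have h := hzero _ (hm n).conj
    have h2 := congrArg conj h
    rw [← integral_conj, map_zero] at h2
    rw [← h2]
    refine integral_congr_ae ?_
    filter_upwards [hK.rot_pow n] with x hx
    rw [hx]; simp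
  have c2 : ∫ x, F0 (τ n x) * conj (φ (π x)) ∂μ = 0 := by
    have h := hzero _ (hm (-n)).conj
    rw [← hK.integral_comp n (((hm (-n)).conj.comp hK.pi.measurable).gmul hF0)] at h
    rw [← h]
    refine integral_congr_ae ?_
    filter_upwards [hK.rot_pow n] with x hx
    rw [hx, zpow_neg, inv_mul_cancel_left, mul_comm]
  have c3 : ∫ x, φ (π (τ n x)) * conj (φ (π x)) ∂μ = autoCorr m φ (α ^ n) := by
    rw [autoCorr, ← integral_comp_mp hK.pi ((hφB.comp (measurable_const_mul _)).mul hφB.conj)]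
    refine integral_congr_ae ?_
    filter_upwards [hK.rot_pow n] with x hx
    rw [hx, zpow_natCast]
  have e : ∫ x, D τ n F x ∂μ = autoCorr m φ (α ^ n) + ∫ x, D τ n F0 x ∂μ := by
    have e1 : ∀ x, D τ n F x = φ (π (τ n x)) * conj (φ (π x)) + φ (π (τ n x)) * conj (F0 x) +
        F0 (τ n x) * conj (φ (π x)) + D τ n F0 x := by
      intro x
      simp only [D, hF0d, map_sub]; ring
    simp only [e1]
    have i1 := ((hφπ.comp (hK.meas n)).gmul hφπ.conj).integrable (μ := μ)
    have i2 := ((hφπ.comp (hK.meas n)).gmul hF0.conj).integrable (μ := μ)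
    have i3 := ((hF0.comp (hK.meas n)).gmul hφπ.conj).integrable (μ := μ)
    have i4 : Integrable (fun x => D τ n F0 x) μ :=
      ((hF0.comp (hK.meas n)).gmul hF0.conj).integrable (μ := μ)
    have i12 : Integrable (fun x => φ (π (τ n x)) * conj (φ (π x)) +
      φ (π (τ n x)) * conj (F0 x)) μ := i1.add i2
    have i123 : Integrable (fun x => φ (π (τ n x)) * conj (φ (π x)) +
      φ (π (τ n x)) * conj (F0 x) + F0 (τ n x) * conj (φ (π x))) μ := i12.add i3
    rw [integral_add i123 i4, integral_add i12 i3, integral_add i1 i2, c1, c2, c3,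
      add_zero, add_zero]
  rw [e]
  have := norm_add_le (autoCorr m φ (α ^ n)) (∫ x, D τ n F0 x ∂μ)
  have h0 := norm_nonneg (autoCorr m φ (α ^ n) + ∫ x, D τ n F0 x ∂μ)
  nlinarith [sq_nonneg (‖autoCorr m φ (α ^ n)‖ - ‖∫ x, D τ n F0 x ∂μ‖)]

theorem Kron.weak' (hK : Kron τ μ q π m α κ) {C : ℝ} (hC : 0 < C) {F : X → ℂ} (hF : Bd C F)
    (h : ∀ᵐ z ∂m, CE κ F z = 0) : CesN (fun n => ‖∫ x, D τ n F x ∂μ‖ ^ 2) := by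
  have h1 : Bd 1 (fun x => (C : ℂ)⁻¹ * F x) := (hF.const_mul (C : ℂ)⁻¹).mono (by
    rw [norm_inv, Complex.norm_real, Real.norm_of_nonneg hC.le, inv_mul_cancel₀ hC.ne'])
  have h2 := (hK.weak _ h1 (by
    filter_upwards [h] with z hz
    rw [CE, integral_const_mul]
    exact mul_eq_zero_of_right _ hz)).const_mul (C ^ 4)
  refine h2.mono (fun n => by positivity) fun n => le_of_eq ?_
  have : ∀ x, D τ n (fun x => (C : ℂ)⁻¹ * F x) x = ((C : ℂ)⁻¹) ^ 2 * D τ n F x := by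
    intro x
    simp only [D, map_mul, map_inv₀, Complex.conj_ofReal]; ring
  simp only [this]
  rw [integral_const_mul, norm_mul, norm_pow, norm_inv, Complex.norm_real,
    Real.norm_of_nonneg hC.le]
  field_simp

theorem Kron.avg_D_sq_le (hK : Kron τ μ q π m α κ) {F : X → ℂ} (hF : Bd 1 F) :
    ∀ ε > 0, ∀ᶠ N : ℕ in atTop, (∑ n ∈ Finset.range N, ‖∫ x, D τ n F x ∂μ‖ ^ 2) / N
      ≤ 2 * autoMass m (CE κ F) + ε := by
  intro ε hε
  have h1 := tendsto_avg_autoCorr (m := m) hK.sep (fun ξ hξ => hK.char_ne' hξ)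
    (hF.CE (κ := κ)) (ε / 4) (by positivity)
  have h2 := hK.weak' (by norm_num : (0 : ℝ) < 1 + 1) (hF.sub (hF.CE.comp hK.pi.measurable))
    (hK.CE_sub_self hF)
  filter_upwards [h1, h2.eventually_lt_const (show (0 : ℝ) < ε / 4 by positivity)] with N h1 h2
  have h3 := Finset.sum_le_sum fun n (_ : n ∈ Finset.range N) => hK.norm_integral_D_sq_le hF n
  rw [Finset.sum_add_distrib, ← Finset.mul_sum, ← Finset.mul_sum] at h3
  calc _ ≤ (2 * ∑ n ∈ Finset.range N, ‖autoCorr m (CE κ F) (α ^ n)‖ ^ 2 + 2 *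
        ∑ n ∈ Finset.range N, ‖∫ x, D τ n (fun x => F x - CE κ F (π x)) x ∂μ‖ ^ 2) / N := by gcongr
    _ ≤ _ := by
      rw [add_div, mul_div_assoc, mul_div_assoc]
      linarith

end Kronecker

section Kronecker

variable {X : Type*} [MeasurableSpace X] {μ : Measure X} [IsProbabilityMeasure μ]
  {Z : Type*} [CommGroup Z] [TopologicalSpace Z] [IsTopologicalGroup Z] [CompactSpace Z]
  [T2Space Z] [SecondCountableTopology Z] [MeasurableSpace Z] [BorelSpace Z]
  {m : Measure Z} [IsProbabilityMeasure m] [m.IsMulLeftInvariant]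
  {τ : ℤ → X → X} {q : ℕ} {π : X → Z} {α : Z} {κ : Kernel Z X} [IsMarkovKernel κ]

/-- Three term correlation along an action. -/
noncomputable def corr3 (τ : ℤ → X → X) (μ : Measure X) (F₁ F₂ F₃ : X → ℂ) (j : ℤ) : ℂ :=
  ∫ x, F₁ x * F₂ (τ j x) * F₃ (τ (2 * j) x) ∂μ

/-- Four term correlation along an action. -/
noncomputable def corr4 (τ : ℤ → X → X) (μ : Measure X) (F₀ F₁ F₂ F₃ : X → ℂ) (j : ℤ) : ℂ :=
  ∫ x, F₀ x * F₁ (τ j x) * F₂ (τ (2 * j) x) * F₃ (τ (3 * j) x) ∂μ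

theorem Kron.norm_corr3_le (hK : Kron τ μ q π m α κ) {F₁ F₂ F₃ : X → ℂ} (h₁ : Bd 1 F₁)
    (h₂ : Bd 1 F₂) (h₃ : Bd 1 F₃) (j : ℤ) : ‖corr3 τ μ F₁ F₂ F₃ j‖ ≤ 1 :=
  ((h₁.mul (h₂.comp (hK.meas _))).mul (h₃.comp (hK.meas _))).norm_integral_le

theorem Kron.norm_corr4_le (hK : Kron τ μ q π m α κ) {F₀ F₁ F₂ F₃ : X → ℂ} (h₀ : Bd 1 F₀)
    (h₁ : Bd 1 F₁) (h₂ : Bd 1 F₂) (h₃ : Bd 1 F₃) (j : ℤ) : ‖corr4 τ μ F₀ F₁ F₂ F₃ j‖ ≤ 1 :=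
  (((h₀.mul (h₁.comp (hK.meas _))).mul (h₂.comp (hK.meas _))).mul
    (h₃.comp (hK.meas _))).norm_integral_le

theorem Kron.norm_integral_D_le (hK : Kron τ μ q π m α κ) {F : X → ℂ} (hF : Bd 1 F) (j : ℤ) :
    ‖∫ x, D τ j F x ∂μ‖ ≤ 1 := (hF.D hK.toZAct j).norm_integral_le

theorem Kron.ub_corr3_autoMass (hK : Kron τ μ q π m α κ) (r : ℤ) {F₁ F₂ F₃ : X → ℂ} (h₁ : Bd 1 F₁)
    (h₂ : Bd 1 F₂) (h₃ : Bd 1 F₃) :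
    UB (fun n : ℕ => corr3 τ μ F₁ F₂ F₃ (q * n + r))
      (√(2 * √(4 * q * autoMass m (CE κ F₃)))) := by
  refine hK.ub_triple hK.erg r h₁ h₂ h₃ fun ε hε => ?_
  have hq : (0 : ℝ) < q := by exact_mod_cast hK.qpos
  have h := hK.avg_D_sq_le h₃ (ε ^ 2 / (2 * q)) (by positivity)
  have hid : Tendsto (fun K : ℕ => 2 * q * K) atTop atTop :=
    tendsto_id.const_mul_atTop' (by have := hK.qpos; omega)
  filter_upwards [hid.eventually h, eventually_gt_atTop 0] with K hN hK0
  have hK0' : (0 : ℝ) < K := by exact_mod_cast hK0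
  set b : ℕ → ℝ := fun n => ‖∫ x, D τ n F₃ x ∂μ‖ with hb
  have hle : ∑ k ∈ Finset.range K, ‖∫ x, D τ (q * k) F₂ x ∂μ‖ *
      ‖∫ x, D τ (2 * (q * k)) F₃ x ∂μ‖ ≤ ∑ k ∈ Finset.range K, b (2 * q * k) := by
    refine Finset.sum_le_sum fun k _ => ?_
    have : b (2 * q * k) = ‖∫ x, D τ (2 * (q * k)) F₃ x ∂μ‖ := by
      simp only [hb]; congr 3; push_cast; ring_nf
    rw [this]
    exact mul_le_of_le_one_left (norm_nonneg _) (hK.norm_integral_D_le h₂ _)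
  have hcs : (∑ k ∈ Finset.range K, b (2 * q * k)) ^ 2 ≤
      K * ∑ k ∈ Finset.range K, b (2 * q * k) ^ 2 := by
    simpa using sq_sum_le_card_mul_sum_sq (s := Finset.range K) (f := fun k => b (2 * q * k))
  have hsub : ∑ k ∈ Finset.range K, b (2 * q * k) ^ 2 ≤
      ∑ n ∈ Finset.range (2 * q * K), b n ^ 2 := by
    have hqp := hK.qpos
    have hinj : Set.InjOn (fun k => 2 * q * k) (Finset.range K : Set ℕ) := fun a _ c _ h =>
      Nat.eq_of_mul_eq_mul_left (by omega : 0 < 2 * q) h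
    rw [← Finset.sum_image (f := fun n => b n ^ 2) hinj]
    refine Finset.sum_le_sum_of_subset_of_nonneg (fun n hn => ?_) fun _ _ _ => by positivity
    obtain ⟨k, hk, rfl⟩ := Finset.mem_image.1 hn
    exact Finset.mem_range.2 (Nat.mul_lt_mul_of_pos_left (Finset.mem_range.1 hk) (by omega))
  have hcast : ((2 * q * K : ℕ) : ℝ) = 2 * q * K := by push_cast; ring
  rw [hcast, div_le_iff₀ (by positivity)] at hN
  set W := autoMass m (CE κ F₃) with hW
  have hW0 : 0 ≤ W := autoMass_nonneg _
  set S := ∑ k ∈ Finset.range K, b (2 * q * k) with hS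
  have hS0 : 0 ≤ S := Finset.sum_nonneg fun _ _ => norm_nonneg _
  have hfin : (S / K) ^ 2 ≤ 4 * q * W + ε ^ 2 := by
    rw [div_pow, div_le_iff₀ (by positivity)]
    calc S ^ 2 ≤ K * ((2 * W + ε ^ 2 / (2 * q)) * (2 * q * K)) :=
          hcs.trans (mul_le_mul_of_nonneg_left (hsub.trans hN) hK0'.le)
      _ = _ := by field_simp; ring
  have h5 : S / K ≤ √(4 * q * W) + ε := by
    refine abs_le_of_sq_le_sq' (hfin.trans ?_) (by positivity) |>.2
    have := Real.sq_sqrt (show 0 ≤ 4 * q * W by positivity)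
    nlinarith [Real.sqrt_nonneg (4 * q * W)]
  exact (div_le_div_of_nonneg_right hle hK0'.le).trans h5

theorem Kron.ub_corr3_zero_right (hK : Kron τ μ q π m α κ) (r : ℤ) {F₁ F₂ F₃ : X → ℂ}
    (h₁ : Bd 1 F₁) (h₂ : Bd 1 F₂) (h₃ : Bd 1 F₃) (h : ∀ᵐ z ∂m, CE κ F₃ z = 0) :
    UB (fun n : ℕ => corr3 τ μ F₁ F₂ F₃ (q * n + r)) 0 := by
  have h1 := hK.ub_corr3_autoMass r h₁ h₂ h₃
  have h2 : autoMass m (CE κ F₃) = 0 := by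
    have : ∀ s, autoCorr m (CE κ F₃) s = 0 := fun s => by
      rw [autoCorr, ← integral_zero Z ℂ (μ := m)]
      refine integral_congr_ae ?_
      filter_upwards [h] with z hz
      rw [hz, map_zero, mul_zero]
    simp [autoMass, this]
  simpa [h2] using h1

theorem Kron.ub_corr3_zero_mid (hK : Kron τ μ q π m α κ) (r : ℤ) {F₁ F₂ F₃ : X → ℂ}
    (h₁ : Bd 1 F₁) (h₂ : Bd 1 F₂) (h₃ : Bd 1 F₃) (h : ∀ᵐ z ∂m, CE κ F₂ z = 0) :
    UB (fun n : ℕ => corr3 τ μ F₁ F₂ F₃ (q * n + r)) 0 := by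
  have h1 := ((hK.weak _ h₂ h).of_sq fun n => norm_nonneg _).mul_index (fun n => norm_nonneg _)
    hK.qpos
  have h2 := hK.ub_triple hK.erg r h₁ h₂ h₃ (w := 0) fun ε hε => ?_
  · simpa [corr3] using h2
  filter_upwards [h1.eventually_lt_const (show 0 < 0 + ε by linarith)] with K hK'
  refine le_trans (div_le_div_of_nonneg_right (Finset.sum_le_sum fun k _ => ?_) (by positivity))
    hK'.le
  push_cast
  exact mul_le_of_le_one_right (norm_nonneg _) (hK.norm_integral_D_le h₃ _)

theorem char_mul_conj (ξ : Z →ₜ* Circle) (a z : Z) :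
    (ξ (a * z) : ℂ) * conj (ξ z : ℂ) = (ξ a : ℂ) := by
  rw [conj_circle, ← Circle.coe_mul, map_mul ξ, mul_inv_cancel_right]

theorem Kron.bd_char (hK : Kron τ μ q π m α κ) (ξ : Z →ₜ* Circle) :
    Bd 1 (fun x => (ξ (π x) : ℂ)) := (bd_charC ξ).comp hK.pi.measurable

theorem Kron.char_mul_corr3 (hK : Kron τ μ q π m α κ) (ξ : Z →ₜ* Circle) (F₁ F₂ F₃ : X → ℂ)
    (j : ℤ) : (ξ (α ^ j) : ℂ) * corr3 τ μ F₁ F₂ F₃ j =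
      corr3 τ μ (fun x => conj (ξ (π x) : ℂ) * F₁ x) (fun x => (ξ (π x) : ℂ) * F₂ x) F₃ j := by
  rw [corr3, corr3, ← integral_const_mul]
  refine integral_congr_ae ?_
  filter_upwards [hK.rot_pow j] with x hx
  rw [← char_mul_conj ξ (α ^ j) (π x), ← hx]
  ring

theorem Kron.char_mul_corr4 (hK : Kron τ μ q π m α κ) (ξ : Z →ₜ* Circle) (F₀ F₁ F₂ F₃ : X → ℂ)
    (j : ℤ) : (ξ (α ^ j) : ℂ) * corr4 τ μ F₀ F₁ F₂ F₃ j =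
      corr4 τ μ (fun x => conj (ξ (π x) : ℂ) * F₀ x) (fun x => (ξ (π x) : ℂ) * F₁ x) F₂ F₃ j := by
  rw [corr4, corr4, ← integral_const_mul]
  refine integral_congr_ae ?_
  filter_upwards [hK.rot_pow j] with x hx
  rw [← char_mul_conj ξ (α ^ j) (π x), ← hx]
  ring

theorem Kron.ub_weight_corr3_mid (hK : Kron τ μ q π m α κ) (r : ℤ) (η : C(Z, ℂ)) {F₁ F₂ F₃ : X → ℂ}
    (h₁ : Bd 1 F₁) (h₂ : Bd 1 F₂) (h₃ : Bd 1 F₃) (h : ∀ᵐ z ∂m, CE κ F₂ z = 0) :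
    UB (fun n : ℕ => η (α ^ ((q : ℤ) * n + r)) * corr3 τ μ F₁ F₂ F₃ (q * n + r)) 0 := by
  refine ub_weight hK.sep (C := 1) (fun n => hK.norm_corr3_le h₁ h₂ h₃ _) (fun ξ => ?_) η
  simp only [hK.char_mul_corr3]
  refine hK.ub_corr3_zero_mid r ((hK.bd_char ξ).conj.mul h₁) ((hK.bd_char ξ).mul h₂) h₃ ?_
  filter_upwards [h, hK.CE_pi_mul (fun z => (ξ z : ℂ)) F₂] with z h1 h2
  rw [h2, h1, mul_zero]

theorem Kron.ub_weight_corr3_right (hK : Kron τ μ q π m α κ) (r : ℤ) (η : C(Z, ℂ))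
    {F₁ F₂ F₃ : X → ℂ}
    (h₁ : Bd 1 F₁) (h₂ : Bd 1 F₂) (h₃ : Bd 1 F₃) (h : ∀ᵐ z ∂m, CE κ F₃ z = 0) :
    UB (fun n : ℕ => η (α ^ ((q : ℤ) * n + r)) * corr3 τ μ F₁ F₂ F₃ (q * n + r)) 0 := by
  refine ub_weight hK.sep (C := 1) (fun n => hK.norm_corr3_le h₁ h₂ h₃ _) (fun ξ => ?_) η
  simp only [hK.char_mul_corr3]
  exact hK.ub_corr3_zero_right r ((hK.bd_char ξ).conj.mul h₁) ((hK.bd_char ξ).mul h₂) h₃ h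

/-- Conditional uniformity relative to the rotation factor. -/
def Unif (τ : ℤ → X → X) (m : Measure Z) (κ : Kernel Z X) (g : X → ℂ) : Prop :=
  CesN fun k => autoMass m (CE κ (D τ k g))

theorem Kron.ub_corr4_zero (hK : Kron τ μ q π m α κ) (r : ℤ) {F₀ F₁ F₂ g : X → ℂ} (h₀ : Bd 1 F₀)
    (h₁ : Bd 1 F₁) (h₂ : Bd 1 F₂) (hg : Bd 1 g) (hU : Unif τ m κ g) :
    UB (fun n : ℕ => corr4 τ μ F₀ F₁ F₂ g (q * n + r)) 0 := by
  have hτ := hK.toZAct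
  set f : ℕ → X → ℂ := fun n x => F₁ (τ (q * n + r) x) * F₂ (τ (2 * (q * n + r)) x) *
    g (τ (3 * (q * n + r)) x) with hf
  have hfB : ∀ n, Bd 1 (f n) := fun n =>
    ((h₁.comp (hτ.meas _)).mul (h₂.comp (hτ.meas _))).mul (hg.comp (hτ.meas _))
  set u : ℕ → Lp ℂ 2 μ := fun n => ((hfB n).memLp 2).toLp _ with hu
  have hu1 : ∀ {g : X → ℂ} (hg : Bd 1 g), ‖(hg.memLp (μ := μ) 2).toLp g‖ ≤ 1 := by
    intro g hg
    rw [← sq_le_one_iff₀ (norm_nonneg _), norm_toLp_sq]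
    calc ∫ x, ‖g x‖ ^ 2 ∂μ ≤ ∫ x, 1 ∂μ := by
          refine integral_mono hg.integrable_norm_sq (integrable_const _) fun x => ?_
          exact pow_le_one₀ (norm_nonneg _) (hg.bdd x)
      _ = 1 := by simp
  have hvdc := van_der_corput_zero (u := u) (fun n => hu1 (hfB n))
    (γ := fun k => √(2 * √(4 * q * autoMass m (CE κ (D τ ((3 * q * k : ℕ) : ℤ) g)))))
    (fun k => by positivity) (fun k hk => ?_) ?_
  · have h := hvdc.inner_left ((h₀.conj.memLp (μ := μ) 2).toLp _)
    simp only [hu, inner_toLp, Complex.conj_conj, hf, ← mul_assoc, mul_zero] at h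
    exact h
  · have h := hK.ub_corr3_autoMass r (h₁.D hτ (q * k)) (h₂.D hτ (2 * (q * k)))
      (hg.D hτ ((3 * q * k : ℕ) : ℤ))
    convert h using 2 with n
    simp only [hu]
    rw [inner_toLp, corr3, ← hτ.integral_comp (q * n + r) (((h₁.D hτ (q * k)).mul
      ((h₂.D hτ (2 * (q * k))).comp (hτ.meas _))).mul ((hg.D hτ _).comp (hτ.meas _)))]
    refine integral_congr_ae (ae_of_all _ fun x => ?_)
    simp only [hf, D, ← hτ.add, map_mul]
    have e1 : (q * ((n + k : ℕ) : ℤ) + r) = q * k + (q * n + r) := by push_cast; ring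
    have e2 : (q : ℤ) * n + r + (q * n + r) = 2 * (q * n + r) := by ring
    have e3 : 2 * ((q : ℤ) * k + (q * n + r)) = 2 * (q * k) + (q * n + r + (q * n + r)) := by ring
    have e4 : 3 * ((q : ℤ) * k + (q * n + r)) =
      ((3 * q * k : ℕ) : ℤ) + (2 * (q * n + r) + (q * n + r)) := by push_cast; ring
    have e5 : 2 * ((q : ℤ) * n + r) + (q * n + r) = 3 * (q * n + r) := by ring
    rw [e1, e3, e4, e2, e5]
    ring
  · have h1 := CesN.mul_index hU (fun n => autoMass_nonneg _)
      (show 0 < 3 * q by have := hK.qpos; omega)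
    have h2 := (h1.const_mul (4 * q)).sqrt (fun n => by
      have := autoMass_nonneg (m := m) (CE κ (D τ ((3 * q * n : ℕ) : ℤ) g)); positivity)
    exact (h2.const_mul 2).sqrt fun n => by positivity

theorem Kron.ub_weight_corr4_zero (hK : Kron τ μ q π m α κ) (r : ℤ) (η : C(Z, ℂ))
    {F₀ F₁ F₂ g : X → ℂ} (h₀ : Bd 1 F₀)
    (h₁ : Bd 1 F₁) (h₂ : Bd 1 F₂) (hg : Bd 1 g) (hU : Unif τ m κ g) :
    UB (fun n : ℕ => η (α ^ ((q : ℤ) * n + r)) * corr4 τ μ F₀ F₁ F₂ g (q * n + r)) 0 := by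
  refine ub_weight hK.sep (C := 1) (fun n => hK.norm_corr4_le h₀ h₁ h₂ hg _) (fun ξ => ?_) η
  simp only [hK.char_mul_corr4]
  exact hK.ub_corr4_zero r ((hK.bd_char ξ).conj.mul h₀) ((hK.bd_char ξ).mul h₁) h₂ hg hU

theorem Kron.ub_weight (hK : Kron τ μ q π m α κ) (r : ℤ) (η : C(Z, ℂ)) {b : ℕ → ℂ} {ε : ℝ}
    (hε : 0 ≤ ε) (h : ∀ n : ℕ, ‖b n‖ ≤ ε * ‖η (α ^ ((q : ℤ) * n + r))‖) :
    UB b (ε * ∫ z, ‖η z‖ ∂m) := by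
  set η' : C(Z, ℂ) := ⟨fun z => ((‖η z‖ : ℝ) : ℂ), by fun_prop⟩ with hη'
  intro δ hδ
  obtain ⟨N₀, h1⟩ := equidistribution (m := m) hK.sep (fun ξ hξ => hK.char_ne hξ) (α ^ r) η'
    (δ / (ε + 1)) (by positivity)
  refine ⟨N₀, fun N hN a => ?_⟩
  have h2 := h1 N hN a
  have e : ∑ i ∈ Finset.range N, (η' ((α ^ q) ^ (a + i) * α ^ r) - ∫ z, η' z ∂m) =
      ((∑ i ∈ Finset.range N, ‖η (α ^ ((q : ℤ) * (a + i : ℕ) + r))‖ - N * ∫ z, ‖η z‖ ∂m : ℝ) : ℂ)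
      := by
    have e1 : ∀ i : ℕ, η' ((α ^ q) ^ (a + i) * α ^ r) =
        ((‖η (α ^ ((q : ℤ) * (a + i : ℕ) + r))‖ : ℝ) : ℂ) := fun i => by
      rw [zpow_add, zpow_mul, zpow_natCast, zpow_natCast]; rfl
    have e2 : ∫ z, η' z ∂m = ((∫ z, ‖η z‖ ∂m : ℝ) : ℂ) := integral_complex_ofReal
    rw [Finset.sum_sub_distrib, e2, Finset.sum_congr rfl fun i _ => e1 i, Finset.sum_const,
      Finset.card_range, nsmul_eq_mul]
    push_cast
    rfl
  rw [e, Complex.norm_real, Real.norm_eq_abs, zero_add] at h2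
  have h3 := (abs_le.1 h2).2
  calc ‖∑ i ∈ Finset.range N, b (a + i)‖ ≤ ∑ i ∈ Finset.range N, ‖b (a + i)‖ := norm_sum_le _ _
    _ ≤ ∑ i ∈ Finset.range N, ε * ‖η (α ^ ((q : ℤ) * (a + i : ℕ) + r))‖ :=
        Finset.sum_le_sum fun i _ => h _
    _ = ε * ∑ i ∈ Finset.range N, ‖η (α ^ ((q : ℤ) * (a + i : ℕ) + r))‖ :=
        (Finset.mul_sum _ _ _).symm
    _ ≤ ε * (N * ∫ z, ‖η z‖ ∂m + δ / (ε + 1) * N) := by gcongr; linarith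
    _ = ε * (∫ z, ‖η z‖ ∂m) * N + ε / (ε + 1) * (δ * N) := by ring
    _ ≤ ε * (∫ z, ‖η z‖ ∂m) * N + 1 * (δ * N) := by
        gcongr; rw [div_le_one (by positivity)]; linarith
    _ = _ := by ring

theorem Kron.corr3_pi (hK : Kron τ μ q π m α κ) {F₁ : X → ℂ} {φ₂ φ₃ : Z → ℂ}
    (h₁ : Bd 1 F₁) (h₂ : Bd 1 φ₂) (h₃ : Bd 1 φ₃) (j : ℤ) :
    corr3 τ μ F₁ (fun x => φ₂ (π x)) (fun x => φ₃ (π x)) j =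
      ∫ z, CE κ F₁ z * φ₂ (α ^ j * z) * φ₃ (α ^ (2 * j) * z) ∂m := by
  have h := hK.integral_pi_mul ((h₂.comp (measurable_const_mul (α ^ j))).mul
    (h₃.comp (measurable_const_mul (α ^ (2 * j))))) h₁
  refine Eq.trans ?_ (h.trans ?_)
  · refine integral_congr_ae ?_
    filter_upwards [hK.rot_pow j, hK.rot_pow (2 * j)] with x h1 h2
    rw [h1, h2]; ring
  · exact integral_congr_ae (ae_of_all _ fun z => by ring)

theorem Kron.ub_weight_corr3_sub (hK : Kron τ μ q π m α κ) (r : ℤ) (η : C(Z, ℂ))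
    {F₁ F₂ F₃ : X → ℂ} (h₁ : Bd 1 F₁) (h₂ : Bd 1 F₂) (h₃ : Bd 1 F₃) :
    UB (fun n : ℕ => η (α ^ ((q : ℤ) * n + r)) * (corr3 τ μ F₁ F₂ F₃ (q * n + r) -
      corr3 τ μ F₁ (fun x => CE κ F₂ (π x)) (fun x => CE κ F₃ (π x)) (q * n + r))) 0 := by
  have hτ := hK.toZAct
  have b2 := (h₂.CE (κ := κ)).comp hK.pi.measurable
  have b3 := (h₃.CE (κ := κ)).comp hK.pi.measurable
  have half : ∀ {F : X → ℂ}, Bd 1 F → Bd 1 (fun x => (2 : ℂ)⁻¹ * (F x - CE κ F (π x))) := by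
    intro F hF
    refine ((hF.sub ((hF.CE (κ := κ)).comp hK.pi.measurable)).const_mul _).mono ?_
    norm_num
  have hz : ∀ {F : X → ℂ}, Bd 1 F →
      ∀ᵐ z ∂m, CE κ (fun x => (2 : ℂ)⁻¹ * (F x - CE κ F (π x))) z = 0 := by
    intro F hF
    filter_upwards [hK.CE_sub_self hF] with z hz
    rw [CE, integral_const_mul]
    exact mul_eq_zero_of_right _ hz
  have u1 := (hK.ub_weight_corr3_mid r η h₁ (half h₂) h₃ (hz h₂)).const_mul 2
  have u2 := (hK.ub_weight_corr3_right r η h₁ b2 (half h₃) (hz h₃)).const_mul 2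
  have u := u1.add u2
  simp only [mul_zero, add_zero] at u
  convert u using 2 with n
  generalize (q : ℤ) * n + r = j
  have i1 := ((h₁.mul (h₂.comp (hτ.meas j))).mul (h₃.comp (hτ.meas (2 * j)))).integrable (μ := μ)
  have i2 := ((h₁.mul (b2.comp (hτ.meas j))).mul (h₃.comp (hτ.meas (2 * j)))).integrable (μ := μ)
  have i3 := ((h₁.mul (b2.comp (hτ.meas j))).mul (b3.comp (hτ.meas (2 * j)))).integrable (μ := μ)
  have e1 : corr3 τ μ F₁ (fun x => (2 : ℂ)⁻¹ * (F₂ x - CE κ F₂ (π x))) F₃ j =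
      2⁻¹ * (corr3 τ μ F₁ F₂ F₃ j - corr3 τ μ F₁ (fun x => CE κ F₂ (π x)) F₃ j) := by
    rw [corr3, corr3, corr3, ← integral_sub i1 i2, ← integral_const_mul]
    exact integral_congr_ae (ae_of_all _ fun x => by ring)
  have e2 : corr3 τ μ F₁ (fun x => CE κ F₂ (π x)) (fun x => (2 : ℂ)⁻¹ * (F₃ x - CE κ F₃ (π x))) j =
      2⁻¹ * (corr3 τ μ F₁ (fun x => CE κ F₂ (π x)) F₃ j -
        corr3 τ μ F₁ (fun x => CE κ F₂ (π x)) (fun x => CE κ F₃ (π x)) j) := by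
    rw [corr3, corr3, corr3, ← integral_sub i2 i3, ← integral_const_mul]
    exact integral_congr_ae (ae_of_all _ fun x => by ring)
  rw [e1, e2]
  ring

/-- Evaluation of weighted three term correlations near the identity of the rotation factor. -/
theorem Kron.eval_corr3 (hK : Kron τ μ q π m α κ) (r : ℤ)
    {F₁ F₂ F₃ : X → ℂ} (h₁ : Bd 1 F₁) (h₂ : Bd 1 F₂) (h₃ : Bd 1 F₃) {ε : ℝ} (hε : 0 < ε) :
    ∀ᶠ s in (𝓝 (1 : Z)).smallSets, ∀ η : C(Z, ℂ), (∀ z ∉ s, η z = 0) →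
      UB (fun n : ℕ => η (α ^ ((q : ℤ) * n + r)) * (corr3 τ μ F₁ F₂ F₃ (q * n + r) -
        ∫ z, CE κ F₁ z * CE κ F₂ z * CE κ F₃ z ∂m)) (ε * ∫ z, ‖η z‖ ∂m) := by
  have c1 := h₁.CE (κ := κ)
  have c2 := h₂.CE (κ := κ)
  have c3 := h₃.CE (κ := κ)
  set φ₁ := CE κ F₁
  set φ₂ := CE κ F₂
  set φ₃ := CE κ F₃
  have t2 := translation_continuity (m := m) c2 (show 0 < ε / 2 by positivity)
  have hsq : Tendsto (fun s : Z => s ^ 2) (𝓝 1) (𝓝 1) := by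
    have : Continuous fun s : Z => s ^ 2 := continuous_pow 2
    simpa using this.tendsto 1
  have t3 := hsq.eventually (translation_continuity (m := m) c3 (show 0 < ε / 2 by positivity))
  have hc : ∀ᶠ s in 𝓝 (1 : Z), ‖(∫ z, φ₁ z * φ₂ (s * z) * φ₃ (s ^ 2 * z) ∂m) -
      ∫ z, φ₁ z * φ₂ z * φ₃ z ∂m‖ ≤ ε := by
    filter_upwards [t2, t3] with s h2 h3
    have m2 : Bd 1 (fun z => φ₂ (s * z)) := c2.comp (measurable_const_mul _)
    have m3 : Bd 1 (fun z => φ₃ (s ^ 2 * z)) := c3.comp (measurable_const_mul _)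
    have n2 : Integrable (fun z => ‖φ₂ (s * z) - φ₂ z‖) m := (m2.sub c2).integrable.norm
    have n3 : Integrable (fun z => ‖φ₃ (s ^ 2 * z) - φ₃ z‖) m := (m3.sub c3).integrable.norm
    rw [← integral_sub ((c1.mul m2).mul m3).integrable ((c1.mul c2).mul c3).integrable]
    calc _ ≤ ∫ z, (‖φ₂ (s * z) - φ₂ z‖ + ‖φ₃ (s ^ 2 * z) - φ₃ z‖) ∂m := by
          refine norm_integral_le_of_norm_le (n2.add n3) (ae_of_all _ fun z => ?_)
          have e : φ₁ z * φ₂ (s * z) * φ₃ (s ^ 2 * z) - φ₁ z * φ₂ z * φ₃ z =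
            φ₁ z * (φ₂ (s * z) - φ₂ z) * φ₃ (s ^ 2 * z) +
                φ₁ z * φ₂ z * (φ₃ (s ^ 2 * z) - φ₃ z) := by
            ring
          rw [e]
          refine (norm_add_le _ _).trans (add_le_add ?_ ?_)
          · rw [norm_mul, norm_mul]
            have := mul_le_mul (mul_le_of_le_one_left (norm_nonneg (φ₂ (s * z) - φ₂ z)) (c1.bdd z))
              (m3.bdd z) (norm_nonneg _) (norm_nonneg _)
            simpa using this
          · rw [norm_mul]
            exact mul_le_of_le_one_left (norm_nonneg _) ((c1.mul c2).bdd z)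
      _ ≤ _ := by
          rw [integral_add n2 n3]; linarith
  rw [eventually_smallSets]
  refine ⟨_, hc, fun t ht η hη => ?_⟩
  have h1 := hK.ub_weight_corr3_sub r η h₁ h₂ h₃
  have h2 := hK.ub_weight r η hε.le (b := fun n : ℕ => η (α ^ ((q : ℤ) * n + r)) *
    ((∫ z, φ₁ z * φ₂ (α ^ ((q : ℤ) * n + r) * z) * φ₃ (α ^ (2 * ((q : ℤ) * n + r)) * z) ∂m) -
      ∫ z, φ₁ z * φ₂ z * φ₃ z ∂m)) fun n => by
    generalize (q : ℤ) * n + r = j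
    by_cases hs : α ^ j ∈ t
    · have := ht hs
      have e : (α ^ j) ^ 2 = α ^ (2 * j) := by
        rw [mul_comm, zpow_mul]; exact (zpow_natCast _ 2).symm
      simp only [Set.mem_ofPred_eq, e] at this
      rw [norm_mul, mul_comm]
      gcongr
    · rw [hη _ hs]; simp
  have h3 := h1.add h2
  rw [zero_add] at h3
  convert h3 using 2 with n
  rw [hK.corr3_pi h₁ c2 c3]
  ring

end Kronecker

section Cocycle

variable {X : Type*} [MeasurableSpace X] {μ : Measure X} [IsProbabilityMeasure μ]
  {Z : Type*} [CommGroup Z] [TopologicalSpace Z] [IsTopologicalGroup Z] [CompactSpace Z]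
  [T2Space Z] [SecondCountableTopology Z] [MeasurableSpace Z] [BorelSpace Z]
  {m : Measure Z} [IsProbabilityMeasure m] [m.IsMulLeftInvariant]
  {τ : ℤ → X → X} {q : ℕ} {π : X → Z} {α : Z} {κ : Kernel Z X} [IsMarkovKernel κ]

theorem conj_eq_inv {z : ℂ} (h : ‖z‖ = 1) : conj z = z⁻¹ := by
  rw [Complex.inv_def, Complex.normSq_eq_norm_sq, h]; simp

theorem ne_zero_of_norm_one {z : ℂ} (h : ‖z‖ = 1) : z ≠ 0 := by
  rintro rfl; simp at h

theorem Kron.ergodic_one (hK : Kron τ μ q π m α κ) : Ergodic (τ 1) μ := by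
  have h : (τ 1)^[q] = τ q := by
    funext x; rw [hK.iterate 1 q x, one_mul]
  refine ⟨hK.mp 1, PreErgodic.of_iterate q ?_⟩
  rw [h]
  exact hK.erg.toPreErgodic

theorem Kron.exists_ae_eq_const (hK : Kron τ μ q π m α κ) {F : X → ℂ} (hF : Measurable F)
    (h : ∀ᵐ x ∂μ, F (τ 1 x) = F x) : ∃ c : ℂ, ∀ᵐ x ∂μ, F x = c :=
  hK.ergodic_one.ae_eq_const_of_ae_eq_comp_ae hF.aestronglyMeasurable h

/-- Unimodular functions whose derivative is measurable with respect to the rotation factor. -/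
def CL (τ : ℤ → X → X) (μ : Measure X) (π : X → Z) (h : X → ℂ) : Prop :=
  Measurable h ∧ (∀ x, ‖h x‖ = 1) ∧ ∃ c : Z → ℂ, Measurable c ∧ (∀ z, ‖c z‖ = 1) ∧
    ∀ᵐ x ∂μ, h (τ 1 x) = c (π x) * h x

theorem CL.bd {h : X → ℂ} (hh : CL τ μ π h) : Bd 1 h := ⟨hh.1, fun x => (hh.2.1 x).le⟩

theorem Kron.D_eq_wIter (hK : Kron τ μ q π m α κ) {h : X → ℂ} {c : Z → ℂ} (h1 : ∀ x, ‖h x‖ = 1)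
    (hc : ∀ᵐ x ∂μ, h (τ 1 x) = c (π x) * h x) (n : ℕ) :
    ∀ᵐ x ∂μ, D τ n h x = wIter (fun z => α * z) c (fun _ => 1) n (π x) := by
  induction n with
  | zero =>
    refine ae_of_all _ fun x => ?_
    simp only [D, Nat.cast_zero, hK.zero, wIter]
    rw [conj_eq_inv (h1 x), mul_inv_cancel₀ (ne_zero_of_norm_one (h1 x))]
  | succ n ih =>
    filter_upwards [hK.rot, hc, (hK.mp 1).quasiMeasurePreserving.ae ih] with x hr hx hi
    have e : ((n + 1 : ℕ) : ℤ) = n + 1 := by push_cast; ring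
    simp only [wIter]
    rw [← hr, ← hi]
    simp only [D]
    rw [e, hK.add, hx, map_mul]
    have e2 : conj (h x) = (h x)⁻¹ := conj_eq_inv (h1 x)
    by_cases hc0 : c (π x) = 0
    · rw [hc0, zero_mul] at hx
      have := h1 (τ 1 x)
      rw [hx, norm_zero] at this
      exact absurd this zero_ne_one
    · have hcn : ‖c (π x)‖ = 1 := by
        have := h1 (τ 1 x)
        rwa [hx, norm_mul, h1 x, mul_one] at this
      rw [conj_eq_inv hcn, conj_eq_inv (h1 x)]
      have := ne_zero_of_norm_one (h1 x)
      field_simp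

/-- The multiplicative cube of `c` along a parallelogram. -/
noncomputable def cubeW (c : Z → ℂ) (p : Z × (Z × Z)) : ℂ :=
  c (p.1 * p.2.1) * conj (c p.2.1) * (conj (c (p.1 * p.2.2)) * c p.2.2)

theorem Bd.cubeW {c : Z → ℂ} (hc : Bd 1 c) : Bd 1 (cubeW c) := by
  have m1 : Measurable fun p : Z × (Z × Z) => p.1 * p.2.1 := by fun_prop
  have m2 : Measurable fun p : Z × (Z × Z) => p.1 * p.2.2 := by fun_prop
  exact ((hc.comp m1).mul (hc.comp (measurable_fst.comp measurable_snd)).conj).mul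
    ((hc.comp m2).conj.mul (hc.comp (measurable_snd.comp measurable_snd)))

theorem wIter_cubeW (c : Z → ℂ) (n : ℕ) (p : Z × (Z × Z)) :
    wIter (fun p => ((1, (α, α)) : Z × (Z × Z)) * p) (cubeW c) (fun _ => 1) n p =
      cubeW (wIter (fun z => α * z) c (fun _ => 1) n) p := by
  induction n generalizing p with
  | zero => simp [wIter, cubeW]
  | succ n ih =>
    simp only [wIter]
    rw [ih]
    simp only [cubeW, Prod.fst_mul, Prod.snd_mul, one_mul, map_mul, mul_left_comm p.1 α]
    ring

theorem autoMass_eq_integral_cubeW {c : Z → ℂ} (hc : Bd 1 c) :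
    ((autoMass m c : ℝ) : ℂ) = ∫ p, cubeW c p ∂(m.prod (m.prod m)) := by
  rw [integral_prod _ hc.cubeW.integrable, autoMass, ← integral_complex_ofReal]
  refine integral_congr_ae (ae_of_all _ fun s => ?_)
  simp only [cubeW]
  have h := integral_prod_mul (μ := m) (ν := m) (fun z => c (s * z) * conj (c z))
    (fun w => conj (c (s * w)) * c w)
  rw [h]
  have : ∫ w, conj (c (s * w)) * c w ∂m = conj (autoCorr m c s) := by
    rw [autoCorr, ← integral_conj]
    exact integral_congr_ae (ae_of_all _ fun w => by simp)
  rw [this]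
  change ((‖autoCorr m c s‖ ^ 2 : ℝ) : ℂ) = autoCorr m c s * _
  rw [Complex.mul_conj, Complex.normSq_eq_norm_sq]

theorem exists_limit_cube (α : Z) {c : Z → ℂ} (hc : Bd 1 c) : ∃ J : Z × (Z × Z) → ℂ, Bd 1 J ∧
    (∀ᵐ p ∂(m.prod (m.prod m)), cubeW c p * J ((1, (α, α)) * p) = J p) ∧
    Tendsto (fun N : ℕ => (∑ n ∈ Finset.range N,
      autoMass m (wIter (fun z => α * z) c (fun _ => 1) n)) / N) atTop
      (𝓝 (∫ p, J p ∂(m.prod (m.prod m))).re) := by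
  obtain ⟨J, hJ, hinv, hlim⟩ := mean_ergodic (translation_mp (m := m.prod (m.prod m))
    ((1, (α, α)) : Z × (Z × Z))) hc.cubeW Bd.one
  refine ⟨J, hJ, hinv, ?_⟩
  set ν := m.prod (m.prod m) with hν
  have hcn : ∀ n, Bd 1 (wIter (fun z => α * z) c (fun _ => 1) n) := fun n =>
    hc.wIter (measurable_const_mul α) Bd.one n
  have hA : ∀ N : ℕ, (((∑ n ∈ Finset.range N,
      autoMass m (wIter (fun z => α * z) c (fun _ => 1) n)) / N : ℝ) : ℂ) =
      ∫ p, (N : ℂ)⁻¹ * ∑ n ∈ Finset.range N,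
        wIter (fun p => ((1, (α, α)) : Z × (Z × Z)) * p) (cubeW c) (fun _ => 1) n p ∂ν := by
    intro N
    rw [integral_const_mul, integral_finsetSum _ fun n _ =>
      (hc.cubeW.wIter (measurable_const_mul _) Bd.one n).integrable]
    simp only [wIter_cubeW]
    rw [Complex.ofReal_div, Complex.ofReal_sum, div_eq_inv_mul]
    simp only [autoMass_eq_integral_cubeW (hcn _)]
    rfl
  have hB : ∀ N : ℕ, Bd 1 (fun p => (N : ℂ)⁻¹ * ∑ n ∈ Finset.range N,
      wIter (fun p => ((1, (α, α)) : Z × (Z × Z)) * p) (cubeW c) (fun _ => 1) n p) := by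
    intro N
    refine ((Bd.sum (Finset.range N) fun i _ =>
      hc.cubeW.wIter (measurable_const_mul _) Bd.one i).const_mul (N : ℂ)⁻¹).mono ?_
    simp only [norm_inv, Complex.norm_natCast, Finset.sum_const, Finset.card_range, nsmul_eq_mul,
      mul_one]
    exact inv_mul_le_one
  have h1 : Tendsto (fun N : ℕ => (((∑ n ∈ Finset.range N,
      autoMass m (wIter (fun z => α * z) c (fun _ => 1) n)) / N : ℝ) : ℂ)) atTop
      (𝓝 (∫ p, J p ∂ν)) := by
    rw [tendsto_iff_norm_sub_tendsto_zero]
    have h2 := (Real.continuous_sqrt.tendsto 0).comp hlim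
    rw [Real.sqrt_zero] at h2
    refine squeeze_zero (fun _ => norm_nonneg _) (fun N => ?_) h2
    rw [hA, ← integral_sub (hB N).integrable hJ.integrable]
    exact (norm_integral_le_integral_norm _).trans
      (integral_norm_le_sqrt (((hB N).sub hJ).memLp 2))
  exact (Complex.continuous_re.tendsto _).comp h1

/-- First projection used in the fourfold product of a limit cube. -/
def pr₁ (p : Z × (Z × (Z × Z))) : Z × (Z × Z) := (p.2.2.1, (p.1, p.2.1))

/-- Second projection used in the fourfold product of a limit cube. -/
def pr₂ (p : Z × (Z × (Z × Z))) : Z × (Z × Z) := (p.2.2.2, (p.1, p.2.1))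

theorem measurable_pr₁ : Measurable (pr₁ (Z := Z)) := by unfold pr₁; fun_prop

theorem measurable_pr₂ : Measurable (pr₂ (Z := Z)) := by unfold pr₂; fun_prop

theorem mp_pr₁ : MeasurePreserving (pr₁ (Z := Z)) (m.prod (m.prod (m.prod m)))
    (m.prod (m.prod m)) := by
  have h1 := (measurePreserving_prodAssoc m m (m.prod m)).symm
  have h2 := (MeasurePreserving.id (m.prod m)).prod (measurePreserving_fst (μ := m) (ν := m))
  exact ((Measure.measurePreserving_swap (μ := m.prod m) (ν := m)).comp h2).comp h1

theorem mp_pr₂ : MeasurePreserving (pr₂ (Z := Z)) (m.prod (m.prod (m.prod m)))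
    (m.prod (m.prod m)) := by
  have h1 := (measurePreserving_prodAssoc m m (m.prod m)).symm
  have h2 := (MeasurePreserving.id (m.prod m)).prod (measurePreserving_snd (μ := m) (ν := m))
  exact ((Measure.measurePreserving_swap (μ := m.prod m) (ν := m)).comp h2).comp h1

/-- A fourfold product of translates of `J`, the second difference of `J` in direction `a`. -/
noncomputable def cubeP (J : Z × (Z × Z) → ℂ) (a : Z) (p : Z × (Z × (Z × Z))) : ℂ :=
  J ((a, (1, a)) * pr₁ p) * conj (J ((1, (a, a ^ 2)) * pr₁ p)) *
    (conj (J ((a, (a, a)) * pr₂ p)) * J ((1, (a ^ 2, a ^ 2)) * pr₂ p))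

theorem Bd.cubeP {J : Z × (Z × Z) → ℂ} (hJ : Bd 1 J) (a : Z) : Bd 1 (cubeP J a) := by
  have h1 : ∀ g : Z × (Z × Z), Bd 1 fun p => J (g * pr₁ p) := fun g =>
    hJ.comp ((measurable_const_mul g).comp measurable_pr₁)
  have h2 : ∀ g : Z × (Z × Z), Bd 1 fun p => J (g * pr₂ p) := fun g =>
    hJ.comp ((measurable_const_mul g).comp measurable_pr₂)
  exact ((h1 _).mul (h1 _).conj).mul ((h2 _).conj.mul (h2 _))

end Cocycle

section Cocycle

variable {X : Type*} [MeasurableSpace X] {μ : Measure X} [IsProbabilityMeasure μ]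
  {Z : Type*} [CommGroup Z] [TopologicalSpace Z] [IsTopologicalGroup Z] [CompactSpace Z]
  [T2Space Z] [SecondCountableTopology Z] [MeasurableSpace Z] [BorelSpace Z]
  {m : Measure Z} [IsProbabilityMeasure m] [m.IsMulLeftInvariant]
  {τ : ℤ → X → X} {q : ℕ} {π : X → Z} {α : Z} {κ : Kernel Z X} [IsMarkovKernel κ]

/-- The partial integral of `cubeP`. -/
noncomputable def cubeG (m : Measure Z) (J : Z × (Z × Z) → ℂ) (a z : Z) : ℂ :=
  ∫ u, cubeP J a (z, u) ∂(m.prod (m.prod m))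

theorem Bd.cubeG {J : Z × (Z × Z) → ℂ} (hJ : Bd 1 J) (a : Z) : Bd 1 (cubeG m J a) :=
  ⟨((hJ.cubeP a).meas.stronglyMeasurable.integral_prod_right'
    (ν := m.prod (m.prod m))).measurable, fun z =>
    ((hJ.cubeP a).comp (measurable_prodMk_left (x := z))).norm_integral_le⟩

theorem norm_cubeW {c : Z → ℂ} (hc : ∀ z, ‖c z‖ = 1) (p : Z × (Z × Z)) : ‖cubeW c p‖ = 1 := by
  simp [cubeW, hc]

theorem cubeW_identity {c : Z → ℂ} (hc : ∀ z, ‖c z‖ = 1) (a : Z) (p : Z × (Z × (Z × Z))) :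
    conj (cubeW c ((a, (1, a)) * pr₁ p)) * cubeW c ((1, (a, a ^ 2)) * pr₁ p) *
    (cubeW c ((a, (a, a)) * pr₂ p) * conj (cubeW c ((1, (a ^ 2, a ^ 2)) * pr₂ p))) =
    c (a ^ 2 * p.1) * conj (c (a * p.1)) ^ 2 * c p.1 := by
  obtain ⟨z, w, s, t⟩ := p
  have e : ∀ z, conj (c z) = (c z)⁻¹ := fun z => conj_eq_inv (hc z)
  have n : ∀ z, c z ≠ 0 := fun z => ne_zero_of_norm_one (hc z)
  simp only [cubeW, pr₁, pr₂, Prod.fst_mul, Prod.snd_mul, one_mul, map_mul, Complex.conj_conj]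
  simp only [e]
  have r1 : s * (a * z) = a * s * z := by rw [mul_left_comm, mul_assoc]
  have r2 : a * s * (a * w) = s * (a ^ 2 * w) := by
    rw [pow_two]; simp only [mul_left_comm, mul_comm]
  have r3 : a * t * (a * z) = t * (a ^ 2 * z) := by
    rw [pow_two]; simp only [mul_left_comm, mul_comm]
  have r4 : a * t * (a * w) = t * (a ^ 2 * w) := by
    rw [pow_two]; simp only [mul_left_comm, mul_comm]
  rw [r1, r2, r3, r4]
  have n1 := n (a * s * z)
  have n2 := n z
  have n3 := n (s * (a ^ 2 * w))
  have n4 := n (a * w)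
  have n5 := n (a * z)
  have n6 := n (a ^ 2 * w)
  have n7 := n (t * (a ^ 2 * z))
  have n8 := n (t * (a ^ 2 * w))
  have n9 := n (a ^ 2 * z)
  field_simp

theorem cubeG_translate {c : Z → ℂ} (hc : ∀ z, ‖c z‖ = 1) {α : Z} {J : Z × (Z × Z) → ℂ}
    (hJ : Bd 1 J)
    (hinv : ∀ᵐ p ∂(m.prod (m.prod m)), cubeW c p * J ((1, (α, α)) * p) = J p) (a : Z) :
    ∀ᵐ z ∂m, cubeG m J a (α * z) =
      c (a ^ 2 * z) * conj (c (a * z)) ^ 2 * c z * cubeG m J a z := by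
  have hinv' : ∀ᵐ p ∂(m.prod (m.prod m)), J ((1, (α, α)) * p) = conj (cubeW c p) * J p := by
    filter_upwards [hinv] with p hp
    rw [← hp, conj_eq_inv (norm_cubeW hc p),
      inv_mul_cancel_left₀ (ne_zero_of_norm_one (norm_cubeW hc p))]
  have h1 : ∀ g : Z × (Z × Z), ∀ᵐ p ∂(m.prod (m.prod (m.prod m))),
      J (g * ((1, (α, α)) * pr₁ p)) = conj (cubeW c (g * pr₁ p)) * J (g * pr₁ p) := fun g => by
    filter_upwards [((translation_mp (m := m.prod (m.prod m)) g).comp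
      mp_pr₁).quasiMeasurePreserving.ae hinv'] with p hp
    rw [mul_left_comm g]; exact hp
  have h2 : ∀ g : Z × (Z × Z), ∀ᵐ p ∂(m.prod (m.prod (m.prod m))),
      J (g * ((1, (α, α)) * pr₂ p)) = conj (cubeW c (g * pr₂ p)) * J (g * pr₂ p) := fun g => by
    filter_upwards [((translation_mp (m := m.prod (m.prod m)) g).comp
      mp_pr₂).quasiMeasurePreserving.ae hinv'] with p hp
    rw [mul_left_comm g]; exact hp
  have hP : ∀ᵐ p ∂(m.prod (m.prod (m.prod m))), cubeP J a ((α, (α, (1, 1))) * p) =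
      c (a ^ 2 * p.1) * conj (c (a * p.1)) ^ 2 * c p.1 * cubeP J a p := by
    filter_upwards [h1 (a, (1, a)), h1 (1, (a, a ^ 2)), h2 (a, (a, a)),
      h2 (1, (a ^ 2, a ^ 2))] with p e1 e2 e3 e4
    have q1 : pr₁ ((α, (α, (1, 1))) * p) = (1, (α, α)) * pr₁ p := rfl
    have q2 : pr₂ ((α, (α, (1, 1))) * p) = (1, (α, α)) * pr₂ p := rfl
    rw [← cubeW_identity hc]
    simp only [cubeP, q1, q2]
    rw [e1, e2, e3, e4]
    simp only [map_mul, Complex.conj_conj]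
    ring
  filter_upwards [Measure.ae_ae_of_ae_prod hP] with z hz
  have h3 := integral_comp_mp (translation_mp (m := m.prod (m.prod m)) ((α, (1, 1)) : Z × (Z × Z)))
    ((hJ.cubeP a).comp (measurable_prodMk_left (x := α * z)))
  rw [cubeG, ← h3, cubeG, ← integral_const_mul]
  exact integral_congr_ae hz

theorem integral_cubeP_one_pos {J : Z × (Z × Z) → ℂ} (hJ : Bd 1 J)
    (h0 : ∫ p, J p ∂(m.prod (m.prod m)) ≠ 0) :
    ∫ p, cubeP J 1 p ∂(m.prod (m.prod (m.prod m))) ≠ 0 := by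
  have e1 : ∀ p, cubeP J 1 p = (((‖J (pr₁ p)‖ ^ 2 * ‖J (pr₂ p)‖ ^ 2 : ℝ)) : ℂ) := by
    intro p
    have h : ((1, (1, 1)) : Z × (Z × Z)) = 1 := rfl
    simp only [cubeP, one_pow, h, one_mul]
    rw [Complex.mul_conj, mul_comm (conj (J (pr₂ p))), Complex.mul_conj,
      Complex.normSq_eq_norm_sq, Complex.normSq_eq_norm_sq, ← Complex.ofReal_mul]
  set ρ : Z × Z → ℂ := fun y => ∫ s, ((‖J (s, y)‖ ^ 2 : ℝ) : ℂ) ∂m with hρ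
  have hsq : Bd 1 (fun p => ((‖J p‖ ^ 2 : ℝ) : ℂ)) :=
    ⟨by have := hJ.meas; fun_prop, fun p => by
      rw [Complex.norm_real, norm_pow, norm_norm]
      exact pow_le_one₀ (norm_nonneg _) (hJ.bdd p)⟩
  have hρB : Bd 1 ρ :=
    ⟨(hsq.meas.stronglyMeasurable.integral_prod_left' (μ := m)).measurable, fun y =>
      (hsq.comp (measurable_prodMk_right (y := y))).norm_integral_le⟩
  have hρr : ∀ y, ρ y = ((∫ s, ‖J (s, y)‖ ^ 2 ∂m : ℝ) : ℂ) := fun y => integral_complex_ofReal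
  have hρn : ∀ y, ((‖ρ y‖ : ℝ) : ℂ) = ρ y := fun y => by
    rw [hρr, Complex.norm_real, Real.norm_of_nonneg (integral_nonneg fun _ => by positivity)]
  have i1 : ∫ p, cubeP J 1 p ∂(m.prod (m.prod (m.prod m))) =
      ((∫ y, ‖ρ y‖ ^ 2 ∂(m.prod m) : ℝ) : ℂ) := by
    rw [← integral_comp_mp (measurePreserving_prodAssoc m m (m.prod m)) (hJ.cubeP 1)]
    have hB : Bd 1 (fun p => cubeP J 1 (MeasurableEquiv.prodAssoc p)) :=
      (hJ.cubeP 1).comp MeasurableEquiv.prodAssoc.measurable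
    rw [integral_prod _ hB.integrable, ← integral_complex_ofReal]
    refine integral_congr_ae (ae_of_all _ fun y => ?_)
    simp only [e1, Complex.ofReal_mul]
    have h := integral_prod_mul (μ := m) (ν := m) (fun s => ((‖J (s, y)‖ ^ 2 : ℝ) : ℂ))
      (fun s => ((‖J (s, y)‖ ^ 2 : ℝ) : ℂ))
    refine h.trans ?_
    change ρ y * ρ y = _
    rw [← hρn y]
    push_cast; rw [Complex.norm_real, norm_norm]; ring
  have i2 : ∫ p, ((‖J p‖ ^ 2 : ℝ) : ℂ) ∂(m.prod (m.prod m)) =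
      ((∫ y, ‖ρ y‖ ∂(m.prod m) : ℝ) : ℂ) := by
    rw [integral_prod_symm _ hsq.integrable, ← integral_complex_ofReal]
    exact integral_congr_ae (ae_of_all _ fun y => (hρn y).symm)
  rw [integral_complex_ofReal, Complex.ofReal_inj] at i2
  have hpos : 0 < ∫ y, ‖ρ y‖ ∂(m.prod m) := by
    rw [← i2]
    have h3 := sq_integral_norm_le (hJ.memLp (μ := m.prod (m.prod m)) 2)
    have h4 := norm_integral_le_integral_norm (μ := m.prod (m.prod m)) J
    have h5 := norm_pos_iff.2 h0
    have : 0 < (∫ p, ‖J p‖ ∂(m.prod (m.prod m))) ^ 2 := by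
      have := h5.trans_le h4; positivity
    linarith
  rw [i1]
  have h6 := sq_integral_norm_le (hρB.memLp (μ := m.prod m) 2)
  have h7 : 0 < (∫ y, ‖ρ y‖ ∂(m.prod m)) ^ 2 := by positivity
  exact Complex.ofReal_ne_zero.2 (h7.trans_le h6).ne'

theorem norm_mul_sub_mul_le {a b c d : ℂ} (hb : ‖b‖ ≤ 1) (hc : ‖c‖ ≤ 1) :
    ‖a * b - c * d‖ ≤ ‖a - c‖ + ‖b - d‖ := by
  have e : a * b - c * d = (a - c) * b + c * (b - d) := by ring
  rw [e]
  refine (norm_add_le _ _).trans (add_le_add ?_ ?_)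
  · rw [norm_mul]; exact mul_le_of_le_one_right (norm_nonneg _) hb
  · rw [norm_mul]; exact mul_le_of_le_one_left (norm_nonneg _) hc

theorem cubeP_continuity {J : Z × (Z × Z) → ℂ} (hJ : Bd 1 J) {ε : ℝ} (hε : 0 < ε) :
    ∀ᶠ a in 𝓝 (1 : Z), ∫ z, ‖cubeG m J a z - cubeG m J 1 z‖ ∂m ≤ ε := by
  have key : ∀ f : Z → Z × (Z × Z), Continuous f → f 1 = 1 →
      ∀ᶠ a in 𝓝 (1 : Z), ∫ p, ‖J (f a * p) - J p‖ ∂(m.prod (m.prod m)) ≤ ε / 4 := by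
    intro f hf h1
    have := hf.tendsto 1
    rw [h1] at this
    exact this.eventually (translation_continuity hJ (by positivity))
  filter_upwards [key (fun a => (a, (1, a))) (by fun_prop) rfl,
    key (fun a => (1, (a, a ^ 2))) (by fun_prop) (by simp), key (fun a => (a, (a, a)))
    (by fun_prop) rfl, key (fun a => (1, (a ^ 2, a ^ 2))) (by fun_prop) (by simp)]
    with a h1 h2 h3 h4
  set ν := m.prod (m.prod (m.prod m)) with hν
  have hA : ∀ g : Z × (Z × Z), Bd 2 (fun p => J (g * p) - J p) := fun g =>
    ((hJ.comp (measurable_const_mul g)).sub hJ).mono (by norm_num)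
  have t1 : ∀ g : Z × (Z × Z), ∫ p, ‖J (g * pr₁ p) - J (pr₁ p)‖ ∂ν =
      ∫ p, ‖J (g * p) - J p‖ ∂(m.prod (m.prod m)) := fun g =>
    integral_comp_mp_real mp_pr₁ (hA g).meas.norm
  have t2 : ∀ g : Z × (Z × Z), ∫ p, ‖J (g * pr₂ p) - J (pr₂ p)‖ ∂ν =
      ∫ p, ‖J (g * p) - J p‖ ∂(m.prod (m.prod m)) := fun g =>
    integral_comp_mp_real mp_pr₂ (hA g).meas.norm
  have j1 : ∀ g : Z × (Z × Z), Integrable (fun p => ‖J (g * pr₁ p) - J (pr₁ p)‖) ν := fun g =>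
    ((hA g).comp measurable_pr₁).integrable.norm
  have j2 : ∀ g : Z × (Z × Z), Integrable (fun p => ‖J (g * pr₂ p) - J (pr₂ p)‖) ν := fun g =>
    ((hA g).comp measurable_pr₂).integrable.norm
  have hd : Bd (1 + 1) (fun p => cubeP J a p - cubeP J 1 p) := (hJ.cubeP a).sub (hJ.cubeP 1)
  have s1 : ∀ z, ‖cubeG m J a z - cubeG m J 1 z‖ ≤
      ∫ u, ‖cubeP J a (z, u) - cubeP J 1 (z, u)‖ ∂(m.prod (m.prod m)) := fun z => by
    rw [cubeG, cubeG, ← integral_sub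
      ((hJ.cubeP a).comp (measurable_prodMk_left (x := z))).integrable
      ((hJ.cubeP 1).comp (measurable_prodMk_left (x := z))).integrable]
    exact norm_integral_le_integral_norm _
  have hdn : Integrable (fun p => ‖cubeP J a p - cubeP J 1 p‖) ν := hd.integrable.norm
  calc ∫ z, ‖cubeG m J a z - cubeG m J 1 z‖ ∂m
      ≤ ∫ z, ∫ u, ‖cubeP J a (z, u) - cubeP J 1 (z, u)‖ ∂(m.prod (m.prod m)) ∂m :=
        integral_mono ((hJ.cubeG a).sub (hJ.cubeG 1)).integrable.norm
          hdn.integral_prod_left s1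
    _ = ∫ p, ‖cubeP J a p - cubeP J 1 p‖ ∂ν := (integral_prod _ hdn).symm
    _ ≤ ∫ p, ((‖J ((a, (1, a)) * pr₁ p) - J (pr₁ p)‖ + ‖J ((1, (a, a ^ 2)) * pr₁ p) - J (pr₁ p)‖)
        + (‖J ((a, (a, a)) * pr₂ p) - J (pr₂ p)‖ +
          ‖J ((1, (a ^ 2, a ^ 2)) * pr₂ p) - J (pr₂ p)‖)) ∂ν := by
      refine integral_mono hdn (((j1 _).add (j1 _)).add ((j2 _).add (j2 _))) fun p => ?_
      have h : ((1, (1, 1)) : Z × (Z × Z)) = 1 := rfl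
      have cj : ∀ x y : ℂ, ‖conj x - conj y‖ = ‖x - y‖ := fun x y => by
        rw [← map_sub]; exact RCLike.norm_conj _
      have nc : ∀ p, ‖conj (J p)‖ ≤ 1 := fun p => (RCLike.norm_conj _).trans_le (hJ.bdd p)
      simp only [cubeP, one_pow, h, one_mul]
      refine (norm_mul_sub_mul_le ?_ ?_).trans (add_le_add ?_ ?_)
      · rw [norm_mul]; exact mul_le_one₀ (nc _) (norm_nonneg _) (hJ.bdd _)
      · rw [norm_mul]; exact mul_le_one₀ (hJ.bdd _) (norm_nonneg _) (nc _)
      · refine (norm_mul_sub_mul_le (nc _) (hJ.bdd _)).trans ?_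
        rw [cj]
      · refine (norm_mul_sub_mul_le (hJ.bdd _) (nc _)).trans ?_
        rw [cj]
    _ = _ := by
      have i12 : Integrable (fun p => ‖J ((a, (1, a)) * pr₁ p) - J (pr₁ p)‖ +
        ‖J ((1, (a, a ^ 2)) * pr₁ p) - J (pr₁ p)‖) ν := (j1 _).add (j1 _)
      have i34 : Integrable (fun p => ‖J ((a, (a, a)) * pr₂ p) - J (pr₂ p)‖ +
          ‖J ((1, (a ^ 2, a ^ 2)) * pr₂ p) - J (pr₂ p)‖) ν := (j2 _).add (j2 _)
      rw [integral_add i12 i34, integral_add (j1 _) (j1 _), integral_add (j2 _) (j2 _),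
        t1, t1, t2, t2]
    _ ≤ ε := by linarith

/-- A relative eigenfunction with non-uniform derivatives is nearly cubic along return times of the
rotation factor. -/
theorem Kron.cl_near (hK : Kron τ μ q π m α κ) {h : X → ℂ} (hh : CL τ μ π h)
    (hU : ¬ Unif τ m κ h) {ε : ℝ} (hε : 0 < ε) : ∀ᶠ a in 𝓝 (1 : Z), ∀ j : ℤ, α ^ j = a →
    ∫ x, ‖h (τ (3 * j) x) * conj (h (τ (2 * j) x)) ^ 3 * h (τ j x) ^ 3 * conj (h x) - 1‖ ∂μ
      ≤ ε := by
  obtain ⟨hm, h1, c, hcm, hc1, hc⟩ := hh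
  have hcB : Bd 1 c := ⟨hcm, fun z => (hc1 z).le⟩
  obtain ⟨J, hJ, hinv, hlim⟩ := exists_limit_cube (m := m) α hcB
  have hJ0 : ∫ p, J p ∂(m.prod (m.prod m)) ≠ 0 := by
    intro h0
    rw [h0, Complex.zero_re] at hlim
    apply hU
    have e : ∀ n : ℕ, autoMass m (CE κ (D τ n h)) =
        autoMass m (wIter (fun z => α * z) c (fun _ => 1) n) := by
      intro n
      have e1 : CE κ (D τ n h) =ᵐ[m] wIter (fun z => α * z) c (fun _ => 1) n :=
        (hK.CE_congr (hK.D_eq_wIter h1 hc n)).trans (hK.CE_pi _)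
      have e2 : ∀ s, autoCorr m (CE κ (D τ n h)) s =
          autoCorr m (wIter (fun z => α * z) c (fun _ => 1) n) s := fun s => by
        refine integral_congr_ae ?_
        filter_upwards [e1, (translation_mp (m := m) s).quasiMeasurePreserving.ae e1] with z a b
        rw [a, b]
      simp only [autoMass, e2]
    unfold Unif CesN
    simpa only [e] using hlim
  have hc0 := integral_cubeP_one_pos hJ hJ0
  have hG1 := cubeG_translate hc1 hJ hinv 1
  obtain ⟨c0, hcc⟩ := hK.exists_ae_eq_const ((hJ.cubeG (m := m) 1).comp hK.pi.measurable).meas (by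
    filter_upwards [hK.rot, hK.pi.quasiMeasurePreserving.ae hG1] with x hx hg
    rw [hx, hg]
    simp only [one_pow, one_mul]
    rw [conj_eq_inv (hc1 _)]
    have := ne_zero_of_norm_one (hc1 (π x))
    field_simp)
  have hc0' : c0 ≠ 0 := by
    intro h0
    apply hc0
    rw [integral_prod _ (hJ.cubeP 1).integrable]
    change ∫ z, cubeG m J 1 z ∂m = 0
    rw [← integral_comp_mp hK.pi (hJ.cubeG 1), integral_congr_ae hcc]
    simp [h0]
  have hp : 0 < ‖c0‖ := norm_pos_iff.2 hc0'
  filter_upwards [cubeP_continuity (m := m) hJ (show 0 < ‖c0‖ * ε / 2 by positivity)] with a ha j hj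
  set G := cubeG m J a with hG
  set Y : X → ℂ := fun x => h (τ (2 * j) x) * conj (h (τ j x)) ^ 2 * h x with hY
  have hτ := hK.toZAct
  have hY1 : ∀ x, ‖Y x‖ = 1 := fun x => by simp [hY, h1]
  have hYm : Measurable Y := by
    have hB : Bd 1 h := ⟨hm, fun x => (h1 x).le⟩
    exact (((hB.comp (hτ.meas (2 * j))).mul ((hB.comp (hτ.meas j)).conj.pow 2)).mul hB).meas
  have hYB : Bd 1 Y := ⟨hYm, fun x => (hY1 x).le⟩
  have hGB : Bd 1 (fun x => G (π x)) := (hJ.cubeG a).comp hK.pi.measurable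
  have hstep : ∀ i : ℤ, ∀ᵐ x ∂μ, h (τ i (τ 1 x)) = c (α ^ i * π x) * h (τ i x) := fun i => by
    filter_upwards [hK.rot_pow i, (hτ.mp i).quasiMeasurePreserving.ae hc] with x hx h2
    rw [← hτ.add, add_comm, hτ.add, h2, hx]
  obtain ⟨θ, hθ⟩ := hK.exists_ae_eq_const (hGB.conj.mul hYB).meas (by
    filter_upwards [hK.rot, hK.pi.quasiMeasurePreserving.ae (cubeG_translate hc1 hJ hinv a),
      hc, hstep j, hstep (2 * j)] with x hx hg e1 e2 e3
    simp only [hY]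
    rw [hx, hG, hg, e1, e2, e3]
    have e : α ^ (2 * j) = a ^ 2 := by
      rw [← hj, mul_comm, zpow_mul]; exact zpow_natCast _ 2
    rw [e, hj]
    simp only [map_mul, map_pow, Complex.conj_conj]
    rw [conj_eq_inv (hc1 _), conj_eq_inv (hc1 _), conj_eq_inv (hc1 _)]
    have n1 := ne_zero_of_norm_one (hc1 (π x))
    have n2 := ne_zero_of_norm_one (hc1 (a * π x))
    have n3 := ne_zero_of_norm_one (hc1 (a ^ 2 * π x))
    field_simp)
  set V : X → ℂ := fun x => conj c0 * Y x - θ with hV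
  have hVB : Bd (‖c0‖ + ‖θ‖) V :=
    ((hYB.const_mul (conj c0)).sub (Bd.const θ)).mono (by simp)
  have hV1 : ∫ x, ‖V x‖ ∂μ ≤ ‖c0‖ * ε / 2 := by
    refine le_trans (le_of_eq ?_) ha
    rw [← integral_comp_mp_real hK.pi ((hJ.cubeG a).sub (hJ.cubeG 1)).meas.norm]
    refine integral_congr_ae ?_
    filter_upwards [hcc, hθ] with x e1 e2
    rw [e1, hV]
    simp only
    rw [← e2, ← sub_mul, norm_mul, hY1, mul_one, ← map_sub, RCLike.norm_conj, norm_sub_rev]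
  have hV2 : ∫ x, ‖V (τ j x)‖ ∂μ ≤ ‖c0‖ * ε / 2 := by
    rwa [integral_comp_mp_real (hτ.mp j) hVB.meas.norm]
  have hpt : ∀ x, ‖h (τ (3 * j) x) * conj (h (τ (2 * j) x)) ^ 3 * h (τ j x) ^ 3 * conj (h x) - 1‖ ≤
      ‖c0‖⁻¹ * (‖V (τ j x)‖ + ‖V x‖) := by
    intro x
    have e1 : h (τ (3 * j) x) * conj (h (τ (2 * j) x)) ^ 3 * h (τ j x) ^ 3 * conj (h x) =
        Y (τ j x) * conj (Y x) := by
      simp only [hY, ← hτ.add, map_mul, map_pow, Complex.conj_conj]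
      have a1 : 2 * j + j = 3 * j := by ring
      have a2 : j + j = 2 * j := by ring
      rw [a1, a2]; ring
    have e2 : V (τ j x) - V x = conj c0 * (Y (τ j x) * conj (Y x) - 1) * Y x := by
      have : conj (Y x) * Y x = 1 := by
        rw [conj_eq_inv (hY1 x), inv_mul_cancel₀ (ne_zero_of_norm_one (hY1 x))]
      simp only [hV]
      linear_combination (-conj c0 * Y (τ j x)) * this
    have e3 : ‖V (τ j x) - V x‖ = ‖c0‖ * ‖Y (τ j x) * conj (Y x) - 1‖ := by
      rw [e2, norm_mul, norm_mul, hY1, mul_one, RCLike.norm_conj]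
    rw [e1, ← div_eq_inv_mul, le_div_iff₀ hp, mul_comm, ← e3]
    exact norm_sub_le _ _
  have i1 : Integrable (fun x => ‖V (τ j x)‖) μ := (hVB.comp (hτ.meas j)).integrable.norm
  have i2 : Integrable (fun x => ‖V x‖) μ := hVB.integrable.norm
  refine (integral_mono_of_nonneg (ae_of_all _ fun _ => norm_nonneg _)
    ((i1.add i2).const_mul _) (ae_of_all _ hpt)).trans ?_
  rw [integral_const_mul]
  have : ∫ x, (‖V (τ j x)‖ + ‖V x‖) ∂μ ≤ ‖c0‖ * ε := by
    rw [integral_add i1 i2]; linarith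
  change ‖c0‖⁻¹ * ∫ x, (‖V (τ j x)‖ + ‖V x‖) ∂μ ≤ ε
  rw [← div_eq_inv_mul, div_le_iff₀ hp, mul_comm]
  exact this

end Cocycle

section Eigenvectors

variable {H : Type*} [NormedAddCommGroup H] [InnerProductSpace ℂ H]

theorem eigenvalue_norm {U : H →ₗᵢ[ℂ] H} {f : H} {l : ℂ} (hf : f ≠ 0) (h : U f = l • f) :
    ‖l‖ = 1 := by
  have h1 := U.norm_map f
  rw [h, norm_smul] at h1
  exact (mul_eq_right₀ (norm_ne_zero_iff.2 hf)).1 h1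

/-- An isometry preserving a finite-dimensional space has an eigenvector there which is not
orthogonal to a given vector that is not orthogonal to the space. -/
theorem exists_eigenvector_of_finiteDimensional (U : H →ₗᵢ[ℂ] H) (E : Submodule ℂ H)
    [FiniteDimensional ℂ E] (hE : ∀ v ∈ E, U v ∈ E) {G v : H} (hv : v ∈ E)
    (hvG : inner ℂ v G ≠ 0) : ∃ (f : H) (l : ℂ), U f = l • f ∧ inner ℂ f G ≠ 0 := by
  by_contra! hcon
  let W : Submodule ℂ H :=
    { carrier := {w | w ∈ E ∧ ∀ f ∈ E, ∀ l : ℂ, U f = l • f → inner ℂ f w = 0}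
      zero_mem' := ⟨E.zero_mem, fun _ _ _ _ => inner_zero_right _⟩
      add_mem' := fun {a b} ha hb => ⟨E.add_mem ha.1 hb.1, fun f hf l hl => by
        rw [inner_add_right, ha.2 f hf l hl, hb.2 f hf l hl, add_zero]⟩
      smul_mem' := fun c a ha => ⟨E.smul_mem c ha.1, fun f hf l hl => by
        rw [inner_smul_right, ha.2 f hf l hl, mul_zero]⟩ }
  have hWE : W ≤ E := fun w hw => hw.1
  have : FiniteDimensional ℂ W := Submodule.finiteDimensional_of_le hWE
  have hUW : ∀ w ∈ W, U.toLinearMap w ∈ W := by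
    intro w hw
    refine ⟨hE w hw.1, fun f hf l hl => ?_⟩
    by_cases hf0 : f = 0
    · rw [hf0, inner_zero_left]
    have hl1 := eigenvalue_norm hf0 hl
    have hl0 : l ≠ 0 := ne_zero_of_norm_one hl1
    have e : f = l⁻¹ • U f := by rw [hl, smul_smul, inv_mul_cancel₀ hl0, one_smul]
    rw [e, inner_smul_left]
    have : inner ℂ (U f) (U w) = inner ℂ f w := U.inner_map_map f w
    change _ * inner ℂ (U f) (U w) = 0
    rw [this, hw.2 f hf l hl, mul_zero]
  have hWbot : W = ⊥ := by
    by_contra hne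
    have : Nontrivial W := Submodule.nontrivial_iff_ne_bot.2 hne
    obtain ⟨l, hl⟩ := Module.End.exists_eigenvalue (U.toLinearMap.restrict hUW)
    obtain ⟨w, hw⟩ := hl.exists_hasEigenvector
    have h1 : U (w : H) = l • (w : H) := congrArg Subtype.val hw.apply_eq_smul
    have h2 := w.2.2 (w : H) w.2.1 l h1
    exact hw.2 (Subtype.ext (inner_self_eq_zero.1 h2))
  have hP : (E.orthogonalProjectionOnto G : H) ∈ W := by
    refine ⟨Submodule.coe_mem _, fun f hf l hl => ?_⟩
    have := E.inner_orthogonalProjectionOnto_eq_of_mem_left (⟨f, hf⟩ : E) G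
    rw [Submodule.coe_inner] at this
    exact this.trans (hcon f l hl)
  rw [hWbot, Submodule.mem_bot] at hP
  have := E.inner_orthogonalProjectionOnto_eq_of_mem_left (⟨v, hv⟩ : E) G
  rw [Submodule.coe_inner, hP, inner_zero_right] at this
  exact hvG this.symm

variable [CompleteSpace H]

theorem exists_eigenvector_of_commute (U : H →ₗᵢ[ℂ] H) (A : H →L[ℂ] H)
    (hA : IsCompactOperator A) (hS : A.IsSymmetric) (hc : ∀ f, A (U f) = U (A f)) {G : H}
    (hG : A G ≠ 0) : ∃ (f : H) (l : ℂ), U f = l • f ∧ inner ℂ f G ≠ 0 := by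
  have h1 := ContinuousLinearMap.orthogonalComplement_iSup_eigenspaces_eq_bot hA hS
  obtain ⟨l, v, hv, hvG⟩ : ∃ l : ℂ, ∃ v ∈ Module.End.eigenspace (A : Module.End ℂ H) l,
      inner ℂ v (A G) ≠ 0 := by
    by_contra! hcon
    apply hG
    rw [← Submodule.mem_bot ℂ, ← h1, Submodule.mem_orthogonal]
    intro u hu
    induction hu using Submodule.iSup_induction' with
    | mem i x hx => exact hcon i x hx
    | zero => exact inner_zero_left _
    | add x y _ _ hx hy => rw [inner_add_left, hx, hy, add_zero]
  have hvl : A v = l • v := Module.End.mem_eigenspace_iff.1 hv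
  have h2 : inner ℂ v (A G) = conj l * inner ℂ v G := by
    have : inner ℂ (A v) G = inner ℂ v (A G) := hS v G
    rw [← this, hvl, inner_smul_left]
  rw [h2] at hvG
  have hl : l ≠ 0 := fun h => hvG (by rw [h, map_zero, zero_mul])
  have := ContinuousLinearMap.finite_dimensional_eigenspace hA l hl
  refine exists_eigenvector_of_finiteDimensional U _ (fun w hw => ?_) hv (right_ne_zero_of_mul hvG)
  have hw' : A w = l • w := Module.End.mem_eigenspace_iff.1 hw
  refine Module.End.mem_eigenspace_iff.2 ?_
  change A (U w) = l • U w
  rw [hc, hw', map_smul]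

/-- The averaged rank one operators along an orbit. -/
noncomputable def orbitOp (U : H →ₗᵢ[ℂ] H) (G : H) (N : ℕ) : H →L[ℂ] H :=
  (N : ℂ)⁻¹ • ∑ n ∈ Finset.range N, InnerProductSpace.rankOne ℂ (U^[n] G) (U^[n] G)

theorem orbitOp_apply (U : H →ₗᵢ[ℂ] H) (G : H) (N : ℕ) (f : H) : orbitOp U G N f =
    (N : ℂ)⁻¹ • ∑ n ∈ Finset.range N, inner ℂ (U^[n] G) f • U^[n] G := by
  simp [orbitOp]

theorem isCompact_orbitOp (U : H →ₗᵢ[ℂ] H) (G : H) (N : ℕ) :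
    IsCompactOperator (orbitOp U G N) := by
  have h : ∀ x : H, IsCompactOperator (InnerProductSpace.rankOne ℂ x x) := fun x => by
    rw [InnerProductSpace.rankOne_def']
    exact (isCompactOperator_of_locallyCompactSpace_rng (T :=
      ContinuousLinearMap.toSpanSingleton ℂ x)).comp_clm (innerSL ℂ x)
  have : orbitOp U G N ∈ compactOperator (RingHom.id ℂ) H H :=
    Submodule.smul_mem _ _ (Submodule.sum_mem _ fun n _ => h _)
  exact this

theorem orbitOp_symm (U : H →ₗᵢ[ℂ] H) (G : H) (N : ℕ) (f g : H) :
    inner ℂ (orbitOp U G N f) g = inner ℂ f (orbitOp U G N g) := by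
  rw [orbitOp_apply, orbitOp_apply, inner_smul_left, inner_smul_right, sum_inner, inner_sum]
  rw [map_inv₀, Complex.conj_natCast]
  congr 1
  refine Finset.sum_congr rfl fun n _ => ?_
  rw [inner_smul_left, inner_smul_right, inner_conj_symm, mul_comm]

theorem exists_eigenvector_of_cauchySeq (U : H →ₗᵢ[ℂ] H) (G : H) (hC : CauchySeq (orbitOp U G))
    (h : ¬ CesN fun n => ‖inner ℂ (U^[n] G) G‖ ^ 2) :
    ∃ (f : H) (l : ℂ), U f = l • f ∧ inner ℂ f G ≠ 0 := by
  obtain ⟨A, hA⟩ := cauchySeq_tendsto_of_complete hC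
  have hAf : ∀ f, Tendsto (fun N => orbitOp U G N f) atTop (𝓝 (A f)) := fun f =>
    ((ContinuousLinearMap.apply ℂ H f).continuous.tendsto A).comp hA
  have hcpt : IsCompactOperator A :=
    isCompactOperator_of_tendsto hA (Eventually.of_forall fun N => isCompact_orbitOp U G N)
  refine exists_eigenvector_of_commute U A hcpt (fun f g => ?_) (fun f => ?_) fun hG => h ?_
  · have h1 := (hAf f).inner (tendsto_const_nhds (x := g)) (𝕜 := ℂ)
    have h2 := (tendsto_const_nhds (x := f)).inner (hAf g) (𝕜 := ℂ)
    simp only [orbitOp_symm] at h1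
    exact tendsto_nhds_unique h1 h2
  · have hb : ∀ N, ‖orbitOp U G N (U f) - U (orbitOp U G N f)‖ ≤
        (N : ℝ)⁻¹ * (2 * (‖G‖ * ‖U f‖ * ‖G‖)) := by
      intro N
      have hn : ∀ n, ‖U^[n] G‖ = ‖G‖ := fun n => by
        induction n with
        | zero => rfl
        | succ n ih => rw [Function.iterate_succ_apply', U.norm_map, ih]
      have ht : ∀ n, ‖inner ℂ (U^[n] G) (U f) • U^[n] G‖ ≤ ‖G‖ * ‖U f‖ * ‖G‖ := fun n => by
        rw [norm_smul, hn]
        refine mul_le_mul_of_nonneg_right ?_ (norm_nonneg _)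
        exact (norm_inner_le_norm _ _).trans (by rw [hn])
      rw [orbitOp_apply, orbitOp_apply, map_smul, ← smul_sub, norm_smul, norm_inv,
        Complex.norm_natCast, map_sum]
      refine mul_le_mul_of_nonneg_left ?_ (by positivity)
      have e : ∀ n, U (inner ℂ (U^[n] G) f • U^[n] G) =
          inner ℂ (U^[n + 1] G) (U f) • U^[n + 1] G := fun n => by
        rw [map_smul, Function.iterate_succ_apply', U.inner_map_map]
      simp only [e]
      have tele := Finset.sum_range_succ_sub_sum
        (fun n => inner ℂ (U^[n] G) (U f) • U^[n] G) (n := N)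
      rw [← Finset.sum_sub_distrib, Finset.sum_range_sub', two_mul]
      exact (norm_sub_le _ _).trans (add_le_add (ht 0) (ht N))
    have h1 := ((hAf (U f)).sub ((U.continuous.tendsto _).comp (hAf f))).norm
    have h2 : Tendsto (fun N : ℕ => (N : ℝ)⁻¹ * (2 * (‖G‖ * ‖U f‖ * ‖G‖))) atTop (𝓝 0) := by
      have := (tendsto_inv_atTop_nhds_zero_nat (𝕜 := ℝ)).mul_const (2 * (‖G‖ * ‖U f‖ * ‖G‖))
      rwa [zero_mul] at this
    have h3 := le_of_tendsto_of_tendsto' h1 h2 hb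
    exact sub_eq_zero.1 (norm_le_zero_iff.1 h3)
  · have h1 := ((hAf G).inner (tendsto_const_nhds (x := G)) (𝕜 := ℂ)).norm
    rw [hG, inner_zero_left, norm_zero] at h1
    refine h1.congr fun N => ?_
    have e : inner ℂ (orbitOp U G N G) G =
        (((∑ n ∈ Finset.range N, ‖inner ℂ (U^[n] G) G‖ ^ 2) / N : ℝ) : ℂ) := by
      rw [orbitOp_apply, inner_smul_left, sum_inner, map_inv₀, Complex.conj_natCast,
        Complex.ofReal_div, Complex.ofReal_sum, Complex.ofReal_natCast, div_eq_inv_mul]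
      congr 1
      refine Finset.sum_congr rfl fun n _ => ?_
      rw [inner_smul_left, mul_comm, Complex.mul_conj, Complex.normSq_eq_norm_sq]
    rw [e, Complex.norm_real, Real.norm_of_nonneg (by positivity)]

end Eigenvectors

section Eigenfunctions

variable {Y : Type*} [MeasurableSpace Y] {ν : Measure Y} [IsProbabilityMeasure ν]

theorem iterate_compMeasurePreserving {T : Y → Y} (hT : MeasurePreserving T ν ν) {C : ℝ}
    {G : Y → ℂ} (hG : Bd C G) (n : ℕ) :
    (Lp.compMeasurePreservingₗᵢ ℂ T hT)^[n] ((hG.memLp (μ := ν) 2).toLp G) =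
      ((hG.comp (hT.iterate n).measurable).memLp (μ := ν) 2).toLp (fun x => G (T^[n] x)) := by
  induction n with
  | zero => rfl
  | succ n ih =>
    rw [Function.iterate_succ_apply', ih]
    refine Lp.ext ?_
    refine (Lp.coeFn_compMeasurePreserving _ hT).trans (EventuallyEq.trans ?_
      (MemLp.coeFn_toLp _).symm)
    refine (hT.quasiMeasurePreserving.ae_eq_comp (MemLp.coeFn_toLp _)).trans ?_
    exact ae_of_all _ fun x => rfl

theorem memLp_tensor (h f : Lp ℂ 2 ν) :
    MemLp (fun p : Y × Y => h p.1 * conj (f p.2)) 2 (ν.prod ν) := by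
  have m1 : AEStronglyMeasurable (fun p : Y × Y => h p.1) (ν.prod ν) :=
    (Lp.aestronglyMeasurable h).comp_fst
  have m2 : AEStronglyMeasurable (fun p : Y × Y => f p.2) (ν.prod ν) :=
    (Lp.aestronglyMeasurable f).comp_snd
  refine (memLp_two_iff_integrable_sq_norm
    (m1.mul (Complex.continuous_conj.comp_aestronglyMeasurable m2))).2 ?_
  have h1 := (Lp.memLp h).integrable_norm_pow (p := 2) (by norm_num)
  have h2 := (Lp.memLp f).integrable_norm_pow (p := 2) (by norm_num)
  refine (h1.mul_prod h2).congr (ae_of_all _ fun p => ?_)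
  change _ = ‖h p.1 * conj (f p.2)‖ ^ 2
  rw [norm_mul, RCLike.norm_conj, mul_pow]

theorem norm_tensor (h f : Lp ℂ 2 ν) : ‖(memLp_tensor h f).toLp _‖ = ‖h‖ * ‖f‖ := by
  rw [← sq_eq_sq₀ (norm_nonneg _) (by positivity), mul_pow, norm_toLp_sq, norm_lp_sq, norm_lp_sq,
    ← integral_prod_mul]
  refine integral_congr_ae (ae_of_all _ fun p => ?_)
  simp only [norm_mul, RCLike.norm_conj, mul_pow]

theorem cauchySeq_orbitOp {T : Y → Y} (hT : MeasurePreserving T ν ν) {G : Y → ℂ} (hG : Bd 1 G) :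
    CauchySeq (orbitOp (Lp.compMeasurePreservingₗᵢ ℂ T hT) ((hG.memLp (μ := ν) 2).toLp G)) := by
  set U : Lp ℂ 2 ν →ₗᵢ[ℂ] Lp ℂ 2 ν := Lp.compMeasurePreservingₗᵢ ℂ T hT with hU
  set v : Lp ℂ 2 ν := (hG.memLp (μ := ν) 2).toLp G with hv
  have hGn : ∀ n, Bd 1 fun x => G (T^[n] x) := fun n => hG.comp (hT.iterate n).measurable
  have hG2 : Bd 1 (fun p : Y × Y => G p.1 * conj (G p.2)) :=
    (hG.comp measurable_fst).mul (hG.comp measurable_snd).conj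
  obtain ⟨J, hJ, -, hlim⟩ := mean_ergodic (hT.prod hT) Bd.one hG2
  set K : ℕ → Y × Y → ℂ := fun N p =>
    (N : ℂ)⁻¹ * ∑ n ∈ Finset.range N, G (T^[n] p.1) * conj (G (T^[n] p.2)) with hK
  have hit : ∀ (n : ℕ) (p : Y × Y), (Prod.map T T)^[n] p = (T^[n] p.1, T^[n] p.2) := by
    intro n p
    rw [Prod.map_iterate]; rfl
  simp only [wIter_one, hit] at hlim
  have hKB : ∀ N : ℕ, Bd ((N : ℝ)⁻¹ * N) (K N) := fun N => by
    have := (Bd.sum (Finset.range N) fun n _ => ((hGn n).comp (measurable_fst (β := Y))).mul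
      ((hGn n).comp (measurable_snd (α := Y))).conj).const_mul (N : ℂ)⁻¹
    refine this.mono ?_
    simp
  set j : ℕ → Lp ℂ 2 (ν.prod ν) := fun N => ((hKB N).memLp 2).toLp (K N) with hj
  have hjt : Tendsto j atTop (𝓝 ((hJ.memLp 2).toLp J)) := by
    rw [tendsto_iff_norm_sub_tendsto_zero]
    have h2 := (Real.continuous_sqrt.tendsto 0).comp hlim
    rw [Real.sqrt_zero] at h2
    refine h2.congr fun N => ?_
    have : j N - (hJ.memLp 2).toLp J = (((hKB N).sub hJ).memLp 2).toLp _ :=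
      (MemLp.toLp_sub ((hKB N).memLp 2) (hJ.memLp 2)).symm
    rw [this, ← Real.sqrt_sq (norm_nonneg _), norm_toLp_sq]
    rfl
  have hin : ∀ (N : ℕ) (h f : Lp ℂ 2 ν), inner ℂ h (orbitOp U v N f) =
      inner ℂ ((memLp_tensor h f).toLp _) (j N) := by
    intro N h f
    rw [orbitOp_apply, inner_smul_right, inner_sum, inner_toLp]
    have e1 : ∀ p : Y × Y, conj (h p.1 * conj (f p.2)) * K N p = (N : ℂ)⁻¹ *
        ∑ n ∈ Finset.range N, (conj (h p.1) * G (T^[n] p.1)) * (conj (G (T^[n] p.2)) * f p.2) := by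
      intro p
      simp only [hK, map_mul, Complex.conj_conj, Finset.mul_sum]
      refine Finset.sum_congr rfl fun n _ => ?_
      ring
    simp only [e1]
    have i1 : ∀ n, Integrable (fun x => conj (h x) * G (T^[n] x)) ν := fun n =>
      (Lp.memLp h).star.integrable_mul ((hGn n).memLp 2)
    have i2 : ∀ n, Integrable (fun x => conj (G (T^[n] x)) * f x) ν := fun n =>
      ((hGn n).conj.memLp 2).integrable_mul (Lp.memLp f)
    rw [integral_const_mul, integral_finsetSum _ fun n _ => (i1 n).mul_prod (i2 n)]
    congr 1
    refine Finset.sum_congr rfl fun n _ => ?_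
    rw [integral_prod_mul (fun x => conj (h x) * G (T^[n] x)) (fun x => conj (G (T^[n] x)) * f x),
      inner_smul_right, hv, hU, iterate_compMeasurePreserving hT hG, L2.inner_def,
      L2.inner_def, mul_comm]
    congr 1
    · refine integral_congr_ae ?_
      filter_upwards [((hGn n).memLp (μ := ν) 2).coeFn_toLp] with x hx
      rw [hx, RCLike.inner_apply, mul_comm]
    · refine integral_congr_ae ?_
      filter_upwards [((hGn n).memLp (μ := ν) 2).coeFn_toLp] with x hx
      rw [hx, RCLike.inner_apply, mul_comm]
  have hop : ∀ N M, ‖orbitOp U v N - orbitOp U v M‖ ≤ ‖j N - j M‖ := by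
    intro N M
    refine ContinuousLinearMap.opNorm_le_bound _ (norm_nonneg _) fun f => ?_
    set w := (orbitOp U v N - orbitOp U v M) f with hw
    have e : inner ℂ w w = inner ℂ ((memLp_tensor w f).toLp _) (j N - j M) := by
      rw [inner_sub_right, ← hin, ← hin, ← inner_sub_right]
      rfl
    have h1 := norm_inner_le_norm (𝕜 := ℂ) ((memLp_tensor w f).toLp _) (j N - j M)
    rw [← e, norm_tensor, inner_self_eq_norm_sq_to_K] at h1
    have h2 : ‖w‖ ^ 2 ≤ ‖w‖ * ‖f‖ * ‖j N - j M‖ := by simpa using h1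
    by_cases h0 : ‖w‖ = 0
    · rw [h0]; positivity
    · have : 0 < ‖w‖ := lt_of_le_of_ne (norm_nonneg _) (Ne.symm h0)
      nlinarith
  have hjc := hjt.cauchySeq
  rw [Metric.cauchySeq_iff] at hjc ⊢
  intro ε hε
  obtain ⟨N, hN⟩ := hjc ε hε
  refine ⟨N, fun a ha b hb => lt_of_le_of_lt ?_ (hN a ha b hb)⟩
  rw [dist_eq_norm, dist_eq_norm]
  exact hop a b

/-- A function with non-vanishing averaged autocorrelations correlates with an eigenfunction. -/
theorem exists_eigenfunction {T : Y → Y} (hT : MeasurePreserving T ν ν) {G : Y → ℂ} (hG : Bd 1 G)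
    (h : ¬ CesN fun n => ‖∫ x, G (T^[n] x) * conj (G x) ∂ν‖ ^ 2) :
    ∃ (ψ : Y → ℂ) (l : ℂ), Bd 1 ψ ∧ ‖l‖ = 1 ∧ (∀ᵐ x ∂ν, ψ (T x) = l * ψ x) ∧
      ∫ x, G x * conj (ψ x) ∂ν ≠ 0 := by
  have h' : ¬ CesN fun n => ‖inner ℂ ((Lp.compMeasurePreservingₗᵢ ℂ T hT)^[n]
      ((hG.memLp (μ := ν) 2).toLp G)) ((hG.memLp (μ := ν) 2).toLp G)‖ ^ 2 := by
    intro hc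
    apply h
    convert hc using 3 with n
    rw [iterate_compMeasurePreserving hT hG, inner_toLp, ← RCLike.norm_conj, ← integral_conj]
    simp only [map_mul, Complex.conj_conj]
  obtain ⟨f, l, hf, hfG⟩ := exists_eigenvector_of_cauchySeq _ _ (cauchySeq_orbitOp hT hG) h'
  have hf0 : f ≠ 0 := fun h0 => hfG (by rw [h0, inner_zero_left])
  have hl : ‖l‖ = 1 := eigenvalue_norm hf0 hf
  have hfT : ∀ᵐ x ∂ν, f (T x) = l * f x := by
    have h1 : (f ∘ T : Y → ℂ) =ᵐ[ν] (l • f : Lp ℂ 2 ν) := by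
      rw [← hf]; exact (Lp.coeFn_compMeasurePreserving f hT).symm
    filter_upwards [h1, Lp.coeFn_smul l f] with x h1 h2
    rw [← smul_eq_mul]
    exact h1.trans h2
  have hfi : ∫ x, G x * conj (f x) ∂ν ≠ 0 := by
    intro h0
    apply hfG
    rw [L2.inner_def, ← h0]
    refine integral_congr_ae ?_
    filter_upwards [(hG.memLp (μ := ν) 2).coeFn_toLp] with x hx
    rw [hx, RCLike.inner_apply]
  have hfm : Measurable f := (Lp.stronglyMeasurable f).measurable
  set B : ℕ → Set Y := fun R => {x | ‖f x‖ ≤ R} with hBdef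
  have hB : ∀ R x, x ∈ B R ↔ ‖f x‖ ≤ R := fun _ _ => Iff.rfl
  have hBm : ∀ R, MeasurableSet (B R) := fun R => measurableSet_le hfm.norm measurable_const
  have hlim : Tendsto (fun R : ℕ => ∫ x, G x * conj ((B R).indicator f x) ∂ν) atTop
      (𝓝 (∫ x, G x * conj (f x) ∂ν)) := by
    refine tendsto_integral_of_dominated_convergence (fun x => ‖f x‖) (fun R => ?_) ?_
      (fun R => ?_) ?_
    · refine (hG.meas.mul (Complex.continuous_conj.measurable.comp (hfm.indicator (hBm R)))).aestronglyMeasurable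
    · exact ((Lp.memLp f).integrable (by norm_num)).norm
    · refine ae_of_all _ fun x => ?_
      rw [norm_mul, RCLike.norm_conj]
      refine (mul_le_of_le_one_left (norm_nonneg _) (hG.bdd x)).trans ?_
      exact norm_indicator_le_norm_self _ _
    · refine ae_of_all _ fun x => ?_
      refine tendsto_const_nhds.congr' ?_
      filter_upwards [eventually_ge_atTop ⌈‖f x‖⌉₊] with R hR
      rw [Set.indicator_of_mem ((hB R x).2 (Nat.ceil_le.1 hR))]
  obtain ⟨R, hR, hRpos⟩ := ((hlim.eventually_ne hfi).and (eventually_gt_atTop 0)).exists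
  have hRp : (0 : ℝ) < R := by exact_mod_cast hRpos
  refine ⟨fun x => (R : ℂ)⁻¹ * (B R).indicator f x, l, ⟨?_, fun x => ?_⟩, hl, ?_, ?_⟩
  · exact (hfm.indicator (hBm R)).const_mul _
  · rw [norm_mul, norm_inv, Complex.norm_natCast, ← div_eq_inv_mul, div_le_one hRp]
    by_cases hx : ‖f x‖ ≤ R
    · rw [Set.indicator_of_mem ((hB R x).2 hx)]; exact hx
    · rw [Set.indicator_of_notMem (fun h => hx ((hB R x).1 h)), norm_zero]; exact hRp.le
  · filter_upwards [hfT] with x hx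
    have hn : ‖f (T x)‖ = ‖f x‖ := by rw [hx, norm_mul, hl, one_mul]
    by_cases hx' : ‖f x‖ ≤ R
    · rw [Set.indicator_of_mem ((hB R _).2 (hn.trans_le hx')),
        Set.indicator_of_mem ((hB R x).2 hx'), hx]
      ring
    · rw [Set.indicator_of_notMem (fun h => hx' (hn.symm.trans_le ((hB R _).1 h))),
        Set.indicator_of_notMem (fun h => hx' ((hB R x).1 h))]
      ring
  · have e : ∀ x, G x * conj ((R : ℂ)⁻¹ * (B R).indicator f x) =
        (R : ℂ)⁻¹ * (G x * conj ((B R).indicator f x)) := fun x => by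
      rw [map_mul, map_inv₀, Complex.conj_natCast]; ring
    simp only [e]
    rw [integral_const_mul]
    exact mul_ne_zero (inv_ne_zero (by exact_mod_cast hRpos.ne')) hR

end Eigenfunctions

section Extension

variable {X : Type*} [MeasurableSpace X] {μ : Measure X} [IsProbabilityMeasure μ]
  {Z : Type*} [CommGroup Z] [TopologicalSpace Z] [IsTopologicalGroup Z] [CompactSpace Z]
  [T2Space Z] [SecondCountableTopology Z] [MeasurableSpace Z] [BorelSpace Z]
  {m : Measure Z} [IsProbabilityMeasure m] [m.IsMulLeftInvariant]
  {τ : ℤ → X → X} {q : ℕ} {π : X → Z} {α : Z} {κ : Kernel Z X} [IsMarkovKernel κ]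
  {W : Type*} [MeasurableSpace W] {M : Measure W} [IsProbabilityMeasure M] {p : W → Z}

/-- The extension of `(W, M)` by the fibres of `κ` over the translate of `p : W → Z` by `s`. -/
noncomputable def Ext (κ : Kernel Z X) (M : Measure W) {p : W → Z} (hp : Measurable p) (s : Z) :
    Measure (W × X) :=
  M ⊗ₘ κ.comap (fun w => s * p w) (hp.const_mul s)

instance (hp : Measurable p) (s : Z) : IsProbabilityMeasure (Ext κ M hp s) := by
  unfold Ext; infer_instance

theorem integral_Ext (hp : Measurable p) (s : Z) {C : ℝ} {F : W × X → ℂ} (hF : Bd C F) :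
    ∫ a, F a ∂(Ext κ M hp s) = ∫ w, ∫ y, F (w, y) ∂(κ (s * p w)) ∂M := by
  unfold Ext
  rw [Measure.integral_compProd hF.integrable]
  rfl

theorem bd_fibre_integral (hp : Measurable p) {C : ℝ} {F : W × X → ℂ} (hF : Bd C F) :
    Bd C (fun a : Z × W => ∫ y, F (a.2, y) ∂(κ (a.1 * p a.2))) := by
  refine ⟨?_, fun a => (hF.comp measurable_prodMk_left).norm_integral_le⟩
  have hm : Measurable fun a : Z × W => a.1 * p a.2 := measurable_fst.mul (hp.comp measurable_snd)
  have h1 : Measurable fun b : (Z × W) × X => F (b.1.2, b.2) :=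
    hF.meas.comp ((measurable_snd.comp measurable_fst).prodMk measurable_snd)
  exact (StronglyMeasurable.integral_kernel_prod_right' (κ := κ.comap _ hm)
    h1.stronglyMeasurable).measurable

theorem bd_integral_Ext (hp : Measurable p) {C : ℝ} {F : W × X → ℂ} (hF : Bd C F) :
    Bd C (fun s => ∫ a, F a ∂(Ext κ M hp s)) := by
  refine ⟨?_, fun s => hF.norm_integral_le⟩
  simp only [integral_Ext hp _ hF]
  exact (StronglyMeasurable.integral_prod_right'
    (bd_fibre_integral (κ := κ) hp hF).meas.stronglyMeasurable).measurable

theorem Kron.integral_integral_Ext (hK : Kron τ μ q π m α κ) (hp : Measurable p) {C : ℝ}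
    {F : W × X → ℂ} (hF : Bd C F) :
    ∫ s, ∫ a, F a ∂(Ext κ M hp s) ∂m = ∫ a, F a ∂(M.prod μ) := by
  simp only [integral_Ext hp _ hF]
  rw [integral_integral_swap (f := fun s w => ∫ y, F (w, y) ∂(κ (s * p w)))
    (bd_fibre_integral hp hF).integrable, integral_prod _ hF.integrable]
  refine integral_congr_ae (ae_of_all _ fun w => ?_)
  have h1 : Bd C fun y => F (w, y) := hF.comp measurable_prodMk_left
  change ∫ s, CE κ (fun y => F (w, y)) (s * p w) ∂m = _
  rw [integral_mul_right_eq_self (CE κ fun y => F (w, y)), hK.integral_CE h1]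

theorem Kron.ae_map_kernel (hK : Kron τ μ q π m α κ) [MeasurableSpace.CountablyGenerated X] :
    ∀ᵐ z ∂m, (κ z).map (τ 1) = κ (α * z) := by
  have hT := hK.toZAct.meas 1
  have h : m ⊗ₘ ((κ.map (τ 1)).comap (fun z => α⁻¹ * z) (measurable_const_mul _)) = m ⊗ₘ κ := by
    have hm : Measurable fun x => (π x, x) := hK.pi.measurable.prodMk measurable_id
    have hg : Measurable fun a : Z × X => (α * a.1, τ 1 a.2) :=
      (measurable_fst.const_mul α).prodMk (hT.comp measurable_snd)
    have h1 : (m ⊗ₘ κ).map (fun a => (α * a.1, τ 1 a.2)) = m ⊗ₘ κ := by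
      rw [← hK.disint, Measure.map_map hg hm]
      calc μ.map _ = μ.map ((fun x => (π x, x)) ∘ τ 1) := by
            refine Measure.map_congr ?_
            filter_upwards [hK.rot] with x hx
            simp only [Function.comp, hx]
        _ = _ := by rw [← Measure.map_map hm hT, (hK.mp 1).map_eq]
    rw [← h1]
    ext S hS
    rw [Measure.map_apply hg hS, Measure.compProd_apply hS, Measure.compProd_apply (hg hS)]
    rw [← lintegral_mul_left_eq_self _ α]
    refine lintegral_congr fun z => ?_
    rw [Kernel.comap_apply, inv_mul_cancel_left, Kernel.map_apply _ hT,
      Measure.map_apply hT (measurable_prodMk_left hS)]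
    rfl
  have h2 := Kernel.ae_eq_of_compProd_eq h
  have h3 := (measurePreserving_mul_left m α).quasiMeasurePreserving.ae h2
  filter_upwards [h3] with z hz
  rw [Kernel.comap_apply, inv_mul_cancel_left, Kernel.map_apply _ hT] at hz
  exact hz

theorem Kron.mp_Ext (hK : Kron τ μ q π m α κ) [MeasurableSpace.CountablyGenerated X]
    (hp : MeasurePreserving p M m) {R : W → W} (hR : MeasurePreserving R M M)
    (hpR : ∀ᵐ w ∂M, p (R w) = α * p w) (s : Z) :
    MeasurePreserving (Prod.map R (τ 1)) (Ext κ M hp.measurable s) (Ext κ M hp.measurable s) := by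
  have hT := hK.toZAct.meas 1
  have hg : Measurable (Prod.map R (τ 1)) := hR.measurable.prodMap hT
  refine ⟨hg, ?_⟩
  ext S hS
  unfold Ext
  rw [Measure.map_apply hg hS, Measure.compProd_apply (hg hS), Measure.compProd_apply hS]
  have hms : Measurable fun w => κ.comap (fun w => s * p w) (hp.measurable.const_mul s) w
      (Prod.mk w ⁻¹' S) := Kernel.measurable_kernel_prodMk_left hS
  rw [← hR.lintegral_comp hms]
  refine lintegral_congr_ae ?_
  have h1 := ((measurePreserving_mul_left m s).comp hp).quasiMeasurePreserving.ae hK.ae_map_kernel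
  filter_upwards [h1, hpR] with w h1 h2
  change (κ (s * p w)).map (τ 1) = κ (α * (s * p w)) at h1
  rw [Kernel.comap_apply, Kernel.comap_apply, h2, mul_left_comm, ← h1,
    Measure.map_apply hT (measurable_prodMk_left hS)]
  rfl

end Extension

section Boxes

theorem exists_countable_algebra (X : Type*) [mX : MeasurableSpace X]
    [MeasurableSpace.CountablyGenerated X] :
    ∃ P : Set (Set X), P.Countable ∧ IsPiSystem P ∧ Set.univ ∈ P ∧
      MeasurableSpace.generateFrom P = mX := by
  obtain ⟨b, hb, hg⟩ := ‹MeasurableSpace.CountablyGenerated X›.isCountablyGenerated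
  refine ⟨generateSetAlgebra b, countable_generateSetAlgebra hb, fun s hs t ht _ =>
    isSetAlgebra_generateSetAlgebra.inter_mem hs ht, isSetAlgebra_generateSetAlgebra.univ_mem, ?_⟩
  rw [generateFrom_generateSetAlgebra_eq, ← hg]

theorem isCountablySpanning_of_univ_mem {Y : Type*} {S : Set (Set Y)} (hS : Set.univ ∈ S) :
    IsCountablySpanning S :=
  ⟨fun _ => Set.univ, fun _ => hS, Set.iUnion_const _⟩

theorem ae_eq_zero_of_boxes {W X : Type*} [mW : MeasurableSpace W] [mX : MeasurableSpace X]
    {ν : Measure (W × X)} [IsProbabilityMeasure ν] {P : Set (Set W)} {Q : Set (Set X)}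
    (hP : IsPiSystem P) (hP1 : Set.univ ∈ P) (hPg : MeasurableSpace.generateFrom P = mW)
    (hQ : IsPiSystem Q) (hQ1 : Set.univ ∈ Q) (hQg : MeasurableSpace.generateFrom Q = mX)
    {C : ℝ} {w : W × X → ℂ} (hw : Bd C w) (h : ∀ B ∈ P, ∀ D ∈ Q, ∫ a in B ×ˢ D, w a ∂ν = 0) :
    ∀ᵐ a ∂ν, w a = 0 := by
  have hi : Integrable w ν := hw.integrable
  refine hi.ae_eq_zero_of_forall_setIntegral_eq_zero fun S hS _ => ?_
  have h0 : ∫ a, w a ∂ν = 0 := by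
    rw [← h _ hP1 _ hQ1, Set.univ_prod_univ, setIntegral_univ]
  refine MeasurableSpace.induction_on_inter (C := fun S _ => ∫ a in S, w a ∂ν = 0)
    (generateFrom_eq_prod hPg hQg (isCountablySpanning_of_univ_mem hP1)
      (isCountablySpanning_of_univ_mem hQ1)).symm (hP.prod hQ) ?_ ?_ ?_ ?_ S hS
  · simp
  · rintro _ ⟨B, hB, D, hD, rfl⟩
    exact h B hB D hD
  · intro t ht h1
    rw [← integral_add_compl ht hi, h1, zero_add] at h0
    exact h0
  · intro f hd hf h1
    rw [integral_iUnion hf hd hi.integrableOn]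
    simp [h1]

end Boxes

section RelativeErgodicity

variable {X : Type*} [MeasurableSpace X] {μ : Measure X} [IsProbabilityMeasure μ]
  {Z : Type*} [CommGroup Z] [TopologicalSpace Z] [IsTopologicalGroup Z] [CompactSpace Z]
  [T2Space Z] [SecondCountableTopology Z] [MeasurableSpace Z] [BorelSpace Z]
  {m : Measure Z} [IsProbabilityMeasure m] [m.IsMulLeftInvariant]
  {τ : ℤ → X → X} {q : ℕ} {π : X → Z} {α : Z} {κ : Kernel Z X} [IsMarkovKernel κ]
  {W : Type*} [MeasurableSpace W] {M : Measure W} [IsProbabilityMeasure M] {p : W → Z}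

theorem Kron.avg_tensor_small (hK : Kron τ μ q π m α κ) {R : W → W} (hR : MeasurePreserving R M M)
    {b : W → ℂ} (hb : Bd 1 b) {g : X → ℂ} (hg : Bd 1 g) (h0 : ∀ᵐ z ∂m, CE κ g z = 0)
    {ε : ℝ} (hε : 0 < ε) :
    ∃ N : ℕ, 0 < N ∧ ∫ a, ‖(N : ℂ)⁻¹ * ∑ n ∈ Finset.range N, b (R^[n] a.1) * g (τ n a.2)‖ ^ 2
      ∂(M.prod μ) < ε := by
  have hB : ∀ n : ℕ, Bd 1 (fun a : W × X => b (R^[n] a.1) * g (τ n a.2)) := fun n =>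
    (hb.comp ((hR.iterate n).measurable.comp measurable_fst)).mul
      (hg.comp ((hK.toZAct.meas n).comp measurable_snd))
  set u : ℕ → Lp ℂ 2 (M.prod μ) := fun n => ((hB n).memLp 2).toLp _ with hu
  have hu1 : ∀ n, ‖u n‖ ≤ 1 := by
    intro n
    rw [← sq_le_one_iff₀ (norm_nonneg _), norm_toLp_sq]
    calc _ ≤ ∫ a : W × X, (1 : ℝ) ∂(M.prod μ) :=
          integral_mono (hB n).integrable_norm_sq (integrable_const _) fun a =>
            pow_le_one₀ (norm_nonneg _) ((hB n).bdd a)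
      _ = 1 := by simp
  have hc : ∀ n k : ℕ, ‖inner ℂ (u n) (u (n + k))‖ ≤ ‖∫ x, D τ k g x ∂μ‖ := by
    intro n k
    rw [inner_toLp]
    have e : ∀ a : W × X, conj (b (R^[n] a.1) * g (τ n a.2)) *
        (b (R^[n + k] a.1) * g (τ ((n + k : ℕ) : ℤ) a.2)) =
        (conj (b (R^[n] a.1)) * b (R^[n + k] a.1)) * D τ k g (τ n a.2) := by
      intro a
      rw [D, ← hK.add, map_mul, add_comm (k : ℤ) n, Nat.cast_add]
      ring
    simp only [e]
    rw [integral_prod_mul (fun w => conj (b (R^[n] w)) * b (R^[n + k] w))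
      (fun x => D τ k g (τ n x)), integral_comp_mp (hK.mp n) (hg.D hK.toZAct k), norm_mul]
    exact mul_le_of_le_one_left (norm_nonneg _) ((hb.comp (hR.iterate n).measurable).conj.mul
      (hb.comp (hR.iterate (n + k)).measurable)).norm_integral_le
  have hC : CesN fun k : ℕ => ‖∫ x, D τ k g x ∂μ‖ :=
    (hK.weak g hg h0).of_sq fun _ => norm_nonneg _
  have hUB : UB u 0 := van_der_corput_zero hu1 (fun _ => norm_nonneg _)
    (fun k _ => UB.of_norm_le fun n => hc n k) hC
  obtain ⟨N₀, hN₀⟩ := hUB (√ε / 2) (by positivity)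
  refine ⟨N₀ + 1, Nat.succ_pos _, ?_⟩
  set N := N₀ + 1 with hN
  have hNp : (0 : ℝ) < N := by positivity
  have h1 := hN₀ N (Nat.le_succ _) 0
  simp only [zero_add] at h1
  have hBs : Bd (∑ n ∈ Finset.range N, 1) (fun a : W × X =>
    ∑ n ∈ Finset.range N, b (R^[n] a.1) * g (τ n a.2)) := Bd.sum _ fun n _ => hB n
  have h2 : ∑ n ∈ Finset.range N, u n = (hBs.memLp 2).toLp _ := by
    refine Lp.ext ((Lp.coeFn_finsetSum _ u).trans (EventuallyEq.trans ?_
      (MemLp.coeFn_toLp _).symm))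
    have := eventually_countable_forall.2 fun n : ℕ => ((hB n).memLp (μ := M.prod μ) 2).coeFn_toLp
    filter_upwards [this] with a ha
    simp only [Finset.sum_apply]
    exact Finset.sum_congr rfl fun n _ => ha n
  have h3 : ∀ a : W × X, ‖(N : ℂ)⁻¹ * ∑ n ∈ Finset.range N, b (R^[n] a.1) * g (τ n a.2)‖ ^ 2 =
      ((N : ℝ)⁻¹) ^ 2 * ‖∑ n ∈ Finset.range N, b (R^[n] a.1) * g (τ n a.2)‖ ^ 2 := by
    intro a
    rw [norm_mul, norm_inv, Complex.norm_natCast, mul_pow]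
  simp only [h3]
  rw [integral_const_mul, ← norm_toLp_sq (hBs.memLp 2), ← h2]
  have h4 : ‖∑ n ∈ Finset.range N, u n‖ ^ 2 ≤ (√ε / 2 * N) ^ 2 :=
    pow_le_pow_left₀ (norm_nonneg _) h1 2
  calc ((N : ℝ)⁻¹) ^ 2 * ‖∑ n ∈ Finset.range N, u n‖ ^ 2
      ≤ ((N : ℝ)⁻¹) ^ 2 * (√ε / 2 * N) ^ 2 := by gcongr
    _ = ε / 4 := by
      field_simp
      rw [Real.sq_sqrt hε.le]
      ring
    _ < ε := by linarith

theorem ae_exists_lt_of_integral_small {f : ℕ → Z → ℝ} (h0 : ∀ n z, 0 ≤ f n z)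
    (hi : ∀ n, Integrable (f n) m) (h : ∀ ε > 0, ∃ n, ∫ z, f n z ∂m < ε) {ε : ℝ} (hε : 0 < ε) :
    ∀ᵐ z ∂m, ∃ n, f n z < ε := by
  have h1 : m.real {z | ∀ n, ε ≤ f n z} ≤ 0 := by
    refine le_of_forall_pos_le_add fun δ hδ => ?_
    obtain ⟨n, hn⟩ := h (ε * δ) (by positivity)
    have h2 := mul_meas_ge_le_integral_of_nonneg (ae_of_all m (h0 n)) (hi n) ε
    have h3 : m.real {z | ∀ n, ε ≤ f n z} ≤ m.real {z | ε ≤ f n z} :=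
      measureReal_mono fun z hz => hz n
    have h4 : ε * m.real {z | ε ≤ f n z} < ε * δ := h2.trans_lt hn
    rw [zero_add]
    exact h3.trans (lt_of_mul_lt_mul_left h4 hε.le).le
  have h2 : m {z | ∀ n, ε ≤ f n z} = 0 :=
    (measureReal_eq_zero_iff).1 (le_antisymm h1 measureReal_nonneg)
  rw [ae_iff]
  convert h2 using 3
  ext z
  push Not
  rfl

theorem Kron.ae_invariant_test (hK : Kron τ μ q π m α κ) [MeasurableSpace.CountablyGenerated X]
    (hp : MeasurePreserving p M m) {R : W → W} (hR : MeasurePreserving R M M)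
    (hpR : ∀ᵐ w ∂M, p (R w) = α * p w) {b : W → ℂ} (hb : Bd 1 b) {g : X → ℂ} (hg : Bd 1 g)
    (h0 : ∀ᵐ z ∂m, CE κ g z = 0) :
    ∀ᵐ s ∂m, ∀ (C : ℝ) (k : W × X → ℂ), Bd C k →
      (∀ᵐ a ∂(Ext κ M hp.measurable s), k (Prod.map R (τ 1) a) = k a) →
      ∫ a, k a * (b a.1 * g a.2) ∂(Ext κ M hp.measurable s) = 0 := by
  set A : ℕ → W × X → ℂ := fun N a =>
    ((N + 1 : ℕ) : ℂ)⁻¹ * ∑ n ∈ Finset.range (N + 1), b (R^[n] a.1) * g (τ n a.2) with hA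
  have hB : ∀ n : ℕ, Bd 1 (fun a : W × X => b (R^[n] a.1) * g (τ n a.2)) := fun n =>
    (hb.comp ((hR.iterate n).measurable.comp measurable_fst)).mul
      (hg.comp ((hK.toZAct.meas n).comp measurable_snd))
  have hAB : ∀ N, Bd 1 (A N) := fun N =>
    ((Bd.sum (Finset.range (N + 1)) fun n _ => hB n).const_mul _).mono (by
      rw [norm_inv, Complex.norm_natCast, Finset.sum_const, Finset.card_range, nsmul_eq_mul,
        mul_one, inv_mul_cancel₀ (by positivity)])
  have hA2 : ∀ N, Bd 1 (fun a => ((‖A N a‖ ^ 2 : ℝ) : ℂ)) := fun N =>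
    ⟨Complex.continuous_ofReal.measurable.comp ((hAB N).meas.norm.pow_const 2), fun a => by
      rw [Complex.norm_real, Real.norm_of_nonneg (by positivity)]
      exact pow_le_one₀ (norm_nonneg _) ((hAB N).bdd a)⟩
  have hintg : ∀ (N : ℕ) (s : Z), ∫ a, ((‖A N a‖ ^ 2 : ℝ) : ℂ) ∂(Ext κ M hp.measurable s) =
      ((∫ a, ‖A N a‖ ^ 2 ∂(Ext κ M hp.measurable s) : ℝ) : ℂ) := fun N s => integral_ofReal
  have hre : ∀ N, Integrable (fun s => ∫ a, ‖A N a‖ ^ 2 ∂(Ext κ M hp.measurable s)) m := by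
    intro N
    have := (bd_integral_Ext (κ := κ) (M := M) hp.measurable (hA2 N)).integrable (μ := m)
    simp only [hintg] at this
    simpa using this.re
  have hsmall : ∀ ε > 0, ∃ N, ∫ s, ∫ a, ‖A N a‖ ^ 2 ∂(Ext κ M hp.measurable s) ∂m < ε := by
    intro ε hε
    obtain ⟨N, hN, h⟩ := hK.avg_tensor_small hR hb hg h0 hε
    obtain ⟨N, rfl⟩ := Nat.exists_eq_succ_of_ne_zero hN.ne'
    refine ⟨N, ?_⟩
    have h1 := hK.integral_integral_Ext (M := M) hp.measurable (hA2 N)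
    simp only [hintg] at h1
    rw [integral_complex_ofReal, integral_complex_ofReal, Complex.ofReal_inj] at h1
    rw [h1]
    exact h
  have hae : ∀ᵐ s ∂m, ∀ i : ℕ, ∃ N, ∫ a, ‖A N a‖ ^ 2 ∂(Ext κ M hp.measurable s) <
      1 / ((i : ℝ) + 1) :=
    ae_all_iff.2 fun i => ae_exists_lt_of_integral_small
      (fun N s => integral_nonneg fun _ => by positivity) hre hsmall (by positivity)
  filter_upwards [hae] with s hs C k hk hinv
  set ν := Ext κ M hp.measurable s with hν
  have hmp : MeasurePreserving (Prod.map R (τ 1)) ν ν := hK.mp_Ext hp hR hpR s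
  have hit : ∀ (n : ℕ) (a : W × X), (Prod.map R (τ 1))^[n] a = (R^[n] a.1, τ n a.2) := by
    intro n a
    rw [Prod.map_iterate]
    have := hK.toZAct.iterate 1 n a.2
    rw [one_mul] at this
    exact Prod.ext rfl this
  have hinvn : ∀ n : ℕ, ∀ᵐ a ∂ν, k (R^[n] a.1, τ n a.2) = k a := by
    intro n
    induction n with
    | zero => exact ae_of_all _ fun a => by simp [hK.zero]
    | succ n ih =>
      filter_upwards [ih, (hmp.iterate n).quasiMeasurePreserving.ae hinv] with a h1 h2
      rw [← Function.iterate_succ_apply' (Prod.map R (τ 1)), hit, hit] at h2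
      exact h2.trans h1
  set I := ∫ a, k a * (b a.1 * g a.2) ∂ν with hI
  have hb0 : Bd 1 (fun a : W × X => b a.1 * g a.2) :=
    (hb.comp measurable_fst).mul (hg.comp measurable_snd)
  have hIn : ∀ n : ℕ, ∫ a, k a * (b (R^[n] a.1) * g (τ n a.2)) ∂ν = I := by
    intro n
    rw [hI, ← integral_comp_mp (hmp.iterate n) (hk.gmul hb0)]
    refine integral_congr_ae ?_
    filter_upwards [hinvn n] with a ha
    rw [hit, ha]
  have hIN : ∀ N, ∫ a, k a * A N a ∂ν = I := by
    intro N
    have e : ∀ a, k a * A N a = ((N + 1 : ℕ) : ℂ)⁻¹ *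
        ∑ n ∈ Finset.range (N + 1), k a * (b (R^[n] a.1) * g (τ n a.2)) := by
      intro a
      rw [hA, ← Finset.mul_sum]
      ring
    simp only [e]
    rw [integral_const_mul, integral_finsetSum _ fun n _ => (hk.gmul (hB n)).integrable]
    simp only [hIn, Finset.sum_const, Finset.card_range, nsmul_eq_mul]
    rw [inv_mul_cancel_left₀]
    exact_mod_cast Nat.succ_ne_zero N
  have hle : ∀ i : ℕ, ‖I‖ ^ 2 ≤ (∫ a, ‖k a‖ ^ 2 ∂ν) * (1 / ((i : ℝ) + 1)) := by
    intro i
    obtain ⟨N, hN⟩ := hs i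
    rw [← hIN N]
    refine (sq_norm_integral_mul_le (hk.memLp 2) ((hAB N).memLp 2)).trans ?_
    exact mul_le_mul_of_nonneg_left hN.le (integral_nonneg fun _ => by positivity)
  have hlim : Tendsto (fun i : ℕ => (∫ a, ‖k a‖ ^ 2 ∂ν) * (1 / ((i : ℝ) + 1))) atTop
      (𝓝 ((∫ a, ‖k a‖ ^ 2 ∂ν) * 0)) := tendsto_one_div_add_atTop_nhds_zero_nat.const_mul _
  rw [mul_zero] at hlim
  have := ge_of_tendsto' hlim hle
  have h2 : ‖I‖ ^ 2 = 0 := le_antisymm this (by positivity)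
  simpa using h2

end RelativeErgodicity

section RelativeErgodicity

variable {X : Type*} [MeasurableSpace X] {μ : Measure X} [IsProbabilityMeasure μ]
  {Z : Type*} [CommGroup Z] [TopologicalSpace Z] [IsTopologicalGroup Z] [CompactSpace Z]
  [T2Space Z] [SecondCountableTopology Z] [MeasurableSpace Z] [BorelSpace Z]
  {m : Measure Z} [IsProbabilityMeasure m] [m.IsMulLeftInvariant]
  {τ : ℤ → X → X} {q : ℕ} {π : X → Z} {α : Z} {κ : Kernel Z X} [IsMarkovKernel κ]
  {W : Type*} [MeasurableSpace W] {M : Measure W} [IsProbabilityMeasure M] {p : W → Z}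

theorem bd_indicator {Y : Type*} [MeasurableSpace Y] {B : Set Y} (hB : MeasurableSet B) :
    Bd 1 (B.indicator fun _ => (1 : ℂ)) :=
  ⟨measurable_const.indicator hB, fun x =>
    (norm_indicator_le_norm_self (f := fun _ : Y => (1 : ℂ)) x).trans (by simp)⟩

/-- Almost every extension is relatively ergodic over its base. -/
theorem Kron.ae_invariant_fibre (hK : Kron τ μ q π m α κ) [MeasurableSpace.CountablyGenerated X]
    [MeasurableSpace.CountablyGenerated W]
    (hp : MeasurePreserving p M m) {R : W → W} (hR : MeasurePreserving R M M)
    (hpR : ∀ᵐ w ∂M, p (R w) = α * p w) :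
    ∀ᵐ s ∂m, ∀ (C : ℝ) (k : W × X → ℂ), Bd C k →
      (∀ᵐ a ∂(Ext κ M hp.measurable s), k (Prod.map R (τ 1) a) = k a) →
      ∀ᵐ a ∂(Ext κ M hp.measurable s), k a = ∫ y, k (a.1, y) ∂(κ (s * p a.1)) := by
  obtain ⟨P, hPc, hP, hP1, hPg⟩ := exists_countable_algebra W
  obtain ⟨Q, hQc, hQ, hQ1, hQg⟩ := exists_countable_algebra X
  have hPm : ∀ B ∈ P, MeasurableSet B := fun B hB => by
    rw [← hPg]; exact MeasurableSpace.measurableSet_generateFrom hB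
  have hQm : ∀ B ∈ Q, MeasurableSet B := fun B hB => by
    rw [← hQg]; exact MeasurableSpace.measurableSet_generateFrom hB
  have hgB : ∀ D, MeasurableSet D → Bd (1 + 1) (fun x => D.indicator (fun _ => (1 : ℂ)) x -
      CE κ (D.indicator fun _ => (1 : ℂ)) (π x)) := fun D hD =>
    (bd_indicator hD).sub ((bd_indicator hD).CE.comp hK.pi.measurable)
  obtain ⟨G, hG⟩ : ∃ G : Set X → X → ℂ, ∀ D x, G D x = (1 / 2 : ℂ) *
    (D.indicator (fun _ => (1 : ℂ)) x - CE κ (D.indicator fun _ => (1 : ℂ)) (π x)) :=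
    ⟨_, fun _ _ => rfl⟩
  have hGB : ∀ D, MeasurableSet D → Bd 1 (G D) := fun D hD => by
    rw [funext (hG D)]
    exact ((hgB D hD).const_mul _).mono (by norm_num)
  have hGC : ∀ D, MeasurableSet D → ∀ᵐ z ∂m, CE κ (G D) z = 0 := fun D hD => by
    filter_upwards [hK.CE_sub_self (bd_indicator hD)] with z hz
    rw [funext (hG D), CE, integral_const_mul]
    change _ * CE κ _ z = 0
    rw [hz, mul_zero]
  have hall : ∀ᵐ s ∂m, ∀ B ∈ P, ∀ D ∈ Q, ∀ (C : ℝ) (k : W × X → ℂ), Bd C k →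
      (∀ᵐ a ∂(Ext κ M hp.measurable s), k (Prod.map R (τ 1) a) = k a) →
      ∫ a, k a * (B.indicator (fun _ => (1 : ℂ)) a.1 * G D a.2) ∂(Ext κ M hp.measurable s) = 0 := by
    rw [ae_ball_iff hPc]
    intro B hB
    rw [ae_ball_iff hQc]
    intro D hD
    exact hK.ae_invariant_test hp hR hpR (bd_indicator (hPm B hB)) (hGB D (hQm D hD))
      (hGC D (hQm D hD))
  filter_upwards [hall] with s hs C k hk hinv
  set ν := Ext κ M hp.measurable s with hν
  have hkb : Bd C (fun w => ∫ y, k (w, y) ∂(κ (s * p w))) :=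
    (bd_fibre_integral (κ := κ) hp.measurable hk).comp measurable_prodMk_left
  have hw : Bd (C + C) (fun a : W × X => k a - ∫ y, k (a.1, y) ∂(κ (s * p a.1))) :=
    hk.sub (hkb.comp measurable_fst)
  have hz : ∀ᵐ w ∂M, ∀ᵐ y ∂(κ (s * p w)), π y = s * p w :=
    ((measurePreserving_mul_left m s).comp hp).quasiMeasurePreserving.ae hK.ae_fiber
  have h0 : ∀ᵐ a ∂ν, k a - ∫ y, k (a.1, y) ∂(κ (s * p a.1)) = 0 := by
    refine ae_eq_zero_of_boxes hP hP1 hPg hQ hQ1 hQg hw fun B hB D hD => ?_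
    set β := B.indicator fun _ => (1 : ℂ) with hβ
    set δ := D.indicator fun _ => (1 : ℂ) with hδ
    have hβB : Bd 1 β := bd_indicator (hPm B hB)
    have hδB : Bd 1 δ := bd_indicator (hQm D hD)
    have h1 : ∫ a, k a * (β a.1 * G D a.2) ∂ν = 0 := hs B hB D hD C k hk hinv
    have e1 : ∀ a : W × X, k a * (β a.1 * ((1 / 2 : ℂ) * (δ a.2 - CE κ δ (π a.2)))) =
        (1 / 2 : ℂ) * (k a * (β a.1 * δ a.2) - k a * (β a.1 * CE κ δ (π a.2))) := fun a => by ring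
    have b1 : Bd (C * (1 * 1)) (fun a : W × X => k a * (β a.1 * δ a.2)) :=
      hk.gmul ((hβB.comp measurable_fst).gmul (hδB.comp measurable_snd))
    have b2 : Bd (C * (1 * 1)) (fun a : W × X => k a * (β a.1 * CE κ δ (π a.2))) :=
      hk.gmul ((hβB.comp measurable_fst).gmul
        (hδB.CE.comp (hK.pi.measurable.comp measurable_snd)))
    have b3 : Bd (C * (1 * 1)) (fun a : W × X => (∫ y, k (a.1, y) ∂(κ (s * p a.1))) *
        (β a.1 * δ a.2)) :=
      (hkb.comp measurable_fst).gmul ((hβB.comp measurable_fst).gmul (hδB.comp measurable_snd))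
    have hG' : ∀ x, G D x = (1 / 2 : ℂ) * (δ x - CE κ δ (π x)) := hG D
    simp only [hG', e1] at h1
    rw [integral_const_mul, integral_sub b1.integrable b2.integrable] at h1
    have h2 : ∫ a, k a * (β a.1 * δ a.2) ∂ν = ∫ a, k a * (β a.1 * CE κ δ (π a.2)) ∂ν :=
      sub_eq_zero.1 ((mul_eq_zero.1 h1).resolve_left (by norm_num))
    have h3 : ∫ a, k a * (β a.1 * CE κ δ (π a.2)) ∂ν =
        ∫ a, (∫ y, k (a.1, y) ∂(κ (s * p a.1))) * (β a.1 * δ a.2) ∂ν := by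
      rw [integral_Ext _ _ b2, integral_Ext _ _ b3]
      refine integral_congr_ae ?_
      filter_upwards [hz] with w hw
      rw [integral_const_mul, integral_const_mul]
      change _ = _ * (_ * CE κ δ (s * p w))
      rw [← integral_mul_const]
      refine integral_congr_ae ?_
      filter_upwards [hw] with y hy
      rw [hy]
    have e2 : ∀ a : W × X, (B ×ˢ D).indicator
        (fun a => k a - ∫ y, k (a.1, y) ∂(κ (s * p a.1))) a =
        k a * (β a.1 * δ a.2) - (∫ y, k (a.1, y) ∂(κ (s * p a.1))) * (β a.1 * δ a.2) := by
      intro a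
      rw [← sub_mul]
      by_cases ha : a.1 ∈ B <;> by_cases ha' : a.2 ∈ D <;>
        simp [hβ, hδ, Set.indicator, Set.mem_prod, ha, ha']
    rw [← integral_indicator ((hPm B hB).prod (hQm D hD))]
    simp only [e2]
    rw [integral_sub b1.integrable b3.integrable, h2, h3, sub_self]
  filter_upwards [h0] with a ha
  exact sub_eq_zero.1 ha

end RelativeErgodicity

section InverseTheorem

variable {X : Type*} [MeasurableSpace X] {μ : Measure X} [IsProbabilityMeasure μ]
  {Z : Type*} [CommGroup Z] [TopologicalSpace Z] [IsTopologicalGroup Z] [CompactSpace Z]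
  [T2Space Z] [SecondCountableTopology Z] [MeasurableSpace Z] [BorelSpace Z]
  {m : Measure Z} [IsProbabilityMeasure m] [m.IsMulLeftInvariant]
  {τ : ℤ → X → X} {q : ℕ} {π : X → Z} {α : Z} {κ : Kernel Z X} [IsMarkovKernel κ]
  {W : Type*} [MeasurableSpace W] {M : Measure W} [IsProbabilityMeasure M] {p : W → Z}

theorem mp_fst_Ext (hp : Measurable p) (s : Z) :
    MeasurePreserving Prod.fst (Ext κ M hp s) M :=
  ⟨measurable_fst, Measure.fst_compProd _ _⟩

theorem ae_ae_of_ae_Ext (hp : Measurable p) {s : Z} {P : W × X → Prop}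
    (h : ∀ᵐ a ∂(Ext κ M hp s), P a) : ∀ᵐ w ∂M, ∀ᵐ y ∂(κ (s * p w)), P (w, y) := by
  unfold Ext at h
  have h1 := Measure.ae_ae_of_ae_compProd
    (κ := κ.comap (fun w => s * p w) (hp.const_mul s)) (p := P) h
  filter_upwards [h1] with w hw
  rwa [Kernel.comap_apply] at hw

theorem ae_base_of_ae_Ext (hp : Measurable p) {s : Z} {P : W → Prop}
    (h : ∀ᵐ a ∂(Ext κ M hp s), P a.1) : ∀ᵐ w ∂M, P w := by
  filter_upwards [ae_ae_of_ae_Ext hp h] with w hw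
  obtain ⟨y, hy⟩ := hw.exists
  exact hy

theorem Kron.mp_snd_Ext (hK : Kron τ μ q π m α κ) :
    MeasurePreserving Prod.snd (Ext κ μ hK.pi.measurable 1) μ := by
  refine ⟨measurable_snd, ?_⟩
  ext S hS
  unfold Ext
  rw [Measure.map_apply measurable_snd hS, Measure.compProd_apply (measurable_snd hS)]
  have hm : Measurable fun x => (π x, x) := hK.pi.measurable.prodMk measurable_id
  have h1 : (m ⊗ₘ κ) (Prod.snd ⁻¹' S) = μ S := by
    rw [← hK.disint, Measure.map_apply hm (measurable_snd hS)]
    rfl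
  rw [← h1, Measure.compProd_apply (measurable_snd hS),
    ← hK.pi.lintegral_comp (Kernel.measurable_kernel_prodMk_left (measurable_snd hS))]
  refine lintegral_congr fun x => ?_
  rw [Kernel.comap_apply, one_mul]
  rfl

theorem Kron.mp_Ext_map (hK : Kron τ μ q π m α κ) (hp : Measurable p) {f : W → X}
    (hf : MeasurePreserving f M μ) (h : ∀ᵐ w ∂M, π (f w) = p w) (s : Z) :
    MeasurePreserving (fun a : W × X => (f a.1, a.2)) (Ext κ M hp s)
      (Ext κ μ hK.pi.measurable s) := by
  have hg : Measurable fun a : W × X => (f a.1, a.2) :=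
    (hf.measurable.comp measurable_fst).prodMk measurable_snd
  refine ⟨hg, ?_⟩
  ext S hS
  unfold Ext
  rw [Measure.map_apply hg hS, Measure.compProd_apply (hg hS), Measure.compProd_apply hS,
    ← hf.lintegral_comp (Kernel.measurable_kernel_prodMk_left hS)]
  refine lintegral_congr_ae ?_
  filter_upwards [h] with w hw
  rw [Kernel.comap_apply, Kernel.comap_apply, hw]
  rfl

theorem Kron.ae_pi_eq (hK : Kron τ μ q π m α κ) :
    ∀ᵐ a ∂(Ext κ μ hK.pi.measurable 1), π a.2 = π a.1 := by
  unfold Ext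
  have hs : MeasurableSet {a : X × X | π a.2 = π a.1} :=
    measurableSet_eq_fun (hK.pi.measurable.comp measurable_snd)
      (hK.pi.measurable.comp measurable_fst)
  refine (Measure.ae_compProd_iff hs).2 ?_
  filter_upwards [hK.pi.quasiMeasurePreserving.ae hK.ae_fiber] with x hx
  rw [Kernel.comap_apply, one_mul]
  exact hx

theorem Kron.eq_CE_of_ae_eq (hK : Kron τ μ q π m α κ) {u : X → ℂ}
    (h : ∀ᵐ a ∂(Ext κ μ hK.pi.measurable 1), u a.1 = u a.2) :
    ∀ᵐ x ∂μ, u x = CE κ u (π x) := by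
  filter_upwards [ae_ae_of_ae_Ext hK.pi.measurable h] with x hx
  rw [one_mul] at hx
  calc u x = ∫ y, u x ∂(κ (π x)) := by simp
    _ = _ := integral_congr_ae hx

theorem Kron.autoCorr_CE_D (hK : Kron τ μ q π m α κ) {g : X → ℂ} (hg : Bd 1 g) (s : Z) (k : ℕ) :
    ∫ a, (conj (g ((τ 1)^[k] a.1)) * g ((τ 1)^[k] a.2)) * conj (conj (g a.1) * g a.2)
      ∂(Ext κ μ hK.pi.measurable s) = autoCorr m (CE κ (D τ k g)) s := by
  have hD : Bd 1 (D τ k g) := hg.D hK.toZAct k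
  have hit : ∀ x, (τ 1)^[k] x = τ k x := fun x => by
    have := hK.toZAct.iterate 1 k x
    rwa [one_mul] at this
  have e : ∀ a : X × X, (conj (g ((τ 1)^[k] a.1)) * g ((τ 1)^[k] a.2)) *
      conj (conj (g a.1) * g a.2) = conj (D τ k g a.1) * D τ k g a.2 := by
    intro a
    rw [hit, hit, D, D, map_mul, map_mul, Complex.conj_conj]
    ring
  simp only [e]
  have hB : Bd 1 (fun a : X × X => conj (D τ k g a.1) * D τ k g a.2) :=
    (hD.comp measurable_fst).conj.mul (hD.comp measurable_snd)
  rw [integral_Ext _ _ hB, autoCorr]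
  simp only [integral_const_mul]
  have h1 := hK.integral_pi_mul (φ := fun z => CE κ (D τ k g) (s * z))
    (hD.CE.comp (measurable_const_mul s)) hD.conj
  simp only [CE_conj] at h1
  rw [← h1]
  refine integral_congr_ae (ae_of_all _ fun x => ?_)
  exact mul_comm _ _

theorem Kron.not_ae_cesN (hK : Kron τ μ q π m α κ) {g : X → ℂ} (hg : Bd 1 g)
    (hU : ¬ Unif τ m κ g) :
    ¬ ∀ᵐ s ∂m, CesN fun k : ℕ => ‖autoCorr m (CE κ (D τ k g)) s‖ ^ 2 := by
  intro h
  apply hU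
  have hD : ∀ k : ℕ, Bd 1 (CE κ (D τ k g)) := fun k => (hg.D hK.toZAct k).CE
  have hc : ∀ k : ℕ, Continuous fun s => ‖autoCorr m (CE κ (D τ k g)) s‖ ^ 2 := fun k =>
    (continuous_autoCorr (hD k)).norm.pow 2
  have hle : ∀ (k : ℕ) s, ‖autoCorr m (CE κ (D τ k g)) s‖ ^ 2 ≤ 1 := fun k s =>
    pow_le_one₀ (norm_nonneg _) (norm_autoCorr_le (hD k) s)
  have hintg : ∀ k : ℕ, Integrable (fun s => ‖autoCorr m (CE κ (D τ k g)) s‖ ^ 2) m := fun k =>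
    Integrable.of_bound (hc k).measurable.aestronglyMeasurable 1 (ae_of_all _ fun s => by
      rw [Real.norm_of_nonneg (by positivity)]; exact hle k s)
  have h1 : ∀ N : ℕ, (∑ k ∈ Finset.range N, autoMass m (CE κ (D τ k g))) / N =
      ∫ s, (∑ k ∈ Finset.range N, ‖autoCorr m (CE κ (D τ k g)) s‖ ^ 2) / N ∂m := by
    intro N
    rw [integral_div, integral_finsetSum _ fun k _ => hintg k]
    rfl
  unfold Unif CesN
  simp only [h1]
  rw [← integral_zero Z ℝ (μ := m)]
  refine tendsto_integral_of_dominated_convergence (fun _ => 1) (fun N => ?_)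
    (integrable_const _) (fun N => ae_of_all _ fun s => ?_) h
  · exact ((Finset.measurable_sum _ fun k _ => (hc k).measurable).div_const _).aestronglyMeasurable
  · rw [Real.norm_of_nonneg (by positivity)]
    refine div_le_one_of_le₀ ?_ (Nat.cast_nonneg _)
    calc _ ≤ ∑ k ∈ Finset.range N, (1 : ℝ) := Finset.sum_le_sum fun k _ => hle k s
      _ = N := by simp

end InverseTheorem

/-- The phase `w / ‖w‖`, with the convention that the phase of `0` is `1`. -/
noncomputable def phase (w : ℂ) : ℂ := if w = 0 then 1 else w / (‖w‖ : ℂ)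

theorem measurable_phase : Measurable phase := by
  unfold phase
  exact Measurable.ite (measurableSet_singleton 0) measurable_const
    (measurable_id.div (Complex.measurable_ofReal.comp measurable_norm))

theorem norm_phase (w : ℂ) : ‖phase w‖ = 1 := by
  unfold phase
  split_ifs with h
  · simp
  · rw [norm_div, Complex.norm_real, norm_norm, div_self (norm_ne_zero_iff.2 h)]

theorem norm_mul_phase (w : ℂ) : (‖w‖ : ℂ) * phase w = w := by
  unfold phase
  split_ifs with h
  · simp [h]
  · rw [mul_div_cancel₀]
    exact Complex.ofReal_ne_zero.2 (norm_ne_zero_iff.2 h)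

theorem mul_phase_eq {ρ k a b : ℂ} (hρ : ρ ≠ 0) (hk : ‖k‖ = ‖ρ‖) (h : ρ * a = k * b) (ha : a ≠ 0) :
    ρ * phase a = k * phase b := by
  have hn : ‖a‖ = ‖b‖ := by
    have := congrArg norm h
    rw [norm_mul, norm_mul, hk] at this
    exact mul_left_cancel₀ (norm_ne_zero_iff.2 hρ) this
  have ha' : (‖a‖ : ℂ) ≠ 0 := Complex.ofReal_ne_zero.2 (norm_ne_zero_iff.2 ha)
  apply mul_left_cancel₀ ha'
  calc (‖a‖ : ℂ) * (ρ * phase a) = ρ * ((‖a‖ : ℂ) * phase a) := by ring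
    _ = k * ((‖b‖ : ℂ) * phase b) := by rw [norm_mul_phase, norm_mul_phase, h]
    _ = _ := by rw [hn]; ring

open Classical in
/-- The first time at which the orbit of `x` leaves the zero set of `h` (`0` if there is none). -/
noncomputable def firstTime {X : Type*} (T : X → X) (h : X → ℂ) (x : X) : ℕ :=
  if H : ∃ n, h (T^[n] x) ≠ 0 then Nat.find H else 0

theorem firstTime_spec {X : Type*} {T : X → X} {h : X → ℂ} {x : X} (H : ∃ n, h (T^[n] x) ≠ 0) :
    h (T^[firstTime T h x] x) ≠ 0 := by
  classical
  rw [firstTime, dif_pos H]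
  exact Nat.find_spec H

theorem firstTime_congr {X : Type*} {T : X → X} {h : X → ℂ} {x y : X}
    (H : ∀ n, h (T^[n] x) = 0 ↔ h (T^[n] y) = 0) : firstTime T h x = firstTime T h y := by
  classical
  unfold firstTime
  have : (fun n => h (T^[n] x) ≠ 0) = fun n => h (T^[n] y) ≠ 0 := by
    funext n
    exact propext (not_congr (H n))
  simp only [this]

theorem measurable_firstTime {X : Type*} [MeasurableSpace X] {T : X → X} (hT : Measurable T)
    {h : X → ℂ} (hh : Measurable h) : Measurable (firstTime T h) := by
  classical
  have hm : ∀ n, MeasurableSet {x | h (T^[n] x) ≠ 0} := fun n =>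
    (measurableSet_eq_fun (hh.comp (hT.iterate n)) measurable_const).compl
  have h0 : MeasurableSet {x | ∀ j, h (T^[j] x) = 0} := by
    rw [Set.ofPred_forall]
    exact MeasurableSet.iInter fun n =>
      measurableSet_eq_fun (hh.comp (hT.iterate n)) measurable_const
  have hex : ∀ x, ∃ n, (h (T^[n] x) ≠ 0 ∨ ∀ j, h (T^[j] x) = 0) := by
    intro x
    by_cases H : ∃ n, h (T^[n] x) ≠ 0
    · exact H.imp fun n hn => Or.inl hn
    · push Not at H
      exact ⟨0, Or.inr H⟩
  have : firstTime T h = fun x => Nat.find (hex x) := by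
    funext x
    unfold firstTime
    split_ifs with H
    · refine Nat.find_congr' fun {n} => ⟨Or.inl, fun hn => hn.resolve_right fun h' => ?_⟩
      obtain ⟨n, hn⟩ := H
      exact hn (h' n)
    · push Not at H
      exact ((Nat.find_eq_zero (hex x)).2 (Or.inr H)).symm
  rw [this]
  exact measurable_find hex fun n => (hm n).union h0

theorem measurable_phase_firstTime {X : Type*} [MeasurableSpace X] {T : X → X} (hT : Measurable T)
    {h : X → ℂ} (hh : Measurable h) :
    Measurable fun x => phase (h (T^[firstTime T h x] x)) := by
  have h1 : Measurable fun a : X × ℕ => phase (h (T^[a.2] a.1)) :=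
    measurable_from_prod_countable_left fun n =>
      measurable_phase.comp (hh.comp (hT.iterate n))
  exact h1.comp (measurable_id.prodMk (measurable_firstTime hT hh))

section InverseTheorem

variable {X : Type*} [MeasurableSpace X] {μ : Measure X} [IsProbabilityMeasure μ]
  {Z : Type*} [CommGroup Z] [TopologicalSpace Z] [IsTopologicalGroup Z] [CompactSpace Z]
  [T2Space Z] [SecondCountableTopology Z] [MeasurableSpace Z] [BorelSpace Z]
  {m : Measure Z} [IsProbabilityMeasure m] [m.IsMulLeftInvariant]
  {τ : ℤ → X → X} {q : ℕ} {π : X → Z} {α : Z} {κ : Kernel Z X} [IsMarkovKernel κ]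
  {W : Type*} [MeasurableSpace W] {M : Measure W} [IsProbabilityMeasure M] {p : W → Z}

theorem Kron.ae_visit (hK : Kron τ μ q π m α κ) {h : X → ℂ} (hh : Measurable h)
    (hne : ¬ ∀ᵐ x ∂μ, h x = 0) : ∀ᵐ x ∂μ, ∃ n, h ((τ 1)^[n] x) ≠ 0 := by
  have hT := hK.toZAct.meas 1
  set B : Set X := {x | ∀ n, h ((τ 1)^[n] x) = 0} with hB
  have hBm : MeasurableSet B := by
    rw [hB, Set.ofPred_forall]
    exact MeasurableSet.iInter fun n =>
      measurableSet_eq_fun (hh.comp (hT.iterate n)) measurable_const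
  have hsub : B ⊆ τ 1 ⁻¹' B := fun x hx n => by
    rw [← Function.iterate_succ_apply]
    exact hx (n + 1)
  rcases hK.ergodic_one.ae_empty_or_univ_of_ae_le_preimage hBm.nullMeasurableSet
    hsub.eventuallyLE with h0 | h0
  · filter_upwards [h0] with x hx
    have hx' : ¬ x ∈ B := fun hxB => by
      have : B x = (∅ : Set X) x := hx
      exact (this ▸ hxB : (∅ : Set X) x)
    by_contra hcon
    push Not at hcon
    exact hx' hcon
  · exfalso
    apply hne
    filter_upwards [h0] with x hx
    have hx' : x ∈ B := by
      have : B x = (Set.univ : Set X) x := hx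
      exact (this ▸ trivial : B x)
    exact hx' 0

/-- Turning a function satisfying a fibrewise cocycle relation into a unimodular one. -/
theorem Kron.exists_cl_of_relation (hK : Kron τ μ q π m α κ)
    [MeasurableSpace.CountablyGenerated X] {h₀ : X → ℂ} {C : ℝ} (hh : Bd C h₀)
    {kb : X × X → ℂ} {ρ : ℂ} (hρ : ρ ≠ 0)
    (hkb : ∀ᵐ w ∂(Ext κ μ hK.pi.measurable 1), ‖kb w‖ = ‖ρ‖)
    (hinv : ∀ᵐ w ∂(Ext κ μ hK.pi.measurable 1), kb (Prod.map (τ 1) (τ 1) w) = kb w)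
    (hrel : ∀ᵐ w ∂(Ext κ μ hK.pi.measurable 1), ρ * h₀ w.1 = kb w * h₀ w.2)
    (hne : ¬ ∀ᵐ x ∂μ, h₀ x = 0) :
    ∃ (h : X → ℂ) (φ : Z → ℂ), CL τ μ π h ∧ Bd C φ ∧ ∀ᵐ x ∂μ, h₀ x = φ (π x) * h x := by
  have hT := hK.toZAct.meas 1
  set V := Ext κ μ hK.pi.measurable 1 with hV
  have hR : MeasurePreserving (Prod.map (τ 1) (τ 1)) V V := hK.mp_Ext hK.pi (hK.mp 1) hK.rot 1
  have hit : ∀ (n : ℕ) (w : X × X), (Prod.map (τ 1) (τ 1))^[n] w =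
      ((τ 1)^[n] w.1, (τ 1)^[n] w.2) := by
    intro n w
    rw [Prod.map_iterate]; rfl
  have hinv' : ∀ n : ℕ, ∀ᵐ w ∂V, kb ((Prod.map (τ 1) (τ 1))^[n] w) = kb w := by
    intro n
    induction n with
    | zero => exact ae_of_all _ fun _ => rfl
    | succ n ih =>
      filter_upwards [ih, (hR.iterate n).quasiMeasurePreserving.ae hinv] with w h1 h2
      rw [Function.iterate_succ_apply', h2, h1]
  have hrel' : ∀ᵐ w ∂V, ∀ n : ℕ, ρ * h₀ ((τ 1)^[n] w.1) = kb w * h₀ ((τ 1)^[n] w.2) := by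
    rw [ae_all_iff]
    intro n
    filter_upwards [hinv' n, (hR.iterate n).quasiMeasurePreserving.ae hrel] with w h1 h2
    rw [h1, hit] at h2
    exact h2
  have hvis : ∀ᵐ w ∂V, ∃ n, h₀ ((τ 1)^[n] w.1) ≠ 0 :=
    (mp_fst_Ext hK.pi.measurable 1).quasiMeasurePreserving.ae (hK.ae_visit hh.meas hne)
  obtain ⟨h, hhdef⟩ : ∃ h : X → ℂ, ∀ x, h x = phase (h₀ ((τ 1)^[firstTime (τ 1) h₀ x] x)) :=
    ⟨_, fun _ => rfl⟩
  have hm : Measurable h := by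
    have : h = fun x => phase (h₀ ((τ 1)^[firstTime (τ 1) h₀ x] x)) := funext hhdef
    rw [this]; exact measurable_phase_firstTime hT hh.meas
  have h1 : ∀ x, ‖h x‖ = 1 := fun x => by rw [hhdef]; exact norm_phase _
  have hbd : Bd 1 h := ⟨hm, fun x => (h1 x).le⟩
  have hrel1 : ∀ᵐ w ∂V, ρ * h w.1 = kb w * h w.2 := by
    filter_upwards [hrel', hvis, hkb] with w h2 h3 h4
    have hkb0 : kb w ≠ 0 := norm_ne_zero_iff.1 (by rw [h4]; exact norm_ne_zero_iff.2 hρ)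
    have hc : firstTime (τ 1) h₀ w.1 = firstTime (τ 1) h₀ w.2 := by
      refine firstTime_congr fun n => ⟨fun h => ?_, fun h => ?_⟩
      · have := h2 n
        rw [h, mul_zero] at this
        exact (mul_eq_zero.1 this.symm).resolve_left hkb0
      · have := h2 n
        rw [h, mul_zero] at this
        exact (mul_eq_zero.1 this).resolve_left hρ
    rw [hhdef, hhdef, ← hc]
    exact mul_phase_eq hρ h4 (h2 _) (firstTime_spec h3)
  have hrel2 : ∀ᵐ w ∂V, ρ * h (τ 1 w.1) = kb w * h (τ 1 w.2) := by
    filter_upwards [hinv, hR.quasiMeasurePreserving.ae hrel1] with w h2 h3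
    rw [h2] at h3
    exact h3
  have hu : ∀ᵐ w ∂V, D τ 1 h w.1 = D τ 1 h w.2 := by
    filter_upwards [hrel1, hrel2, hkb] with w h2 h3 h4
    have hρ2 : ρ * conj ρ ≠ 0 := mul_ne_zero hρ ((map_ne_zero _).2 hρ)
    have hk2 : kb w * conj (kb w) = ρ * conj ρ := by
      rw [Complex.mul_conj, Complex.mul_conj, Complex.normSq_eq_norm_sq,
        Complex.normSq_eq_norm_sq, h4]
    apply mul_left_cancel₀ hρ2
    unfold D
    calc ρ * conj ρ * (h (τ 1 w.1) * conj (h w.1))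
        = (ρ * h (τ 1 w.1)) * conj (ρ * h w.1) := by rw [map_mul]; ring
      _ = (kb w * conj (kb w)) * (h (τ 1 w.2) * conj (h w.2)) := by
        rw [h2, h3, map_mul]; ring
      _ = _ := by rw [hk2]
  have huCE := hK.eq_CE_of_ae_eq hu
  have hDb : Bd 1 (D τ 1 h) := hbd.D hK.toZAct 1
  have hh1 : ∀ x, h (τ 1 x) = D τ 1 h x * h x := fun x => by
    unfold D
    rw [mul_assoc, mul_comm (conj (h x)), Complex.mul_conj, Complex.normSq_eq_norm_sq, h1]
    simp
  have hn : ∀ᵐ w ∂V, (‖h₀ w.1‖ : ℂ) = (‖h₀ w.2‖ : ℂ) := by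
    filter_upwards [hrel, hkb] with w h2 h3
    have := congrArg norm h2
    rw [norm_mul, norm_mul, h3] at this
    rw [mul_left_cancel₀ (norm_ne_zero_iff.2 hρ) this]
  have hnCE := hK.eq_CE_of_ae_eq (u := fun x => (‖h₀ x‖ : ℂ)) hn
  have hnb : Bd C (fun x => (‖h₀ x‖ : ℂ)) :=
    ⟨Complex.measurable_ofReal.comp hh.meas.norm, fun x => by
      rw [Complex.norm_real, norm_norm]; exact hh.bdd x⟩
  refine ⟨h, CE κ (fun x => (‖h₀ x‖ : ℂ)), ⟨hm, h1, fun z => phase (CE κ (D τ 1 h) z),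
    measurable_phase.comp hDb.CE.meas, fun z => norm_phase _, ?_⟩, hnb.CE, ?_⟩
  · filter_upwards [huCE] with x hx
    rw [hh1, ← hx]
    congr 1
    have hD1 : ‖D τ 1 h x‖ = 1 := by
      unfold D; rw [norm_mul, Complex.norm_conj, h1, h1, one_mul]
    have := norm_mul_phase (D τ 1 h x)
    rw [hD1] at this
    simpa using this.symm
  · filter_upwards [hnCE] with x hx
    rw [← hx]
    by_cases h0 : h₀ x = 0
    · simp [h0]
    · have hf : firstTime (τ 1) h₀ x = 0 := by
        classical
        have H : ∃ n, h₀ ((τ 1)^[n] x) ≠ 0 := ⟨0, h0⟩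
        rw [firstTime, dif_pos H]
        exact (Nat.find_eq_zero H).2 h0
      rw [hhdef, hf, Function.iterate_zero_apply, norm_mul_phase]

end InverseTheorem

section InverseTheorem

variable {X : Type*} [MeasurableSpace X] {μ : Measure X} [IsProbabilityMeasure μ]
  {Z : Type*} [CommGroup Z] [TopologicalSpace Z] [IsTopologicalGroup Z] [CompactSpace Z]
  [T2Space Z] [SecondCountableTopology Z] [MeasurableSpace Z] [BorelSpace Z]
  {m : Measure Z} [IsProbabilityMeasure m] [m.IsMulLeftInvariant]
  {τ : ℤ → X → X} {q : ℕ} {π : X → Z} {α : Z} {κ : Kernel Z X} [IsMarkovKernel κ]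
  {W : Type*} [MeasurableSpace W] {M : Measure W} [IsProbabilityMeasure M] {p : W → Z}

theorem fibre_integral_invariant (hp : Measurable p) {R : W → W} {s : Z}
    (hmp : MeasurePreserving (Prod.map R (τ 1)) (Ext κ M hp s) (Ext κ M hp s))
    {k : W × X → ℂ} {r : W → ℂ}
    (hinv : ∀ᵐ a ∂(Ext κ M hp s), k (Prod.map R (τ 1) a) = k a)
    (hr : ∀ᵐ a ∂(Ext κ M hp s), k a = r a.1) : ∀ᵐ w ∂M, r (R w) = r w := by
  refine ae_base_of_ae_Ext (κ := κ) hp (s := s) ?_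
  filter_upwards [hinv, hr, hmp.quasiMeasurePreserving.ae hr] with a h1 h2 h3
  rw [← h2, ← h1, h3]
  rfl

/-- The inverse theorem: non-uniformity is correlation with a function of derivative in the
rotation factor. -/
theorem Kron.exists_cl (hK : Kron τ μ q π m α κ) [MeasurableSpace.CountablyGenerated X]
    {g : X → ℂ} (hg : Bd 1 g) (hU : ¬ Unif τ m κ g) :
    ∃ h, CL τ μ π h ∧ ¬ ∀ᵐ z ∂m, CE κ (fun x => g x * conj (h x)) z = 0 := by
  have hπ := hK.pi.measurable
  obtain ⟨V, hV⟩ : ∃ V, V = Ext κ μ hπ 1 := ⟨_, rfl⟩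
  have hVp : IsProbabilityMeasure V := by rw [hV]; infer_instance
  have hfst : MeasurePreserving Prod.fst V μ := by rw [hV]; exact mp_fst_Ext hπ 1
  have hsnd : MeasurePreserving Prod.snd V μ := by rw [hV]; exact hK.mp_snd_Ext
  have hR : MeasurePreserving (Prod.map (τ 1) (τ 1)) V V := by
    rw [hV]; exact hK.mp_Ext hK.pi (hK.mp 1) hK.rot 1
  have hpi12 : ∀ᵐ w ∂V, π w.2 = π w.1 := by rw [hV]; exact hK.ae_pi_eq
  have hp2 : MeasurePreserving (fun w : X × X => π w.1) V m := hK.pi.comp hfst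
  have hpR : ∀ᵐ w ∂V, π (Prod.map (τ 1) (τ 1) w).1 = α * π w.1 :=
    hfst.quasiMeasurePreserving.ae hK.rot
  have A1 := hK.ae_invariant_fibre hK.pi (hK.mp 1) hK.rot
  have A2 := hK.ae_invariant_fibre hp2 hR hpR
  obtain ⟨s, hs, hs1, hs2⟩ : ∃ s, (¬ CesN fun k : ℕ => ‖autoCorr m (CE κ (D τ k g)) s‖ ^ 2) ∧
      (∀ (C : ℝ) (k : X × X → ℂ), Bd C k →
      (∀ᵐ a ∂(Ext κ μ hπ s), k (Prod.map (τ 1) (τ 1) a) = k a) →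
      ∀ᵐ a ∂(Ext κ μ hπ s), k a = ∫ y, k (a.1, y) ∂(κ (s * π a.1))) ∧
      (∀ (C : ℝ) (k : (X × X) × X → ℂ), Bd C k →
      (∀ᵐ a ∂(Ext κ V hp2.measurable s), k (Prod.map (Prod.map (τ 1) (τ 1)) (τ 1) a) = k a) →
      ∀ᵐ a ∂(Ext κ V hp2.measurable s), k a = ∫ y, k (a.1, y) ∂(κ (s * π a.1.1))) := by
    by_contra hcon
    apply hK.not_ae_cesN hg hU
    filter_upwards [A1, A2] with s h1 h2
    by_contra hc
    exact hcon ⟨s, hc, h1, h2⟩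
  obtain ⟨E₁, hE₁⟩ : ∃ E, E = Ext κ μ hπ s := ⟨_, rfl⟩
  obtain ⟨E₂, hE₂⟩ : ∃ E, E = Ext κ V hp2.measurable s := ⟨_, rfl⟩
  have hE₁p : IsProbabilityMeasure E₁ := by rw [hE₁]; infer_instance
  rw [← hE₁] at hs1
  rw [← hE₂] at hs2
  have hR1 : MeasurePreserving (Prod.map (τ 1) (τ 1)) E₁ E₁ := by
    rw [hE₁]; exact hK.mp_Ext hK.pi (hK.mp 1) hK.rot s
  have hR2 : MeasurePreserving (Prod.map (Prod.map (τ 1) (τ 1)) (τ 1)) E₂ E₂ := by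
    rw [hE₂]; exact hK.mp_Ext hp2 hR hpR s
  have hp13 : MeasurePreserving (fun a : (X × X) × X => (a.1.1, a.2)) E₂ E₁ := by
    rw [hE₁, hE₂]; exact hK.mp_Ext_map hp2.measurable hfst (ae_of_all _ fun _ => rfl) s
  have hp23 : MeasurePreserving (fun a : (X × X) × X => (a.1.2, a.2)) E₂ E₁ := by
    rw [hE₁, hE₂]; exact hK.mp_Ext_map hp2.measurable hsnd hpi12 s
  have hG : Bd 1 fun a : X × X => conj (g a.1) * g a.2 :=
    (hg.comp measurable_fst).conj.mul (hg.comp measurable_snd)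
  obtain ⟨ψ, l, hψ, hl, heig, hGψ⟩ := exists_eigenfunction hR1 hG (by
    intro hc
    apply hs
    convert hc using 4 with k
    rw [hE₁, ← hK.autoCorr_CE_D hg s k]
    simp only [Prod.map_iterate, Prod.map_fst, Prod.map_snd])
  have hll : conj l * l = 1 := by
    rw [mul_comm, Complex.mul_conj, Complex.normSq_eq_norm_sq, hl]; simp
  -- constancy of the modulus of the eigenfunction
  obtain ⟨ρ, hρ⟩ : ∃ ρ : ℂ, ∀ᵐ a ∂E₁, ψ a * conj (ψ a) = ρ := by
    have hB : Bd 1 fun a => ψ a * conj (ψ a) := hψ.mul hψ.conj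
    have hinv : ∀ᵐ a ∂E₁, ψ (Prod.map (τ 1) (τ 1) a) * conj (ψ (Prod.map (τ 1) (τ 1) a)) =
        ψ a * conj (ψ a) := by
      filter_upwards [heig] with a ha
      rw [ha, map_mul]
      calc _ = (conj l * l) * (ψ a * conj (ψ a)) := by ring
        _ = _ := by rw [hll, one_mul]
    obtain ⟨r, hr⟩ : ∃ r : X → ℂ, ∀ x, r x = ∫ y, ψ (x, y) * conj (ψ (x, y)) ∂(κ (s * π x)) :=
      ⟨_, fun _ => rfl⟩
    have hrm : Measurable r := by
      have h1 := (bd_fibre_integral (κ := κ) hπ hB).meas.comp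
        (measurable_const.prodMk measurable_id : Measurable fun x : X => (s, x))
      have : r = _ := funext hr
      rw [this]; exact h1
    have hkr : ∀ᵐ a ∂E₁, ψ a * conj (ψ a) = r a.1 := by
      filter_upwards [hs1 1 _ hB hinv] with a ha
      rw [ha, hr]
    have hri : ∀ᵐ x ∂μ, r (τ 1 x) = r x := by
      rw [hE₁] at hinv hkr hR1
      exact fibre_integral_invariant hπ hR1 hinv hkr
    obtain ⟨ρ, hρ⟩ := hK.exists_ae_eq_const hrm hri
    have hρ1 : ∀ᵐ a ∂E₁, r a.1 = ρ := by
      rw [hE₁]; exact (mp_fst_Ext hπ s).quasiMeasurePreserving.ae hρ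
    exact ⟨ρ, by filter_upwards [hkr, hρ1] with a h1 h2; rw [h1, h2]⟩
  have hρ0 : ρ ≠ 0 := by
    rintro rfl
    apply hGψ
    rw [← integral_zero (X × X) ℂ (μ := E₁)]
    refine integral_congr_ae ?_
    filter_upwards [hρ] with a ha
    have : ψ a = 0 := by
      rw [Complex.mul_conj] at ha
      exact Complex.normSq_eq_zero.1 (Complex.ofReal_eq_zero.1 ha)
    simp [this]
  -- the relation between two points of the same fibre
  have hkB : Bd 1 fun a : (X × X) × X => conj (ψ (a.1.1, a.2)) * ψ (a.1.2, a.2) :=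
    (hψ.comp hp13.measurable).conj.mul (hψ.comp hp23.measurable)
  obtain ⟨kf, hkf⟩ : ∃ kf : (X × X) × X → ℂ, ∀ a, kf a = conj (ψ (a.1.1, a.2)) * ψ (a.1.2, a.2) :=
    ⟨_, fun _ => rfl⟩
  have hkfB : Bd 1 kf := by
    have : kf = _ := funext hkf
    rw [this]; exact hkB
  have hkinv : ∀ᵐ a ∂E₂, kf (Prod.map (Prod.map (τ 1) (τ 1)) (τ 1) a) = kf a := by
    filter_upwards [hp13.quasiMeasurePreserving.ae heig, hp23.quasiMeasurePreserving.ae heig]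
      with a h1 h2
    simp only [Prod.map_apply] at h1 h2
    rw [hkf, hkf]
    simp only [Prod.map_fst, Prod.map_snd]
    rw [h1, h2, map_mul]
    calc _ = (conj l * l) * (conj (ψ (a.1.1, a.2)) * ψ (a.1.2, a.2)) := by ring
      _ = _ := by rw [hll, one_mul]
  obtain ⟨kb, hkb⟩ : ∃ kb : X × X → ℂ, ∀ w, kb w = ∫ y, kf (w, y) ∂(κ (s * π w.1)) :=
    ⟨_, fun _ => rfl⟩
  have hkkb : ∀ᵐ a ∂E₂, kf a = kb a.1 := by
    filter_upwards [hs2 1 _ hkfB hkinv] with a ha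
    rw [ha, hkb]
  have hkbinv : ∀ᵐ w ∂V, kb (Prod.map (τ 1) (τ 1) w) = kb w := by
    rw [hE₂] at hkinv hkkb hR2
    exact fibre_integral_invariant hp2.measurable hR2 hkinv hkkb
  have hall : ∀ᵐ a ∂E₂, conj (ψ (a.1.1, a.2)) * ψ (a.1.2, a.2) = kb a.1 ∧
      ψ (a.1.1, a.2) * conj (ψ (a.1.1, a.2)) = ρ ∧ ψ (a.1.2, a.2) * conj (ψ (a.1.2, a.2)) = ρ := by
    filter_upwards [hkkb, hp13.quasiMeasurePreserving.ae hρ, hp23.quasiMeasurePreserving.ae hρ]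
      with a h1 h2 h3
    rw [hkf] at h1
    exact ⟨h1, h2, h3⟩
  have hfib : ∀ᵐ w ∂V, ∀ᵐ y ∂(κ (s * π w.1)), conj (ψ (w.1, y)) * ψ (w.2, y) = kb w ∧
      ψ (w.1, y) * conj (ψ (w.1, y)) = ρ ∧ ψ (w.2, y) * conj (ψ (w.2, y)) = ρ := by
    rw [hE₂] at hall
    exact ae_ae_of_ae_Ext hp2.measurable hall
  have hkbn : ∀ᵐ w ∂V, ‖kb w‖ = ‖ρ‖ := by
    filter_upwards [hfib] with w hw
    obtain ⟨y, h1, h2, h3⟩ := hw.exists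
    have e2 := congrArg norm h2
    have e3 := congrArg norm h3
    rw [norm_mul, Complex.norm_conj] at e2 e3
    rw [← h1, norm_mul, Complex.norm_conj]
    have : ‖ψ (w.1, y)‖ = ‖ψ (w.2, y)‖ := by
      rw [← abs_of_nonneg (norm_nonneg (ψ (w.1, y))), ← abs_of_nonneg (norm_nonneg (ψ (w.2, y))),
        ← sq_eq_sq_iff_abs_eq_abs, pow_two, pow_two, e2, e3]
    rw [← this, e2]
  obtain ⟨h₀, hh₀⟩ : ∃ h₀ : X → ℂ, ∀ x, h₀ x = ∫ y, g y * conj (ψ (x, y)) ∂(κ (s * π x)) :=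
    ⟨_, fun _ => rfl⟩
  have hgψ : Bd 1 fun a : X × X => g a.2 * conj (ψ a) := (hg.comp measurable_snd).mul hψ.conj
  have hh₀b : Bd 1 h₀ := by
    have h1 := (bd_fibre_integral (κ := κ) hπ hgψ).comp
      (measurable_const.prodMk measurable_id : Measurable fun x : X => (s, x))
    have : h₀ = _ := funext hh₀
    rw [this]; exact h1
  have hrel : ∀ᵐ w ∂V, ρ * h₀ w.1 = kb w * h₀ w.2 := by
    filter_upwards [hfib, hpi12] with w hw hπw
    rw [hh₀, hh₀, hπw, ← integral_const_mul, ← integral_const_mul]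
    refine integral_congr_ae ?_
    filter_upwards [hw] with y ⟨h1, h2, h3⟩
    change ρ * (g y * conj (ψ (w.1, y))) = kb w * (g y * conj (ψ (w.2, y)))
    rw [← h1, ← h3]
    ring
  have hintg : ∫ x, conj (g x) * h₀ x ∂μ ≠ 0 := by
    have hB : Bd 1 fun a : X × X => (conj (g a.1) * g a.2) * conj (ψ a) := hG.mul hψ.conj
    rw [hE₁, integral_Ext hπ s hB] at hGψ
    convert hGψ using 3 with x
    rw [hh₀, ← integral_const_mul]
    refine integral_congr_ae (ae_of_all _ fun y => ?_)
    change conj (g x) * (g y * conj (ψ (x, y))) = conj (g x) * g y * conj (ψ (x, y))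
    ring
  have hne : ¬ ∀ᵐ x ∂μ, h₀ x = 0 := by
    intro h0
    apply hintg
    rw [← integral_zero X ℂ (μ := μ)]
    refine integral_congr_ae ?_
    filter_upwards [h0] with x hx
    simp [hx]
  rw [hV] at hkbn hkbinv hrel
  obtain ⟨h, φ, hCL, hφ, hφh⟩ := hK.exists_cl_of_relation hh₀b hρ0 hkbn hkbinv hrel hne
  refine ⟨h, hCL, fun h0 => hintg ?_⟩
  have hB : Bd 1 fun x => g x * conj (h x) := hg.mul hCL.bd.conj
  have e : ∫ x, conj (g x) * h₀ x ∂μ = ∫ x, φ (π x) * conj (g x * conj (h x)) ∂μ := by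
    refine integral_congr_ae ?_
    filter_upwards [hφh] with x hx
    rw [hx, map_mul, Complex.conj_conj]
    ring
  rw [e, hK.integral_pi_mul hφ hB.conj, ← integral_zero Z ℂ (μ := m)]
  refine integral_congr_ae ?_
  filter_upwards [h0] with z hz
  rw [CE_conj, hz]
  simp

end InverseTheorem

section Evaluation

variable {X : Type*} [MeasurableSpace X] {μ : Measure X} [IsProbabilityMeasure μ]
  {Z : Type*} [CommGroup Z] [TopologicalSpace Z] [IsTopologicalGroup Z] [CompactSpace Z]
  [T2Space Z] [SecondCountableTopology Z] [MeasurableSpace Z] [BorelSpace Z]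
  {m : Measure Z} [IsProbabilityMeasure m] [m.IsMulLeftInvariant]
  {τ : ℤ → X → X} {q : ℕ} {π : X → Z} {α : Z} {κ : Kernel Z X} [IsMarkovKernel κ]

/-- Averaged over the times `n` with `α ^ (q n + r)` close to `1`, the sequence `b` is within `ε`
of the value `v`. -/
def Evals (m : Measure Z) (α : Z) (q : ℕ) (r : ℤ) (ε : ℝ) (b : ℕ → ℂ) (v : ℂ) : Prop :=
  ∀ᶠ s in (𝓝 (1 : Z)).smallSets, ∀ η : C(Z, ℂ), (∀ z ∉ s, η z = 0) →
    UB (fun n : ℕ => η (α ^ ((q : ℤ) * n + r)) * (b n - v)) (ε * ∫ z, ‖η z‖ ∂m)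

theorem Evals.add {r : ℤ} {ε ε' : ℝ} {b b' : ℕ → ℂ} {v v' : ℂ} (h : Evals m α q r ε b v)
    (h' : Evals m α q r ε' b' v') :
    Evals m α q r (ε + ε') (fun n => b n + b' n) (v + v') := by
  unfold Evals at *
  filter_upwards [h, h'] with s h1 h2 η hη
  convert (h1 η hη).add (h2 η hη) using 2 with n
  · ring
  · ring

theorem Evals.mono {r : ℤ} {ε ε' : ℝ} {b : ℕ → ℂ} {v : ℂ} (h : Evals m α q r ε b v)
    (hε : ε ≤ ε') : Evals m α q r ε' b v := by
  unfold Evals at *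
  filter_upwards [h] with s h1 η hη
  exact (h1 η hη).mono (mul_le_mul_of_nonneg_right hε (integral_nonneg fun _ => norm_nonneg _))

theorem Evals.of_ub {r : ℤ} {ε : ℝ} (hε : 0 ≤ ε) {b : ℕ → ℂ}
    (h : ∀ η : C(Z, ℂ), UB (fun n : ℕ => η (α ^ ((q : ℤ) * n + r)) * b n) 0) :
    Evals m α q r ε b 0 := by
  refine Eventually.of_forall fun s η _ => ?_
  simp only [sub_zero]
  exact (h η).mono (mul_nonneg hε (integral_nonneg fun _ => norm_nonneg _))

theorem Kron.evals_of_near (hK : Kron τ μ q π m α κ) {r : ℤ} {ε : ℝ} (hε : 0 ≤ ε) {b : ℕ → ℂ}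
    {v : ℂ} (h : ∀ᶠ a in 𝓝 (1 : Z), ∀ n : ℕ, α ^ ((q : ℤ) * n + r) = a → ‖b n - v‖ ≤ ε) :
    Evals m α q r ε b v := by
  unfold Evals
  rw [eventually_smallSets]
  refine ⟨_, h, fun t ht η hη => hK.ub_weight r η hε fun n => ?_⟩
  by_cases hs : α ^ ((q : ℤ) * n + r) ∈ t
  · rw [norm_mul, mul_comm]
    exact mul_le_mul_of_nonneg_right (ht hs n rfl) (norm_nonneg _)
  · rw [hη _ hs]; simp

theorem Evals.sum {ι : Type*} (s : Finset ι) {r : ℤ} {ε : ι → ℝ} {b : ι → ℕ → ℂ} {v : ι → ℂ}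
    (h : ∀ i ∈ s, Evals m α q r (ε i) (b i) (v i)) :
    Evals m α q r (∑ i ∈ s, ε i) (fun n => ∑ i ∈ s, b i n) (∑ i ∈ s, v i) := by
  classical
  induction s using Finset.induction_on with
  | empty =>
    simp only [Finset.sum_empty]
    exact Evals.of_ub le_rfl fun η => UB.of_norm_le fun n => by simp
  | insert i s hi ih =>
    simp only [Finset.sum_insert hi]
    exact (h i (Finset.mem_insert_self _ _)).add
      (ih fun j hj => h j (Finset.mem_insert_of_mem hj))

theorem Kron.syndetic (hK : Kron τ μ q π m α κ) {r : ℤ} {b : ℕ → ℝ} {v c ε : ℝ} (hε : 0 < ε)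
    (hv : c ≤ v) (h : Evals m α q r (ε / 4) (fun n => (b n : ℂ)) v) :
    Syndetic {n | b n > c - ε} := by
  unfold Evals at h
  rw [eventually_smallSets] at h
  obtain ⟨s, hs, h⟩ := h
  obtain ⟨U, hUs, hUo, hU1⟩ := mem_nhds_iff.1 hs
  obtain ⟨η₀, h0, h1, h01⟩ := exists_continuous_zero_one_of_isClosed hUo.isClosed_compl
    (isClosed_singleton (x := (1 : Z))) (by simpa using hU1)
  set η : C(Z, ℂ) := ⟨fun z => (η₀ z : ℂ), by fun_prop⟩ with hη
  have hpos : m.IsOpenPosMeasure :=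
    isOpenPosMeasure_of_mulLeftInvariant_of_compact Set.univ isCompact_univ (by simp)
  have hI : 0 < ∫ z, η₀ z ∂m := by
    refine η₀.continuous.integral_pos_of_hasCompactSupport_nonneg_nonzero
      (HasCompactSupport.of_compactSpace _) (fun z => (h01 z).1) (x := 1) ?_
    rw [h1 rfl]; exact one_ne_zero
  set I := ∫ z, η₀ z ∂m with hIdef
  have hn : ∫ z, ‖η z‖ ∂m = I := integral_congr_ae (ae_of_all _ fun z => by
    change ‖(η₀ z : ℂ)‖ = η₀ z
    rw [Complex.norm_real, Real.norm_of_nonneg (h01 z).1])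
  have hηI : ∫ z, η z ∂m = (I : ℂ) := integral_complex_ofReal
  obtain ⟨N₀, H0⟩ := h U hUs η (fun z hz => by
    change (η₀ z : ℂ) = 0
    rw [h0 hz]; simp) (ε * I / 8) (by positivity)
  obtain ⟨N₁, H1⟩ := equidistribution (m := m) hK.sep (fun ξ hξ => hK.char_ne hξ) (α ^ r) η
    (I / 4) (by positivity)
  refine ⟨max (max N₀ N₁) 1, by positivity, fun a => ?_⟩
  set N := max (max N₀ N₁) 1 with hN
  have hN0 : N₀ ≤ N := (le_max_left _ _).trans (le_max_left _ _)
  have hN1 : N₁ ≤ N := (le_max_right _ _).trans (le_max_left _ _)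
  have hNp : (0 : ℝ) < N := by
    have : 1 ≤ N := le_max_right _ _
    exact_mod_cast this
  by_contra hcon
  push Not at hcon
  have hbad : ∀ i ∈ Finset.range N, b (a + i) ≤ c - ε := fun i hi => by
    by_contra hb
    have := hcon (a + i) (not_le.1 hb) (Nat.le_add_right _ _)
    have := Finset.mem_range.1 hi
    omega
  obtain ⟨w, hw⟩ : ∃ w : ℕ → ℝ, ∀ i, w i = η₀ (α ^ ((q : ℤ) * (a + i : ℕ) + r)) := ⟨_, fun _ => rfl⟩
  have hw0 : ∀ i, 0 ≤ w i := fun i => by rw [hw]; exact (h01 _).1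
  have K0 := H0 N hN0 a
  have K1 := H1 N hN1 a
  have e0 : ∑ i ∈ Finset.range N, η (α ^ ((q : ℤ) * (a + i : ℕ) + r)) * ((b (a + i) : ℂ) - v) =
      ((∑ i ∈ Finset.range N, w i * (b (a + i) - v) : ℝ) : ℂ) := by
    push_cast
    refine Finset.sum_congr rfl fun i _ => ?_
    rw [hw]; push_cast; rfl
  have e1 : ∑ i ∈ Finset.range N, (η ((α ^ q) ^ (a + i) * α ^ r) - ∫ z, η z ∂m) =
      ((∑ i ∈ Finset.range N, w i - N * I : ℝ) : ℂ) := by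
    rw [Finset.sum_sub_distrib, hηI, Finset.sum_const, Finset.card_range, nsmul_eq_mul]
    push_cast
    congr 1
    refine Finset.sum_congr rfl fun i _ => ?_
    rw [hw, zpow_add, zpow_mul, zpow_natCast, zpow_natCast]
    rfl
  rw [e0, Complex.norm_real, Real.norm_eq_abs, hn] at K0
  rw [e1, Complex.norm_real, Real.norm_eq_abs] at K1
  have L0 := (abs_le.1 K0).1
  have L1 := (abs_le.1 K1).1
  have hle : ∑ i ∈ Finset.range N, w i * (b (a + i) - v) ≤ -ε * ∑ i ∈ Finset.range N, w i := by
    rw [Finset.mul_sum]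
    refine Finset.sum_le_sum fun i hi => ?_
    rw [mul_comm (-ε)]
    exact mul_le_mul_of_nonneg_left (by have := hbad i hi; linarith) (hw0 i)
  have hIN : 0 < ε * (I * N) := by positivity
  have := mul_le_mul_of_nonneg_left L1 hε.le
  nlinarith

theorem pow_integral_le_integral_pow {Y : Type*} [MeasurableSpace Y] {ν : Measure Y}
    [IsProbabilityMeasure ν] {e : Y → ℝ} (hm : Measurable e) (h0 : ∀ y, 0 ≤ e y) (h1 : ∀ y, e y ≤ 1)
    (n : ℕ) : (∫ y, e y ∂ν) ^ n ≤ ∫ y, e y ^ n ∂ν := by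
  refine (convexOn_pow n).map_integral_le (continuousOn_pow n) isClosed_Ici (ae_of_all _ h0) ?_ ?_
  · exact Integrable.of_bound hm.aestronglyMeasurable 1 (ae_of_all _ fun y => by
      rw [Real.norm_of_nonneg (h0 y)]; exact h1 y)
  · exact Integrable.of_bound (hm.pow_const n).aestronglyMeasurable 1 (ae_of_all _ fun y => by
      change ‖e y ^ n‖ ≤ 1
      rw [Real.norm_of_nonneg (pow_nonneg (h0 y) n)]; exact pow_le_one₀ (h0 y) (h1 y))

theorem bd_ofReal {f : X → ℝ} (hm : Measurable f) (h0 : ∀ x, 0 ≤ f x) (h1 : ∀ x, f x ≤ 1) :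
    Bd 1 fun x => (f x : ℂ) :=
  ⟨Complex.measurable_ofReal.comp hm, fun x => by
    rw [Complex.norm_real, Real.norm_of_nonneg (h0 x)]; exact h1 x⟩

theorem Kron.exists_CE_ofReal (hK : Kron τ μ q π m α κ) {f : X → ℝ} (hm : Measurable f)
    (h0 : ∀ x, 0 ≤ f x) (h1 : ∀ x, f x ≤ 1) :
    ∃ e : Z → ℝ, Measurable e ∧ (∀ z, 0 ≤ e z) ∧ (∀ z, e z ≤ 1) ∧
      (∀ z, CE κ (fun x => (f x : ℂ)) z = e z) ∧ ∫ z, e z ∂m = ∫ x, f x ∂μ := by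
  have hB := bd_ofReal hm h0 h1
  have hc : ∀ z, CE κ (fun x => (f x : ℂ)) z = ((∫ x, f x ∂(κ z) : ℝ) : ℂ) := fun z =>
    integral_complex_ofReal
  refine ⟨fun z => ∫ x, f x ∂(κ z), ?_, fun z => integral_nonneg h0, fun z => ?_, hc, ?_⟩
  · have := Complex.measurable_re.comp (hB.CE (κ := κ)).meas
    convert this using 2 with z
    rw [Function.comp, hc, Complex.ofReal_re]
  · have := (hB.CE (κ := κ)).bdd z
    rw [hc, Complex.norm_real] at this
    exact (le_abs_self _).trans this
  · have := hK.integral_CE hB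
    simp only [hc] at this
    rw [integral_complex_ofReal, integral_complex_ofReal] at this
    exact_mod_cast this

theorem CE_one (z : Z) : CE κ (fun _ => (1 : ℂ)) z = 1 := by simp [CE]

theorem Kron.lower_two (hK : Kron τ μ q π m α κ) (r : ℤ) {f : X → ℝ} (hm : Measurable f)
    (h0 : ∀ x, 0 ≤ f x) (h1 : ∀ x, f x ≤ 1) {ε : ℝ} (hε : 0 < ε) :
    ∃ v : ℝ, (∫ x, f x ∂μ) ^ 2 ≤ v ∧ Evals m α q r ε (fun n : ℕ =>
      corr3 τ μ (fun x => (f x : ℂ)) (fun x => (f x : ℂ)) (fun _ => 1) (q * n + r)) v := by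
  have hB := bd_ofReal hm h0 h1
  obtain ⟨e, he, he0, he1, hc, hi⟩ := hK.exists_CE_ofReal hm h0 h1
  refine ⟨∫ z, e z ^ 2 ∂m, by rw [← hi]; exact pow_integral_le_integral_pow he he0 he1 2, ?_⟩
  have h := hK.eval_corr3 r hB hB Bd.one hε
  have ev : ∫ z, CE κ (fun x => (f x : ℂ)) z * CE κ (fun x => (f x : ℂ)) z *
      CE κ (fun _ => (1 : ℂ)) z ∂m = ((∫ z, e z ^ 2 ∂m : ℝ) : ℂ) := by
    rw [← integral_complex_ofReal]
    refine integral_congr_ae (ae_of_all _ fun z => ?_)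
    simp only [hc, CE_one]
    push_cast; ring
  rw [ev] at h
  exact h

theorem Kron.lower_three (hK : Kron τ μ q π m α κ) (r : ℤ) {f : X → ℝ} (hm : Measurable f)
    (h0 : ∀ x, 0 ≤ f x) (h1 : ∀ x, f x ≤ 1) {ε : ℝ} (hε : 0 < ε) :
    ∃ v : ℝ, (∫ x, f x ∂μ) ^ 3 ≤ v ∧ Evals m α q r ε (fun n : ℕ =>
      corr3 τ μ (fun x => (f x : ℂ)) (fun x => (f x : ℂ)) (fun x => (f x : ℂ)) (q * n + r)) v := by
  have hB := bd_ofReal hm h0 h1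
  obtain ⟨e, he, he0, he1, hc, hi⟩ := hK.exists_CE_ofReal hm h0 h1
  refine ⟨∫ z, e z ^ 3 ∂m, by rw [← hi]; exact pow_integral_le_integral_pow he he0 he1 3, ?_⟩
  have h := hK.eval_corr3 r hB hB hB hε
  have ev : ∫ z, CE κ (fun x => (f x : ℂ)) z * CE κ (fun x => (f x : ℂ)) z *
      CE κ (fun x => (f x : ℂ)) z ∂m = ((∫ z, e z ^ 3 ∂m : ℝ) : ℂ) := by
    rw [← integral_complex_ofReal]
    refine integral_congr_ae (ae_of_all _ fun z => ?_)
    simp only [hc]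
    push_cast; ring
  rw [ev] at h
  exact h

end Evaluation

section Projection

variable {X : Type*} [MeasurableSpace X] {μ : Measure X} [IsProbabilityMeasure μ]

/-- Truncation to the unit interval. -/
def clamp (t : ℝ) : ℝ := max 0 (min 1 t)

theorem continuous_clamp : Continuous clamp := by unfold clamp; fun_prop

theorem clamp_nonneg (t : ℝ) : 0 ≤ clamp t := le_max_left _ _

theorem clamp_le_one (t : ℝ) : clamp t ≤ 1 := max_le zero_le_one (min_le_left _ _)

theorem abs_clamp_sub_le (s t : ℝ) : |clamp s - clamp t| ≤ |s - t| := by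
  unfold clamp
  rw [max_comm 0, max_comm 0, min_comm 1 s, min_comm 1 t]
  exact (abs_max_sub_max_le_abs _ _ _).trans (abs_inf_sub_inf_le_abs _ _ _)

theorem clamp_of_mem {t : ℝ} (h0 : 0 ≤ t) (h1 : t ≤ 1) : clamp t = t := by
  unfold clamp; rw [min_eq_right h1, max_eq_right h0]

theorem norm_sub_clamp_le {t : ℝ} (h0 : 0 ≤ t) (h1 : t ≤ 1) (z : ℂ) :
    ‖(t : ℂ) - (clamp z.re : ℝ)‖ ≤ ‖(t : ℂ) - z‖ := by
  rw [← Complex.ofReal_sub, Complex.norm_real, Real.norm_eq_abs]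
  conv_lhs => rw [← clamp_of_mem h0 h1]
  refine (abs_clamp_sub_le _ _).trans ?_
  simpa using Complex.abs_re_le_norm ((t : ℂ) - z)

/-- The classes in `L²` of the elements of an algebra of functions. -/
def lpClasses (μ : Measure X) (A : Submodule ℂ (X → ℂ)) : Submodule ℂ (Lp ℂ 2 μ) where
  carrier := {v | ∃ a ∈ A, v =ᵐ[μ] a}
  add_mem' := by
    rintro v w ⟨a, ha, hva⟩ ⟨b, hb, hwb⟩
    exact ⟨a + b, A.add_mem ha hb, (Lp.coeFn_add v w).trans (hva.add hwb)⟩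
  zero_mem' := ⟨0, A.zero_mem, Lp.coeFn_zero _ _ _⟩
  smul_mem' := by
    rintro c v ⟨a, ha, hva⟩
    exact ⟨c • a, A.smul_mem c ha, (Lp.coeFn_smul c v).trans (hva.const_smul c)⟩

theorem exists_clamp_near {A : Subalgebra ℂ (X → ℂ)} (hbd : ∀ a ∈ A, ∃ C, Bd C a)
    (hconj : ∀ a ∈ A, (fun x => conj (a x)) ∈ A) {a : X → ℂ} (ha : a ∈ A) {ε : ℝ} (hε : 0 < ε) :
    ∃ b ∈ A, ∀ x, ‖((clamp (a x).re : ℝ) : ℂ) - b x‖ ≤ ε := by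
  obtain ⟨C, hC⟩ := hbd a ha
  obtain ⟨p, hp⟩ := exists_polynomial_near_of_continuousOn (-C) C clamp
    continuous_clamp.continuousOn ε hε
  have hre : (fun x => (((a x).re : ℝ) : ℂ)) ∈ A := by
    have e : (fun x => (((a x).re : ℝ) : ℂ)) = (2⁻¹ : ℂ) • (a + fun x => conj (a x)) := by
      funext x
      simp only [Pi.smul_apply, Pi.add_apply, smul_eq_mul, Complex.add_conj]
      push_cast; ring
    rw [e]
    exact A.smul_mem (A.add_mem ha (hconj a ha)) _
  have hq : (fun x => ((p.eval (a x).re : ℝ) : ℂ)) ∈ A := by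
    have h := (Polynomial.aeval (⟨_, hre⟩ : A) (p.map (algebraMap ℝ ℂ))).2
    rw [← Subalgebra.aeval_coe] at h
    convert h using 1
    funext x
    have := Polynomial.map_aeval_eq_aeval_map (S := X → ℂ) (T := ℂ) (U := ℂ) (φ := RingHom.id ℂ)
      (ψ := Pi.evalRingHom (fun _ => ℂ) x) (by ext; rfl) (p.map (algebraMap ℝ ℂ))
      (fun x => (((a x).re : ℝ) : ℂ))
    rw [Pi.evalRingHom_apply] at this
    rw [this]
    simp only [Pi.evalRingHom_apply, Polynomial.map_id]
    rw [Polynomial.aeval_map_algebraMap]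
    exact (Polynomial.aeval_algebraMap_apply ℂ (a x).re p).symm ▸ rfl
  refine ⟨_, hq, fun x => ?_⟩
  rw [← Complex.ofReal_sub, Complex.norm_real, Real.norm_eq_abs, abs_sub_comm]
  have hx := (Complex.abs_re_le_norm (a x)).trans (hC.bdd x)
  exact (hp _ (abs_le.1 hx)).le

theorem exists_clamped_projection {A : Subalgebra ℂ (X → ℂ)} (hbd : ∀ a ∈ A, ∃ C, Bd C a)
    (hconj : ∀ a ∈ A, (fun x => conj (a x)) ∈ A) {f : X → ℝ} (hm : Measurable f)
    (h0 : ∀ x, 0 ≤ f x) (h1 : ∀ x, f x ≤ 1) :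
    ∃ f' : X → ℝ, Measurable f' ∧ (∀ x, 0 ≤ f' x) ∧ (∀ x, f' x ≤ 1) ∧
      (∀ a ∈ A, ∫ x, ((f x : ℂ) - f' x) * conj (a x) ∂μ = 0) ∧
      ∀ ε > 0, ∃ a ∈ A, ∫ x, ‖(f' x : ℂ) - a x‖ ^ 2 ∂μ ≤ ε := by
  have hB := bd_ofReal hm h0 h1
  set F := (hB.memLp (μ := μ) 2).toLp _ with hF
  set M := (lpClasses μ A.toSubmodule).topologicalClosure with hM
  have hMc : IsClosed (M : Set (Lp ℂ 2 μ)) := Submodule.isClosed_topologicalClosure _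
  have hMcomp : CompleteSpace M := hMc.completeSpace_coe
  set v : Lp ℂ 2 μ := M.starProjection F with hv
  have hvM : v ∈ M := Submodule.starProjection_apply_mem _ _
  have horth : ∀ w ∈ M, inner ℂ w (F - v) = 0 := fun w hw =>
    (Submodule.sub_starProjection_mem_orthogonal (K := M) F) w hw
  have hvm : Measurable (v : X → ℂ) := (Lp.stronglyMeasurable v).measurable
  set f' : X → ℝ := fun x => clamp (v x).re with hf'
  have hf'm : Measurable f' := continuous_clamp.measurable.comp (Complex.measurable_re.comp hvm)
  have hB' := bd_ofReal hf'm (fun x => clamp_nonneg _) (fun x => clamp_le_one _)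
  set W := (hB'.memLp (μ := μ) 2).toLp _ with hW
  have hWF : W =ᵐ[μ] fun x => (f' x : ℂ) := MemLp.coeFn_toLp _
  have hFF : F =ᵐ[μ] fun x => (f x : ℂ) := MemLp.coeFn_toLp _
  have hnear : ∀ ε > 0, ∃ a ∈ A, ∃ u : Lp ℂ 2 μ, u =ᵐ[μ] a ∧ ‖W - u‖ ≤ ε := by
    intro ε hε
    obtain ⟨u, hu, hdist⟩ := Metric.mem_closure_iff.1 hvM (ε / 2) (by positivity)
    obtain ⟨a, ha, hua⟩ := hu
    obtain ⟨b, hb, hab⟩ := exists_clamp_near hbd hconj ha (show 0 < ε / 2 by positivity)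
    obtain ⟨C, hC⟩ := hbd a ha
    obtain ⟨C', hC'⟩ := hbd b hb
    have hBa : Bd 1 fun x => ((clamp (a x).re : ℝ) : ℂ) := bd_ofReal
      (continuous_clamp.measurable.comp (Complex.measurable_re.comp hC.meas))
      (fun x => clamp_nonneg _) (fun x => clamp_le_one _)
    refine ⟨b, hb, (hC'.memLp (μ := μ) 2).toLp _, MemLp.coeFn_toLp _, ?_⟩
    set ua := (hBa.memLp (μ := μ) 2).toLp _ with hua'
    have i1 : ‖W - ua‖ ≤ ‖v - u‖ := by
      refine Lp.norm_le_norm_of_ae_le ?_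
      filter_upwards [Lp.coeFn_sub W ua, Lp.coeFn_sub v u, hWF, hua,
        MemLp.coeFn_toLp (hBa.memLp (μ := μ) 2)] with x e1 e2 e3 e4 e5
      rw [e1, e2, Pi.sub_apply, Pi.sub_apply, e3, e4, e5, ← Complex.ofReal_sub, Complex.norm_real,
        Real.norm_eq_abs]
      refine (abs_clamp_sub_le _ _).trans ?_
      simpa using Complex.abs_re_le_norm (v x - a x)
    have i2 : ‖ua - (hC'.memLp (μ := μ) 2).toLp _‖ ≤ ε / 2 := by
      have := Lp.norm_le_of_ae_bound (f := ua - (hC'.memLp (μ := μ) 2).toLp _)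
        (C := ε / 2) (by positivity) (by
        filter_upwards [Lp.coeFn_sub ua ((hC'.memLp (μ := μ) 2).toLp _),
          MemLp.coeFn_toLp (hBa.memLp (μ := μ) 2),
          MemLp.coeFn_toLp (hC'.memLp (μ := μ) 2)] with x e1 e2 e3
        rw [e1, Pi.sub_apply, e2, e3]
        exact hab x)
      have e : measureUnivNNReal μ = 1 := by simp [measureUnivNNReal]
      simpa [e] using this
    rw [dist_eq_norm] at hdist
    calc ‖W - (hC'.memLp (μ := μ) 2).toLp _‖
        ≤ ‖W - ua‖ + ‖ua - (hC'.memLp (μ := μ) 2).toLp _‖ := norm_sub_le_norm_sub_add_norm_sub _ _ _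
      _ ≤ ε := by linarith
  have hWM : W ∈ M := by
    refine Metric.mem_closure_iff.2 fun ε hε => ?_
    obtain ⟨a, ha, u, hu, hle⟩ := hnear (ε / 2) (by positivity)
    exact ⟨u, ⟨a, ha, hu⟩, by rw [dist_eq_norm]; linarith⟩
  have hle : ‖F - W‖ ≤ ‖F - v‖ := by
    refine Lp.norm_le_norm_of_ae_le ?_
    filter_upwards [Lp.coeFn_sub F W, Lp.coeFn_sub F v, hWF, hFF] with x e1 e2 e3 e4
    rw [e1, e2, Pi.sub_apply, Pi.sub_apply, e3, e4]
    exact norm_sub_clamp_le (h0 x) (h1 x) _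
  have hvW : v = W := by
    have hz : inner ℂ (F - v) (v - W) = 0 := by
      rw [← inner_conj_symm, horth _ (M.sub_mem hvM hWM), map_zero]
    have hp := norm_add_sq_eq_norm_sq_add_norm_sq_of_inner_eq_zero _ _ hz
    rw [sub_add_sub_cancel] at hp
    have h3 := mul_self_le_mul_self (norm_nonneg _) hle
    have h4 : ‖v - W‖ = 0 := by nlinarith [norm_nonneg (v - W)]
    exact sub_eq_zero.1 (norm_eq_zero.1 h4)
  refine ⟨f', hf'm, fun x => clamp_nonneg _, fun x => clamp_le_one _, fun a ha => ?_,
    fun ε hε => ?_⟩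
  · obtain ⟨C, hC⟩ := hbd a ha
    have h := horth _ (Submodule.le_topologicalClosure _
      (show (hC.memLp (μ := μ) 2).toLp _ ∈ lpClasses μ A.toSubmodule from
        ⟨a, ha, MemLp.coeFn_toLp _⟩))
    rw [hvW, hF, hW, ← MemLp.toLp_sub, inner_toLp] at h
    rw [← h]
    refine integral_congr_ae (ae_of_all _ fun x => ?_)
    simp only [Pi.sub_apply]; ring
  · obtain ⟨a, ha, u, hu, hle⟩ := hnear (√ε) (Real.sqrt_pos.2 hε)
    refine ⟨a, ha, ?_⟩
    have := pow_le_pow_left₀ (norm_nonneg _) hle 2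
    rw [Real.sq_sqrt hε.le, norm_lp_sq] at this
    refine (integral_congr_ae ?_).trans_le this
    filter_upwards [Lp.coeFn_sub W u, hWF, hu] with x e1 e2 e3
    rw [e1, Pi.sub_apply, e2, e3]

end Projection

section CocycleAlgebra

variable {X : Type*} [MeasurableSpace X] {μ : Measure X} [IsProbabilityMeasure μ]
  {Z : Type*} [CommGroup Z] [TopologicalSpace Z] [IsTopologicalGroup Z] [CompactSpace Z]
  [T2Space Z] [SecondCountableTopology Z] [MeasurableSpace Z] [BorelSpace Z]
  {m : Measure Z} [IsProbabilityMeasure m] [m.IsMulLeftInvariant]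
  {τ : ℤ → X → X} {q : ℕ} {π : X → Z} {α : Z} {κ : Kernel Z X} [IsMarkovKernel κ]

theorem CL.one : CL τ μ π fun _ => 1 :=
  ⟨measurable_const, fun _ => norm_one, fun _ => 1, measurable_const, fun _ => norm_one,
    ae_of_all _ fun _ => (one_mul 1).symm⟩

theorem CL.mul {h h' : X → ℂ} (hh : CL τ μ π h) (hh' : CL τ μ π h') :
    CL τ μ π fun x => h x * h' x := by
  obtain ⟨hm, h1, c, hcm, hc1, hc⟩ := hh
  obtain ⟨hm', h1', c', hcm', hc1', hc'⟩ := hh'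
  refine ⟨hm.mul hm', fun x => by rw [norm_mul, h1, h1', one_mul], fun z => c z * c' z,
    hcm.mul hcm', fun z => by rw [norm_mul, hc1, hc1', one_mul], ?_⟩
  filter_upwards [hc, hc'] with x e e'
  rw [e, e']; ring

theorem CL.conj {h : X → ℂ} (hh : CL τ μ π h) : CL τ μ π fun x => conj (h x) := by
  obtain ⟨hm, h1, c, hcm, hc1, hc⟩ := hh
  refine ⟨Complex.continuous_conj.measurable.comp hm, fun x => by rw [RCLike.norm_conj, h1],
    fun z => (starRingEnd ℂ) (c z), Complex.continuous_conj.measurable.comp hcm,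
    fun z => by rw [RCLike.norm_conj, hc1], ?_⟩
  filter_upwards [hc] with x e
  rw [e, map_mul]

theorem CL.mul_conj {h : X → ℂ} (hh : CL τ μ π h) (x : X) : h x * (starRingEnd ℂ) (h x) = 1 := by
  rw [conj_eq_inv (hh.2.1 x), mul_inv_cancel₀ (ne_zero_of_norm_one (hh.2.1 x))]

/-- Products of a function of the rotation factor with a cocycle function. -/
def clGen (τ : ℤ → X → X) (μ : Measure X) [IsProbabilityMeasure μ] (π : X → Z) :
    Submonoid (X → ℂ) where
  carrier := {a | ∃ (φ : Z → ℂ) (h : X → ℂ), Bd 1 φ ∧ CL τ μ π h ∧ a = fun x => φ (π x) * h x}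
  mul_mem' := by
    rintro _ _ ⟨φ, h, hφ, hh, rfl⟩ ⟨φ', h', hφ', hh', rfl⟩
    refine ⟨_, _, hφ.mul hφ', hh.mul hh', ?_⟩
    funext x
    simp only [Pi.mul_apply]; ring
  one_mem' := ⟨_, _, Bd.one, CL.one, by funext x; simp⟩

/-- The algebra generated by the cocycle functions over the rotation factor. -/
def clAlg (τ : ℤ → X → X) (μ : Measure X) [IsProbabilityMeasure μ] (π : X → Z) :
    Subalgebra ℂ (X → ℂ) :=
  Algebra.adjoin ℂ (clGen τ μ π : Set (X → ℂ))

theorem clAlg_induction {P : (X → ℂ) → Prop}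
    (gen : ∀ φ h, Bd 1 φ → CL τ μ π h → P fun x => φ (π x) * h x)
    (zero : P fun _ => 0) (add : ∀ a b, P a → P b → P fun x => a x + b x)
    (smul : ∀ (c : ℂ) a, P a → P fun x => c * a x) {a : X → ℂ} (ha : a ∈ clAlg τ μ π) : P a := by
  have h : a ∈ Submodule.span ℂ (clGen τ μ π : Set (X → ℂ)) := by
    rw [← Submonoid.closure_eq (clGen τ μ π), ← Algebra.adjoin_eq_span]
    exact ha
  clear ha
  induction h using Submodule.span_induction with
  | mem x hx =>
    obtain ⟨φ, h, hφ, hh, rfl⟩ := hx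
    exact gen φ h hφ hh
  | zero => exact zero
  | add x y _ _ hx hy => exact add x y hx hy
  | smul c x _ hx => exact smul c x hx

theorem mem_clAlg {φ : Z → ℂ} {h : X → ℂ} (hφ : Bd 1 φ) (hh : CL τ μ π h) :
    (fun x => φ (π x) * h x) ∈ clAlg τ μ π :=
  Algebra.subset_adjoin ⟨φ, h, hφ, hh, rfl⟩

theorem clAlg_bd (hπ : Measurable π) {a : X → ℂ} (ha : a ∈ clAlg τ μ π) :
    ∃ C, Bd C a := by
  refine clAlg_induction (P := fun a => ∃ C, Bd C a) (fun φ h hφ hh => ⟨1, (hφ.comp hπ).mul hh.bd⟩)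
    ⟨1, measurable_const, fun _ => by simp⟩ ?_ ?_ ha
  · rintro a b ⟨C, hC⟩ ⟨C', hC'⟩
    exact ⟨_, hC.add hC'⟩
  · rintro c a ⟨C, hC⟩
    exact ⟨_, hC.const_mul c⟩

theorem clAlg_conj {a : X → ℂ} (ha : a ∈ clAlg τ μ π) :
    (fun x => conj (a x)) ∈ clAlg τ μ π := by
  refine clAlg_induction (P := fun a => (fun x => conj (a x)) ∈ clAlg τ μ π)
    (fun φ h hφ hh => ?_) ?_ ?_ ?_ ha
  · simp only [map_mul]
    exact mem_clAlg hφ.conj hh.conj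
  · simp only [map_zero]
    exact (clAlg τ μ π).zero_mem
  · intro a b ha hb
    simp only [map_add]
    exact (clAlg τ μ π).add_mem ha hb
  · intro c a ha
    simp only [map_mul]
    exact (clAlg τ μ π).smul_mem ha (conj c)

theorem CE_sub {C C' : ℝ} {F G : X → ℂ} (hF : Bd C F) (hG : Bd C' G) (z : Z) :
    CE κ (fun x => F x - G x) z = CE κ F z - CE κ G z :=
  integral_sub hF.integrable hG.integrable

theorem CE_finset_sum {ι : Type*} (s : Finset ι) {C : ι → ℝ} {F : ι → X → ℂ}
    (h : ∀ i ∈ s, Bd (C i) (F i)) (z : Z) :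
    CE κ (fun x => ∑ i ∈ s, F i x) z = ∑ i ∈ s, CE κ (F i) z :=
  integral_finsetSum _ fun i hi => (h i hi).integrable

/-- A cocycle function not orthogonal to the rotation factor is measurable with respect to it. -/
theorem Kron.exists_factor (hK : Kron τ μ q π m α κ) [MeasurableSpace.CountablyGenerated X]
    {u : X → ℂ} (hu : CL τ μ π u) (hne : ¬ ∀ᵐ z ∂m, CE κ u z = 0) :
    ∃ φ : Z → ℂ, Bd 1 φ ∧ ∀ᵐ x ∂μ, u x = φ (π x) := by
  have hub := hu.bd
  obtain ⟨hm, h1, d, hdm, hd1, hd⟩ := hu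
  have hT := hK.toZAct.meas 1
  have heB : Bd 1 (CE κ u) := hub.CE
  have heα : ∀ᵐ z ∂m, CE κ u (α * z) = d z * CE κ u z := by
    filter_upwards [hK.ae_map_kernel, hK.ae_disint hd, hK.ae_fiber] with z e1 e2 e3
    rw [CE, ← e1, integral_map hT.aemeasurable hm.aestronglyMeasurable, CE, ← integral_const_mul]
    refine integral_congr_ae ?_
    filter_upwards [e2, e3] with x h2 h3
    rw [h2, h3]
  obtain ⟨G, hG⟩ : ∃ G : X → ℂ, ∀ x, G x = u x * conj (CE κ u (π x)) := ⟨_, fun _ => rfl⟩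
  have hGe : G = fun x => u x * conj (CE κ u (π x)) := funext hG
  have hGm : Measurable G := by
    rw [hGe]
    exact (hub.mul (heB.comp hK.pi.measurable).conj).meas
  obtain ⟨c, hc⟩ := hK.exists_ae_eq_const hGm (by
    filter_upwards [hd, hK.rot, hK.pi.quasiMeasurePreserving.ae heα] with x e1 e2 e3
    rw [hG, hG, e2, e3, e1, map_mul]
    have : d (π x) * conj (d (π x)) = 1 := by
      rw [conj_eq_inv (hd1 _), mul_inv_cancel₀ (ne_zero_of_norm_one (hd1 _))]
    linear_combination (u x * conj (CE κ u (π x))) * this)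
  have hn : ∀ᵐ x ∂μ, ‖CE κ u (π x)‖ = ‖c‖ := by
    filter_upwards [hc] with x hx
    rw [← hx, hG, norm_mul, h1, one_mul, RCLike.norm_conj]
  have hc0 : c ≠ 0 := by
    rintro rfl
    refine hne ?_
    rw [← hK.pi.map_eq, ae_map_iff hK.pi.measurable.aemeasurable
      (measurableSet_eq_fun heB.meas measurable_const)]
    filter_upwards [hn] with x hx
    simpa using hx
  refine ⟨fun z => phase c * phase (CE κ u z), ⟨measurable_const.mul
    (measurable_phase.comp heB.meas), fun z => by rw [norm_mul, norm_phase, norm_phase, one_mul]⟩,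
    ?_⟩
  filter_upwards [hc, hn] with x e1 e2
  rw [hG] at e1
  have h3 := norm_mul_phase (CE κ u (π x))
  have h4 := norm_mul_phase c
  have hc' : (‖c‖ : ℂ) ≠ 0 := Complex.ofReal_ne_zero.2 (norm_ne_zero_iff.2 hc0)
  have h5 : phase (CE κ u (π x)) * conj (phase (CE κ u (π x))) = 1 := by
    rw [conj_eq_inv (norm_phase _), mul_inv_cancel₀ (ne_zero_of_norm_one (norm_phase _))]
  rw [e2] at h3
  rw [← h3, map_mul, Complex.conj_ofReal, ← h4] at e1
  have h6 : (‖(‖c‖ : ℂ) * phase c‖ : ℂ) = ‖c‖ := by rw [h4]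
  have h7 : u x * conj (phase (CE κ u (π x))) = phase c := by
    refine mul_left_cancel₀ hc' ?_
    rw [h6] at e1
    linear_combination e1
  linear_combination phase (CE κ u (π x)) * h7 - u x * h5

/-- A finite family of pairwise orthogonal cocycle functions, including the constant. -/
structure OrthCL (τ : ℤ → X → X) (μ : Measure X) (π : X → Z) (m : Measure Z) (κ : Kernel Z X)
    (I : Finset (X → ℂ)) : Prop where
  one_mem : (fun _ => (1 : ℂ)) ∈ I
  cl : ∀ h ∈ I, CL τ μ π h
  orth : ∀ h ∈ I, ∀ h' ∈ I, h ≠ h' → ∀ᵐ z ∂m, CE κ (fun x => h x * conj (h' x)) z = 0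

/-- The function `h` is a multiple over the rotation factor of a member of `I`. -/
def Absorbs (μ : Measure X) (π : X → Z) (I : Finset (X → ℂ)) (h : X → ℂ) : Prop :=
  ∃ i ∈ I, ∃ φ : Z → ℂ, Bd 1 φ ∧ ∀ᵐ x ∂μ, h x = φ (π x) * i x

theorem Kron.exists_orthCL (hK : Kron τ μ q π m α κ) [MeasurableSpace.CountablyGenerated X]
    (H : Finset (X → ℂ)) (hH : ∀ h ∈ H, CL τ μ π h) :
    ∃ I, OrthCL τ μ π m κ I ∧ ∀ h ∈ H, Absorbs μ π I h := by
  classical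
  induction H using Finset.induction_on with
  | empty =>
    refine ⟨{fun _ => 1}, ⟨Finset.mem_singleton_self _, fun h hh => ?_, fun h hh h' hh' hne => ?_⟩,
      fun h hh => absurd hh (Finset.notMem_empty h)⟩
    · rw [Finset.mem_singleton.1 hh]; exact CL.one
    · exact absurd ((Finset.mem_singleton.1 hh).trans (Finset.mem_singleton.1 hh').symm) hne
  | insert h H _ ih =>
    obtain ⟨I, hI, hab⟩ := ih fun h' hh' => hH h' (Finset.mem_insert_of_mem hh')
    have hh := hH h (Finset.mem_insert_self _ _)
    by_cases hex : ∃ i ∈ I, ¬ ∀ᵐ z ∂m, CE κ (fun x => h x * conj (i x)) z = 0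
    · obtain ⟨i, hi, hne⟩ := hex
      obtain ⟨φ, hφ, he⟩ := hK.exists_factor (hh.mul (hI.cl i hi).conj) hne
      refine ⟨I, hI, fun h' hh' => ?_⟩
      rcases Finset.mem_insert.1 hh' with rfl | hh'
      · refine ⟨i, hi, φ, hφ, ?_⟩
        filter_upwards [he] with x hx
        rw [← hx]
        linear_combination -h' x * (hI.cl i hi).mul_conj x
      · exact hab h' hh'
    · push Not at hex
      have hconj : ∀ i ∈ I, ∀ᵐ z ∂m, CE κ (fun x => i x * conj (h x)) z = 0 := fun i hi => by
        filter_upwards [hex i hi] with z hz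
        have := CE_conj (κ := κ) (fun x => h x * conj (i x)) z
        rw [hz, map_zero] at this
        rw [← this]
        congr 1; funext x
        rw [map_mul, Complex.conj_conj, mul_comm]
      refine ⟨insert h I, ⟨Finset.mem_insert_of_mem hI.one_mem, fun h' hh' => ?_,
        fun a ha b hb hab => ?_⟩, fun h' hh' => ?_⟩
      · rcases Finset.mem_insert.1 hh' with rfl | hh'
        · exact hh
        · exact hI.cl h' hh'
      · rcases Finset.mem_insert.1 ha with rfl | ha' <;>
          rcases Finset.mem_insert.1 hb with rfl | hb'
        · exact absurd rfl hab
        · exact hex b hb'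
        · exact hconj a ha'
        · exact hI.orth a ha' b hb' hab
      · rcases Finset.mem_insert.1 hh' with rfl | hh'
        · exact ⟨h', Finset.mem_insert_self _ _, fun _ => 1, Bd.one,
            ae_of_all _ fun x => (one_mul _).symm⟩
        · obtain ⟨i, hi, φ, hφ, he⟩ := hab h' hh'
          exact ⟨i, Finset.mem_insert_of_mem hi, φ, hφ, he⟩

/-- Relative orthogonal projection onto the span of `I` over the rotation factor. -/
noncomputable def relProj (κ : Kernel Z X) (π : X → Z) (I : Finset (X → ℂ)) (f : X → ℂ) (x : X) :
    ℂ :=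
  ∑ h ∈ I, CE κ (fun y => f y * conj (h y)) (π x) * h x

theorem OrthCL.bd_term {I : Finset (X → ℂ)} (hI : OrthCL τ μ π m κ I) {f : X → ℂ} (hf : Bd 1 f)
    {h : X → ℂ} (hh : h ∈ I) : Bd 1 (CE κ fun y => f y * conj (h y)) :=
  (hf.mul (hI.cl h hh).bd.conj).CE

theorem OrthCL.relProj_mem {I : Finset (X → ℂ)} (hI : OrthCL τ μ π m κ I)
    {f : X → ℂ} (hf : Bd 1 f) :
    relProj κ π I f ∈ clAlg τ μ π := by
  have e : relProj κ π I f = ∑ h ∈ I, fun x => CE κ (fun y => f y * conj (h y)) (π x) * h x := by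
    funext x; rw [Finset.sum_apply]; rfl
  rw [e]
  exact Subalgebra.sum_mem _ fun h hh => mem_clAlg (hI.bd_term hf hh) (hI.cl h hh)

theorem Kron.CE_relProj (hK : Kron τ μ q π m α κ) {I : Finset (X → ℂ)}
    (hI : OrthCL τ μ π m κ I) {f : X → ℂ} (hf : Bd 1 f) {i : X → ℂ} (hi : i ∈ I) :
    ∀ᵐ z ∂m, CE κ (fun x => relProj κ π I f x * conj (i x)) z =
      CE κ (fun x => f x * conj (i x)) z := by
  have hb : ∀ h ∈ I, Bd 1 (fun x => CE κ (fun y => f y * conj (h y)) (π x) *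
      (h x * conj (i x))) := fun h hh =>
    ((hI.bd_term hf hh).comp hK.pi.measurable).mul ((hI.cl h hh).bd.mul (hI.cl i hi).bd.conj)
  have h1 : ∀ᵐ z ∂m, ∀ h ∈ I, CE κ (fun x => CE κ (fun y => f y * conj (h y)) (π x) *
      (h x * conj (i x))) z =
      CE κ (fun y => f y * conj (h y)) z * CE κ (fun x => h x * conj (i x)) z :=
    (ae_ball_iff I.countable_toSet).2 fun h _ => hK.CE_pi_mul _ _
  have h2 : ∀ᵐ z ∂m, ∀ h ∈ I, h ≠ i → CE κ (fun x => h x * conj (i x)) z = 0 :=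
    (ae_ball_iff I.countable_toSet).2 fun h hh => by
      by_cases he : h = i
      · exact ae_of_all _ fun z hne => absurd he hne
      · filter_upwards [hI.orth h hh i hi he] with z hz _ using hz
  filter_upwards [h1, h2] with z e1 e2
  have e : (fun x => relProj κ π I f x * conj (i x)) = fun x => ∑ h ∈ I,
      CE κ (fun y => f y * conj (h y)) (π x) * (h x * conj (i x)) := by
    funext x
    rw [relProj, Finset.sum_mul]
    exact Finset.sum_congr rfl fun h _ => by ring
  rw [e, CE_finset_sum I hb z, Finset.sum_congr rfl e1, Finset.sum_eq_single i]
  · simp only [(hI.cl i hi).mul_conj, CE_one, mul_one]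
  · intro h hh hne
    rw [e2 h hh hne, mul_zero]
  · exact fun h => absurd hi h

end CocycleAlgebra

section FourTerms

variable {X : Type*} [MeasurableSpace X] {μ : Measure X} [IsProbabilityMeasure μ]
  {Z : Type*} [CommGroup Z] [TopologicalSpace Z] [IsTopologicalGroup Z] [CompactSpace Z]
  [T2Space Z] [SecondCountableTopology Z] [MeasurableSpace Z] [BorelSpace Z]
  {m : Measure Z} [IsProbabilityMeasure m] [m.IsMulLeftInvariant]
  {τ : ℤ → X → X} {q : ℕ} {π : X → Z} {α : Z} {κ : Kernel Z X} [IsMarkovKernel κ]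

theorem Kron.exists_approx (hK : Kron τ μ q π m α κ) [MeasurableSpace.CountablyGenerated X]
    {f : X → ℝ} (hm : Measurable f) (h0 : ∀ x, 0 ≤ f x) (h1 : ∀ x, f x ≤ 1) :
    ∃ f' : X → ℝ, Measurable f' ∧ (∀ x, 0 ≤ f' x) ∧ (∀ x, f' x ≤ 1) ∧
      Bd 1 (fun x => (f x : ℂ) - f' x) ∧ Unif τ m κ (fun x => (f x : ℂ) - f' x) ∧
      ∀ δ > 0, ∃ I, OrthCL τ μ π m κ I ∧
        ∫ x, ‖(f' x : ℂ) - relProj κ π I (fun x => (f x : ℂ)) x‖ ^ 2 ∂μ ≤ δ := by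
  classical
  have hπ := hK.pi.measurable
  obtain ⟨f', hm', h0', h1', horth, hnear⟩ := exists_clamped_projection (μ := μ)
    (A := clAlg τ μ π) (fun a ha => clAlg_bd hπ ha) (fun a ha => clAlg_conj ha) hm h0 h1
  have hB := bd_ofReal hm h0 h1
  have hB' := bd_ofReal hm' h0' h1'
  have hd : Bd 1 (fun x => (f x : ℂ) - f' x) := ⟨hB.meas.sub hB'.meas, fun x => by
    rw [← Complex.ofReal_sub, Complex.norm_real, Real.norm_eq_abs, abs_le]
    constructor <;> linarith [h0 x, h1 x, h0' x, h1' x]⟩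
  have hCE : ∀ h, CL τ μ π h → ∀ᵐ z ∂m, CE κ (fun x => ((f x : ℂ) - f' x) * conj (h x)) z = 0 := by
    intro h hh
    have hG : Bd 1 (fun x => ((f x : ℂ) - f' x) * conj (h x)) := hd.mul hh.bd.conj
    have hE : Bd 1 (CE κ (fun x => ((f x : ℂ) - f' x) * conj (h x))) := hG.CE
    set E := CE κ (fun x => ((f x : ℂ) - f' x) * conj (h x)) with hEdef
    have e1 := horth _ (mem_clAlg hE hh)
    have e2 := hK.integral_pi_mul hE.conj hG
    have e3 : ∫ z, ((‖E z‖ ^ 2 : ℝ) : ℂ) ∂m = 0 := by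
      rw [← e1]
      refine Eq.trans ?_ (e2.symm.trans ?_)
      · refine integral_congr_ae (ae_of_all _ fun z => ?_)
        change _ = conj (E z) * E z
        rw [mul_comm, Complex.mul_conj, Complex.normSq_eq_norm_sq]
      · refine integral_congr_ae (ae_of_all _ fun x => ?_)
        simp only [map_mul]; ring
    rw [integral_complex_ofReal, Complex.ofReal_eq_zero,
      integral_eq_zero_iff_of_nonneg (fun z => by positivity) hE.integrable_norm_sq] at e3
    filter_upwards [e3] with z hz
    simpa using hz
  refine ⟨f', hm', h0', h1', hd, ?_, fun δ hδ => ?_⟩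
  · by_contra hU
    obtain ⟨h, hh, hne⟩ := hK.exists_cl hd hU
    exact hne (hCE h hh)
  · obtain ⟨a, ha, hle⟩ := hnear δ hδ
    have hrb : ∀ I, OrthCL τ μ π m κ I → ∃ C, Bd C (fun x => (f' x : ℂ) -
        relProj κ π I (fun x => (f x : ℂ)) x) := fun I hI => by
      obtain ⟨C, hC⟩ := clAlg_bd hπ (hI.relProj_mem hB)
      exact ⟨_, hB'.sub hC⟩
    have hbase : ∀ I, OrthCL τ μ π m κ I → ∀ i ∈ I, ∀ φ : Z → ℂ, Bd 1 φ →
        ∫ x, ((f' x : ℂ) - relProj κ π I (fun x => (f x : ℂ)) x) * conj (φ (π x) * i x) ∂μ = 0 := by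
      intro I hI i hi φ hφ
      obtain ⟨C, hC⟩ := hrb I hI
      have hz : ∀ᵐ z ∂m, CE κ (fun x => ((f' x : ℂ) - relProj κ π I (fun x => (f x : ℂ)) x) *
          conj (i x)) z = 0 := by
        filter_upwards [hCE i (hI.cl i hi), hK.CE_relProj hI hB hi] with z e1 e2
        obtain ⟨C', hC'⟩ := clAlg_bd hπ (hI.relProj_mem hB)
        have hib := (hI.cl i hi).bd.conj
        have e3 := CE_sub (κ := κ) (hB'.gmul hib) (hC'.gmul hib) z
        have e4 := CE_sub (κ := κ) (hB.gmul hib) (hB'.gmul hib) z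
        simp only [← sub_mul] at e3 e4
        rw [e3, e2]
        rw [e1] at e4
        linear_combination e4
      have e := hK.integral_pi_mul hφ.conj (hC.gmul (hI.cl i hi).bd.conj)
      refine Eq.trans (integral_congr_ae (ae_of_all _ fun x => ?_)) (e.trans ?_)
      · simp only [map_mul]; ring
      · rw [integral_congr_ae (g := fun _ => (0 : ℂ)), integral_zero]
        filter_upwards [hz] with z hz
        rw [hz, mul_zero]
    have hH : (∃ C, Bd C a) ∧ ∃ H : Finset (X → ℂ), (∀ h ∈ H, CL τ μ π h) ∧
        ∀ I, OrthCL τ μ π m κ I → (∀ h ∈ H, Absorbs μ π I h) →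
        ∫ x, ((f' x : ℂ) - relProj κ π I (fun x => (f x : ℂ)) x) * conj (a x) ∂μ = 0 := by
      refine clAlg_induction (P := fun a => (∃ C, Bd C a) ∧
        ∃ H : Finset (X → ℂ), (∀ h ∈ H, CL τ μ π h) ∧
        ∀ I, OrthCL τ μ π m κ I → (∀ h ∈ H, Absorbs μ π I h) →
        ∫ x, ((f' x : ℂ) - relProj κ π I (fun x => (f x : ℂ)) x) * conj (a x) ∂μ = 0) ?_ ?_ ?_ ?_ ha
      · intro φ h hφ hh
        refine ⟨⟨1, (hφ.comp hπ).mul hh.bd⟩, {h}, fun h' hh' => ?_, fun I hI hab => ?_⟩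
        · rw [Finset.mem_singleton.1 hh']; exact hh
        · obtain ⟨i, hi, φ', hφ', he⟩ := hab h (Finset.mem_singleton_self h)
          rw [← hbase I hI i hi _ (hφ.mul hφ')]
          refine integral_congr_ae ?_
          filter_upwards [he] with x hx
          rw [hx, mul_assoc]
      · exact ⟨⟨1, measurable_const, fun _ => by simp⟩, ∅, fun h hh =>
          absurd hh (Finset.notMem_empty h), fun I _ _ => by simp⟩
      · rintro a b ⟨⟨C, hC⟩, H, hH, hI⟩ ⟨⟨C', hC'⟩, H', hH', hI'⟩
        refine ⟨⟨_, hC.add hC'⟩, H ∪ H', fun h hh => ?_, fun I hO hab => ?_⟩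
        · rcases Finset.mem_union.1 hh with hh | hh
          · exact hH h hh
          · exact hH' h hh
        · obtain ⟨C₀, hC₀⟩ := hrb I hO
          simp only [map_add, mul_add]
          rw [integral_add (hC₀.gmul hC.conj).integrable (hC₀.gmul hC'.conj).integrable,
            hI I hO fun h hh => hab h (Finset.mem_union_left _ hh),
            hI' I hO fun h hh => hab h (Finset.mem_union_right _ hh), add_zero]
      · rintro c a ⟨⟨C, hC⟩, H, hH, hI⟩
        refine ⟨⟨_, hC.const_mul c⟩, H, hH, fun I hO hab => ?_⟩
        have := hI I hO hab
        simp only [map_mul, mul_left_comm _ (conj c)]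
        rw [integral_const_mul, this, mul_zero]
    obtain ⟨⟨C, hC⟩, H, hHc, hHI⟩ := hH
    obtain ⟨I, hI, hab⟩ := hK.exists_orthCL H hHc
    refine ⟨I, hI, le_trans ?_ hle⟩
    obtain ⟨C₁, hC₁⟩ := hrb I hI
    obtain ⟨C₂, hC₂⟩ := clAlg_bd hπ (hI.relProj_mem hB)
    have hz1 := hHI I hI hab
    have hz2 : ∫ x, ((f' x : ℂ) - relProj κ π I (fun x => (f x : ℂ)) x) *
        conj (relProj κ π I (fun x => (f x : ℂ)) x) ∂μ = 0 := by
      have e : ∀ x, ((f' x : ℂ) - relProj κ π I (fun x => (f x : ℂ)) x) *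
          conj (relProj κ π I (fun x => (f x : ℂ)) x) = ∑ h ∈ I,
          ((f' x : ℂ) - relProj κ π I (fun x => (f x : ℂ)) x) *
          conj (CE κ (fun y => (f y : ℂ) * conj (h y)) (π x) * h x) := fun x => by
        rw [← Finset.mul_sum, ← map_sum]; rfl
      simp only [e]
      rw [integral_finsetSum]
      · exact Finset.sum_eq_zero fun h hh => hbase I hI h hh _ (hI.bd_term hB hh)
      · intro h hh
        exact (hC₁.gmul (((hI.bd_term hB hh).comp hπ).mul (hI.cl h hh).bd).conj).integrable
    set P := relProj κ π I (fun x => (f x : ℂ)) with hP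
    have hintg : Bd (C₁ * (C₂ + C)) fun x => ((f' x : ℂ) - P x) * conj (P x - a x) :=
      hC₁.gmul (hC₂.sub hC).conj
    have hz : ∫ x, ((f' x : ℂ) - P x) * conj (P x - a x) ∂μ = 0 := by
      simp only [map_sub, mul_sub]
      rw [integral_sub (hC₁.gmul hC₂.conj).integrable (hC₁.gmul hC.conj).integrable, hz1, hz2,
        sub_zero]
    have hre : ∫ x, (((f' x : ℂ) - P x) * conj (P x - a x)).re ∂μ = 0 := by
      have := integral_re (𝕜 := ℂ) (hintg.integrable (μ := μ))
      rw [hz] at this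
      simpa using this
    have hi1 : Integrable (fun x => 2 * (((f' x : ℂ) - P x) * conj (P x - a x)).re) μ :=
      (hintg.integrable.re).const_mul 2
    have : ∫ x, ‖(f' x : ℂ) - P x‖ ^ 2 ∂μ = ∫ x, (‖(f' x : ℂ) - P x‖ ^ 2 +
        2 * (((f' x : ℂ) - P x) * conj (P x - a x)).re) ∂μ := by
      rw [integral_add hC₁.integrable_norm_sq hi1, integral_const_mul, hre, mul_zero, add_zero]
    rw [this]
    refine integral_mono (hC₁.integrable_norm_sq.add hi1) (hB'.sub hC).integrable_norm_sq
      fun x => ?_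
    have e : (f' x : ℂ) - a x = (f' x - P x) + (P x - a x) := by ring
    change _ ≤ ‖(f' x : ℂ) - a x‖ ^ 2
    rw [e, ← Complex.normSq_eq_norm_sq (_ + _), Complex.normSq_add,
      Complex.normSq_eq_norm_sq, Complex.normSq_eq_norm_sq]
    nlinarith [sq_nonneg ‖P x - a x‖]

end FourTerms

section LowerFour

variable {X : Type*} [MeasurableSpace X] {μ : Measure X} [IsProbabilityMeasure μ]
  {Z : Type*} [CommGroup Z] [TopologicalSpace Z] [IsTopologicalGroup Z] [CompactSpace Z]
  [T2Space Z] [SecondCountableTopology Z] [MeasurableSpace Z] [BorelSpace Z]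
  {m : Measure Z} [IsProbabilityMeasure m] [m.IsMulLeftInvariant]
  {τ : ℤ → X → X} {q : ℕ} {π : X → Z} {α : Z} {κ : Kernel Z X} [IsMarkovKernel κ]

theorem Kron.norm_corr4_sub_le (hK : Kron τ μ q π m α κ) {F₀ F₁ F₂ G : X → ℂ} (h₀ : Bd 1 F₀)
    (h₁ : Bd 1 F₁) (h₂ : Bd 1 F₂) {C : ℝ} (hG : Bd C G) (j : ℤ) :
    ‖corr4 τ μ F₀ F₁ F₂ G j‖ ≤ ∫ x, ‖G x‖ ∂μ := by
  rw [← integral_comp_mp_real (hK.mp (3 * j)) hG.meas.norm]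
  refine (norm_integral_le_integral_norm _).trans ?_
  have hb := ((h₀.mul (h₁.comp (hK.meas j))).mul (h₂.comp (hK.meas (2 * j))))
  refine integral_mono_of_nonneg (ae_of_all _ fun _ => norm_nonneg _)
    (hG.comp (hK.meas (3 * j))).integrable.norm (ae_of_all _ fun x => ?_)
  beta_reduce
  rw [norm_mul]
  exact mul_le_of_le_one_left (norm_nonneg _) (hb.bdd x)

/-- Moving a factor measurable with respect to the rotation from the last to the first place. -/
theorem Kron.evals_corr4_shift (hK : Kron τ μ q π m α κ) (r : ℤ) {F₀ F₁ F₂ h : X → ℂ} {φ : Z → ℂ}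
    (h₀ : Bd 1 F₀) (h₁ : Bd 1 F₁) (h₂ : Bd 1 F₂) (hh : Bd 1 h) (hφ : Bd 1 φ) {ε : ℝ} (hε : 0 < ε) :
    Evals m α q r ε (fun n : ℕ => corr4 τ μ F₀ F₁ F₂ (fun x => φ (π x) * h x) (q * n + r) -
      corr4 τ μ (fun x => F₀ x * φ (π x)) F₁ F₂ h (q * n + r)) 0 := by
  have hπ := hK.pi.measurable
  refine hK.evals_of_near hε.le ?_
  have ht : Tendsto (fun a : Z => a ^ 3) (𝓝 1) (𝓝 1) := by
    have := (continuous_pow 3).tendsto (1 : Z)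
    rwa [one_pow] at this
  filter_upwards [ht.eventually (translation_continuity (m := m) hφ hε)] with a ha n hn
  rw [sub_zero]
  set j : ℤ := q * n + r
  have hφπ := hφ.comp hπ
  have b1 : Bd 1 (fun x => F₀ x * F₁ (τ j x) * F₂ (τ (2 * j) x) *
      (φ (π (τ (3 * j) x)) * h (τ (3 * j) x))) :=
    ((h₀.mul (h₁.comp (hK.meas _))).mul (h₂.comp (hK.meas _))).mul
      ((hφπ.mul hh).comp (hK.meas _))
  have b2 : Bd 1 (fun x => F₀ x * φ (π x) * F₁ (τ j x) * F₂ (τ (2 * j) x) * h (τ (3 * j) x)) :=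
    (((h₀.mul hφπ).mul (h₁.comp (hK.meas _))).mul (h₂.comp (hK.meas _))).mul (hh.comp (hK.meas _))
  have b3 : Bd 2 (fun z => φ (a ^ 3 * z) - φ z) :=
    ((hφ.comp (measurable_const_mul _)).sub hφ).mono (by norm_num)
  have e : ‖∫ x, (F₀ x * F₁ (τ j x) * F₂ (τ (2 * j) x) *
      (φ (π (τ (3 * j) x)) * h (τ (3 * j) x)) -
      F₀ x * φ (π x) * F₁ (τ j x) * F₂ (τ (2 * j) x) * h (τ (3 * j) x)) ∂μ‖ ≤ ε := by
    refine (norm_integral_le_integral_norm _).trans (le_trans ?_ ha)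
    rw [← integral_comp_mp_real hK.pi b3.meas.norm]
    refine integral_mono_of_nonneg (ae_of_all _ fun _ => norm_nonneg _)
      (b3.comp hπ).integrable.norm ?_
    filter_upwards [hK.rot_pow (3 * j)] with x hx
    have e3 : α ^ (3 * j) = a ^ 3 := by
      rw [mul_comm, zpow_mul, hn]; exact zpow_natCast a 3
    rw [hx, e3]
    have : F₀ x * F₁ (τ j x) * F₂ (τ (2 * j) x) * (φ (a ^ 3 * π x) * h (τ (3 * j) x)) -
        F₀ x * φ (π x) * F₁ (τ j x) * F₂ (τ (2 * j) x) * h (τ (3 * j) x) =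
        (F₀ x * F₁ (τ j x) * F₂ (τ (2 * j) x) * h (τ (3 * j) x)) * (φ (a ^ 3 * π x) - φ (π x)) := by
      ring
    rw [this, norm_mul]
    exact mul_le_of_le_one_left (norm_nonneg _)
      ((((h₀.mul (h₁.comp (hK.meas j))).mul (h₂.comp (hK.meas (2 * j)))).mul
        (hh.comp (hK.meas (3 * j)))).bdd x)
  rw [integral_sub b1.integrable b2.integrable] at e
  exact e

theorem Kron.evals_corr4_near (hK : Kron τ μ q π m α κ) (r : ℤ) {F₀ F₁ F₂ h : X → ℂ}
    (h₀ : Bd 1 F₀) (h₁ : Bd 1 F₁) (h₂ : Bd 1 F₂) (hh : CL τ μ π h) {ε : ℝ} (hε : 0 < ε)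
    (hnear : ∀ᶠ a in 𝓝 (1 : Z), ∀ j : ℤ, α ^ j = a →
      ∫ x, ‖h (τ (3 * j) x) * conj (h (τ (2 * j) x)) ^ 3 * h (τ j x) ^ 3 * conj (h x) - 1‖ ∂μ ≤ ε) :
    Evals m α q r ε (fun n : ℕ => corr4 τ μ F₀ F₁ F₂ h (q * n + r) -
      corr3 τ μ (fun x => F₀ x * h x) (fun x => F₁ x * conj (h x) ^ 3) (fun x => F₂ x * h x ^ 3)
        (q * n + r)) 0 := by
  refine hK.evals_of_near hε.le ?_
  filter_upwards [hnear] with a ha n hn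
  rw [sub_zero]
  have hle := ha _ hn
  set j : ℤ := q * n + r
  have hb := hh.bd
  have b1 : Bd 1 (fun x => F₀ x * F₁ (τ j x) * F₂ (τ (2 * j) x) * h (τ (3 * j) x)) :=
    ((h₀.mul (h₁.comp (hK.meas _))).mul (h₂.comp (hK.meas _))).mul (hb.comp (hK.meas _))
  have b2 : Bd 1 (fun x => F₀ x * h x * (F₁ (τ j x) * conj (h (τ j x)) ^ 3) *
      (F₂ (τ (2 * j) x) * h (τ (2 * j) x) ^ 3)) :=
    ((h₀.mul hb).mul ((h₁.mul (hb.conj.pow 3)).comp (hK.meas j))).mul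
      ((h₂.mul (hb.pow 3)).comp (hK.meas (2 * j)))
  have b3 : Bd (1 + 1) (fun x => h (τ (3 * j) x) * conj (h (τ (2 * j) x)) ^ 3 * h (τ j x) ^ 3 *
      conj (h x) - 1) :=
    ((((hb.comp (hK.meas (3 * j))).mul ((hb.conj.pow 3).comp (hK.meas (2 * j)))).mul
      ((hb.pow 3).comp (hK.meas j))).mul hb.conj).sub Bd.one
  have e : ‖∫ x, (F₀ x * F₁ (τ j x) * F₂ (τ (2 * j) x) * h (τ (3 * j) x) -
      F₀ x * h x * (F₁ (τ j x) * conj (h (τ j x)) ^ 3) *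
      (F₂ (τ (2 * j) x) * h (τ (2 * j) x) ^ 3)) ∂μ‖ ≤ ε := by
    refine (norm_integral_le_integral_norm _).trans (le_trans ?_ hle)
    refine integral_mono_of_nonneg (ae_of_all _ fun _ => norm_nonneg _) b3.integrable.norm
      (ae_of_all _ fun x => ?_)
    obtain ⟨u, hu⟩ : ∃ u, u = F₀ x * h x * (F₁ (τ j x) * conj (h (τ j x)) ^ 3) *
      (F₂ (τ (2 * j) x) * h (τ (2 * j) x) ^ 3) := ⟨_, rfl⟩
    have e0 := hh.mul_conj x
    have e1 : h (τ j x) ^ 3 * conj (h (τ j x)) ^ 3 = 1 := by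
      rw [← mul_pow, hh.mul_conj, one_pow]
    have e2 : h (τ (2 * j) x) ^ 3 * conj (h (τ (2 * j) x)) ^ 3 = 1 := by
      rw [← mul_pow, hh.mul_conj, one_pow]
    have : F₀ x * F₁ (τ j x) * F₂ (τ (2 * j) x) * h (τ (3 * j) x) -
        F₀ x * h x * (F₁ (τ j x) * conj (h (τ j x)) ^ 3) *
        (F₂ (τ (2 * j) x) * h (τ (2 * j) x) ^ 3) = u * (h (τ (3 * j) x) *
        conj (h (τ (2 * j) x)) ^ 3 * h (τ j x) ^ 3 * conj (h x) - 1) := by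
      have e3 : u * (h (τ (3 * j) x) * conj (h (τ (2 * j) x)) ^ 3 * h (τ j x) ^ 3 * conj (h x)) =
          F₀ x * F₁ (τ j x) * F₂ (τ (2 * j) x) * h (τ (3 * j) x) * ((h x * conj (h x)) *
          (h (τ j x) ^ 3 * conj (h (τ j x)) ^ 3) *
          (h (τ (2 * j) x) ^ 3 * conj (h (τ (2 * j) x)) ^ 3)) := by
        rw [hu]; ring
      rw [mul_sub, e3, e0, e1, e2, ← hu]; ring
    change ‖_ - _‖ ≤ _
    rw [this, norm_mul]
    refine mul_le_of_le_one_left (norm_nonneg _) ?_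
    rw [hu]
    exact b2.bdd x
  rw [integral_sub b1.integrable b2.integrable] at e
  exact e

theorem Kron.evals_term (hK : Kron τ μ q π m α κ) (r : ℤ) {f : X → ℝ} (hm : Measurable f)
    (h0 : ∀ x, 0 ≤ f x) (h1 : ∀ x, f x ≤ 1) {h : X → ℂ} (hh : CL τ μ π h) {ε : ℝ} (hε : 0 < ε) :
    ∃ v : ℝ, 0 ≤ v ∧ (h = (fun _ => 1) → (∫ x, f x ∂μ) ^ 4 ≤ v) ∧
      Evals m α q r ε (fun n : ℕ => corr4 τ μ (fun x => (f x : ℂ)) (fun x => (f x : ℂ))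
        (fun x => (f x : ℂ)) (fun x => CE κ (fun y => f y * conj (h y)) (π x) * h x)
        (q * n + r)) v := by
  classical
  have hB := bd_ofReal hm h0 h1
  have hb := hh.bd
  have hφ : Bd 1 (CE κ (fun y => f y * conj (h y))) := (hB.mul hb.conj).CE
  have hconj : ∀ (u : X → ℂ) z, CE κ (fun y => f y * conj (u y)) z =
      conj (CE κ (fun y => f y * u y) z) := fun u z => by
    rw [← CE_conj]
    congr 1; funext y
    rw [map_mul, Complex.conj_ofReal]
  set φ := CE κ (fun y => f y * conj (h y)) with hφdef
  have hF₀ := hB.mul (hφ.comp hK.pi.measurable)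
  have hs := hK.evals_corr4_shift r hB hB hB hb hφ (show 0 < ε / 3 by positivity)
  by_cases hcase : h = (fun _ => 1) ∨ ¬ Unif τ m κ h
  · have hnear : ∀ᶠ a in 𝓝 (1 : Z), ∀ j : ℤ, α ^ j = a →
        ∫ x, ‖h (τ (3 * j) x) * conj (h (τ (2 * j) x)) ^ 3 * h (τ j x) ^ 3 * conj (h x) - 1‖ ∂μ
          ≤ ε / 3 := by
      by_cases hU : Unif τ m κ h
      · rw [hcase.resolve_right (not_not.2 hU)]
        refine Eventually.of_forall fun a j _ => ?_
        simp; positivity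
      · exact hK.cl_near hh hU (by positivity)
    have h2 := hK.evals_corr4_near r hF₀ hB hB hh (by positivity) hnear
    have h3 : Evals m α q r (ε / 3) _ _ := hK.eval_corr3 r (hF₀.mul hb) (hB.mul (hb.conj.pow 3))
      (hB.mul (hb.pow 3)) (show 0 < ε / 3 by positivity)
    have hval : ∫ z, CE κ (fun x => (f x : ℂ) * φ (π x) * h x) z *
        CE κ (fun x => (f x : ℂ) * conj (h x) ^ 3) z * CE κ (fun x => (f x : ℂ) * h x ^ 3) z ∂m =
        ((∫ z, ‖CE κ (fun x => (f x : ℂ) * h x) z‖ ^ 2 *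
          ‖CE κ (fun x => (f x : ℂ) * h x ^ 3) z‖ ^ 2 ∂m : ℝ) : ℂ) := by
      rw [← integral_complex_ofReal]
      refine integral_congr_ae ?_
      filter_upwards [hK.CE_pi_mul φ (fun x => (f x : ℂ) * h x)] with z hz
      have e1 : (fun x => (f x : ℂ) * φ (π x) * h x) = fun x => φ (π x) * (f x * h x) := by
        funext x; ring
      have e2 := hconj (fun x => h x ^ 3) z
      simp only [map_pow] at e2
      rw [e1, hz, e2, hφdef, hconj h z]
      push_cast
      rw [← Complex.conj_mul', ← Complex.conj_mul']
      ring
    refine ⟨∫ z, ‖CE κ (fun x => (f x : ℂ) * h x) z‖ ^ 2 *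
          ‖CE κ (fun x => (f x : ℂ) * h x ^ 3) z‖ ^ 2 ∂m, integral_nonneg fun z => by positivity,
      fun h1' => ?_, ?_⟩
    · obtain ⟨e, he, he0, he1, hc, hi⟩ := hK.exists_CE_ofReal hm h0 h1
      rw [h1', ← hi]
      refine (pow_integral_le_integral_pow he he0 he1 4).trans_eq
        (integral_congr_ae (ae_of_all _ fun z => ?_))
      simp only [one_pow, mul_one, hc, Complex.norm_real, Real.norm_eq_abs, sq_abs]
      ring
    · rw [hval] at h3
      convert ((hs.add h2).add h3) using 1
      · ring
      · funext n; ring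
      · ring
  · push Not at hcase
    refine ⟨0, le_rfl, fun h1' => absurd h1' hcase.1, ?_⟩
    have h2 : Evals m α q r (ε / 3) (fun n : ℕ => corr4 τ μ (fun x => (f x : ℂ) * φ (π x))
        (fun x => (f x : ℂ)) (fun x => (f x : ℂ)) h (q * n + r)) 0 :=
      Evals.of_ub (by positivity) fun η => hK.ub_weight_corr4_zero r η hF₀ hB hB hb hcase.2
    have h3 := (hs.add h2).mono (show ε / 3 + ε / 3 ≤ ε by linarith)
    convert h3 using 1
    · funext n; ring
    · simp

theorem Kron.lower_four (hK : Kron τ μ q π m α κ) [MeasurableSpace.CountablyGenerated X] (r : ℤ)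
    {f : X → ℝ} (hm : Measurable f) (h0 : ∀ x, 0 ≤ f x) (h1 : ∀ x, f x ≤ 1) {ε : ℝ} (hε : 0 < ε) :
    ∃ v : ℝ, (∫ x, f x ∂μ) ^ 4 ≤ v ∧ Evals m α q r ε (fun n : ℕ =>
      corr4 τ μ (fun x => (f x : ℂ)) (fun x => (f x : ℂ)) (fun x => (f x : ℂ))
        (fun x => (f x : ℂ)) (q * n + r)) v := by
  have hB := bd_ofReal hm h0 h1
  obtain ⟨f', hm', h0', h1', hd, hU, happ⟩ := hK.exists_approx hm h0 h1
  have hB' := bd_ofReal hm' h0' h1'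
  obtain ⟨I, hI, hle⟩ := happ ((ε / 3) ^ 2) (by positivity)
  have hterm : ∀ h : X → ℂ, ∃ v : ℝ, h ∈ I → 0 ≤ v ∧ (h = (fun _ => 1) → (∫ x, f x ∂μ) ^ 4 ≤ v) ∧
      Evals m α q r (ε / (3 * I.card)) (fun n : ℕ => corr4 τ μ (fun x => (f x : ℂ))
        (fun x => (f x : ℂ)) (fun x => (f x : ℂ))
        (fun x => CE κ (fun y => f y * conj (h y)) (π x) * h x) (q * n + r)) v := fun h => by
    by_cases hh : h ∈ I
    · have : 0 < I.card := Finset.card_pos.2 ⟨h, hh⟩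
      obtain ⟨v, hv⟩ := hK.evals_term r hm h0 h1 (hI.cl h hh)
        (show 0 < ε / (3 * I.card) by positivity)
      exact ⟨v, fun _ => hv⟩
    · exact ⟨0, fun h => absurd h hh⟩
  choose v hv using hterm
  have hcard : 0 < I.card := Finset.card_pos.2 ⟨_, hI.one_mem⟩
  refine ⟨∑ h ∈ I, v h, ((hv _ hI.one_mem).2.1 rfl).trans
    (Finset.single_le_sum (fun h hh => (hv h hh).1) hI.one_mem), ?_⟩
  have hsum := Evals.sum I fun h hh => (hv h hh).2.2
  have e1 : ∑ _h ∈ I, ε / (3 * I.card) = ε / 3 := by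
    rw [Finset.sum_const, nsmul_eq_mul]
    field_simp
  rw [e1] at hsum
  have hu1 : Evals m α q r (ε / 3) (fun n : ℕ => corr4 τ μ (fun x => (f x : ℂ))
      (fun x => (f x : ℂ)) (fun x => (f x : ℂ)) (fun x => (f x : ℂ) - f' x) (q * n + r)) 0 :=
    Evals.of_ub (by positivity) fun η => hK.ub_weight_corr4_zero r η hB hB hB hd hU
  set P := relProj κ π I (fun x => (f x : ℂ)) with hP
  obtain ⟨C, hC⟩ : ∃ C, Bd C P := clAlg_bd hK.pi.measurable (hI.relProj_mem hB)
  have hg := hB'.sub hC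
  have hu2 : Evals m α q r (ε / 3) (fun n : ℕ => corr4 τ μ (fun x => (f x : ℂ))
      (fun x => (f x : ℂ)) (fun x => (f x : ℂ)) (fun x => (f' x : ℂ) - P x) (q * n + r)) 0 := by
    refine hK.evals_of_near (by positivity) (Eventually.of_forall fun a n _ => ?_)
    rw [sub_zero]
    refine (hK.norm_corr4_sub_le hB hB hB hg _).trans
      ((integral_norm_le_sqrt (hg.memLp 2)).trans ?_)
    rw [Real.sqrt_le_left (by positivity)]
    exact hle
  convert (hu1.add hu2).add hsum using 1
  · ring
  · funext n
    obtain ⟨j, hj⟩ : ∃ j : ℤ, j = q * n + r := ⟨_, rfl⟩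
    rw [← hj]
    have hA := (hB.mul (hB.comp (hK.meas j))).mul (hB.comp (hK.meas (2 * j)))
    have hterms : ∀ h ∈ I, Bd 1 fun x => CE κ (fun y => (f y : ℂ) * conj (h y)) (π x) * h x :=
      fun h hh => ((hI.bd_term hB hh).comp hK.pi.measurable).mul (hI.cl h hh).bd
    simp only [corr4]
    rw [← integral_add (hA.gmul (hd.comp (hK.meas (3 * j)))).integrable
      (hA.gmul (hg.comp (hK.meas (3 * j)))).integrable, ← integral_finsetSum I fun h hh =>
      (hA.gmul ((hterms h hh).comp (hK.meas (3 * j)))).integrable, ← integral_add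
      ((hA.gmul (hd.comp (hK.meas (3 * j)))).add
        (hA.gmul (hg.comp (hK.meas (3 * j))))).integrable
      (Bd.sum I fun h hh => hA.gmul ((hterms h hh).comp (hK.meas (3 * j)))).integrable]
    refine integral_congr_ae (ae_of_all _ fun x => ?_)
    simp only [← Finset.mul_sum]
    change _ = _ + _ * P (τ (3 * j) x)
    ring
  · push_cast; ring

end LowerFour

noncomputable instance : MeasurableSpace Circle := borel Circle

instance : BorelSpace Circle := ⟨rfl⟩

theorem measurable_circle_coe : Measurable fun c : Circle => (c : ℂ) := by
  have h : Continuous fun c : Circle => (c : ℂ) := continuous_subtype_val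
  exact h.measurable

section Eigenvalues

variable {X : Type*} [MeasurableSpace X] {μ : Measure X} [IsProbabilityMeasure μ]

theorem Bd.circle {χ : X → Circle} (hχ : Measurable χ) : Bd 1 (fun x => (χ x : ℂ)) :=
  ⟨measurable_circle_coe.comp hχ, fun _ => (Circle.norm_coe _).le⟩

/-- Eigenvalues of a measure preserving map having a unimodular eigenfunction. -/
def IsEig (T : X → X) (μ : Measure X) (l : Circle) : Prop :=
  ∃ χ : X → Circle, Measurable χ ∧ ∀ᵐ x ∂μ, χ (T x) = l * χ x

theorem integral_eig_mul_conj {T : X → X} (hT : MeasurePreserving T μ μ) {l l' : Circle}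
    (hl : l ≠ l') {χ χ' : X → Circle} (hχ : Measurable χ) (hχ' : Measurable χ')
    (h : ∀ᵐ x ∂μ, χ (T x) = l * χ x) (h' : ∀ᵐ x ∂μ, χ' (T x) = l' * χ' x) :
    ∫ x, (χ x : ℂ) * conj (χ' x : ℂ) ∂μ = 0 := by
  set c := ∫ x, (χ x : ℂ) * conj (χ' x : ℂ) ∂μ with hc
  have e : c = ((l * l'⁻¹ : Circle) : ℂ) * c := by
    conv_lhs => rw [hc, ← integral_comp_mp hT ((Bd.circle hχ).mul (Bd.circle hχ').conj)]
    rw [hc, ← integral_const_mul]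
    refine integral_congr_ae ?_
    filter_upwards [h, h'] with x h1 h2
    rw [h1, h2, Circle.coe_mul, Circle.coe_mul, Circle.coe_mul, map_mul, ← conj_circle]
    ring
  by_contra h0
  have h1 : ((l * l'⁻¹ : Circle) : ℂ) = 1 := by
    apply mul_right_cancel₀ h0
    rw [← e, one_mul]
  exact hl (mul_inv_eq_one.1 (Circle.coe_eq_one.1 h1))

theorem countable_isEig [MeasurableSpace.CountablyGenerated X] {T : X → X}
    (hT : MeasurePreserving T μ μ) : {l | IsEig T μ l}.Countable := by
  classical
  have : Fact ((2 : ENNReal) ≠ ⊤) := ⟨by simp⟩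
  choose! χ hχ hχT using fun (l : Circle) (hl : l ∈ {l | IsEig T μ l}) => hl
  set v : Circle → Lp ℂ 2 μ := fun l => if hl : Measurable (χ l) then
    ((Bd.circle hl).memLp (μ := μ) 2).toLp (fun x => (χ l x : ℂ)) else 0
  have hd : ({l | IsEig T μ l}).PairwiseDisjoint fun l => Metric.ball (v l) (1 / 2) := by
    intro l hl l' hl' hne
    refine Metric.ball_disjoint_ball ?_
    have hv : v l = ((Bd.circle (hχ l hl)).memLp (μ := μ) 2).toLp (fun x => (χ l x : ℂ)) :=
        dif_pos (hχ l hl)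
    have hv' : v l' =
        ((Bd.circle (hχ l' hl')).memLp (μ := μ) 2).toLp (fun x => (χ l' x : ℂ)) :=
            dif_pos (hχ l' hl')
    have hn : ∀ k (hk : IsEig T μ k),
        ‖((Bd.circle (hχ k hk)).memLp (μ := μ) 2).toLp (fun x => (χ k x : ℂ))‖ ^ 2 = 1 := by
      intro k hk
      rw [norm_toLp_sq]
      simp only [Circle.norm_coe]
      simp
    rw [dist_eq_norm, hv, hv']
    have h2 := norm_sub_sq (𝕜 := ℂ)
      (((Bd.circle (hχ l hl)).memLp (μ := μ) 2).toLp (fun x => (χ l x : ℂ)))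
      (((Bd.circle (hχ l' hl')).memLp (μ := μ) 2).toLp (fun x => (χ l' x : ℂ)))
    rw [hn l hl, hn l' hl', inner_toLp] at h2
    have h3 := integral_eig_mul_conj hT hne.symm (hχ l' hl') (hχ l hl) (hχT l' hl') (hχT l hl)
    have h4 : ∫ x, conj (χ l x : ℂ) * (χ l' x : ℂ) ∂μ = 0 := by
      rw [← h3]; exact integral_congr_ae (ae_of_all _ fun x => mul_comm _ _)
    rw [h4] at h2
    simp only [map_zero, mul_zero, sub_zero] at h2
    nlinarith [norm_nonneg (((Bd.circle (hχ l hl)).memLp (μ := μ) 2).toLp (fun x => (χ l x : ℂ)) -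
      ((Bd.circle (hχ l' hl')).memLp (μ := μ) 2).toLp (fun x => (χ l' x : ℂ)))]
  exact hd.countable_of_isOpen (fun _ _ => Metric.isOpen_ball)
    fun l _ => Metric.nonempty_ball.2 (by norm_num)

end Eigenvalues

section OrbitClosure

variable {X : Type*} [MeasurableSpace X] {μ : Measure X} [IsProbabilityMeasure μ]
  {K : Type*} [CommGroup K] [TopologicalSpace K] [IsTopologicalGroup K] [CompactSpace K]
  [T2Space K] [SecondCountableTopology K] [MeasurableSpace K] [BorelSpace K]

/-- The closed subgroup topologically generated by `α`. -/
def orbitClosure (α : K) : Subgroup K := (Subgroup.zpowers α).topologicalClosure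

theorem isClosed_orbitClosure (α : K) : IsClosed (orbitClosure α : Set K) :=
  Subgroup.isClosed_topologicalClosure _

theorem mem_orbitClosure (α : K) : α ∈ orbitClosure α :=
  Subgroup.le_topologicalClosure _ (Subgroup.mem_zpowers α)

/-- The generator of `orbitClosure α`. -/
def orbitGen (α : K) : orbitClosure α := ⟨α, mem_orbitClosure α⟩

theorem dense_zpow_orbitGen (α : K) : Dense (Set.range fun n : ℤ => orbitGen α ^ n) := by
  rw [Subtype.dense_iff, ← Set.range_comp]
  intro x hx
  refine closure_mono ?_ hx
  rintro _ ⟨n, rfl⟩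
  exact ⟨n, rfl⟩

instance (α : K) : CompactSpace (orbitClosure α) :=
  isCompact_iff_compactSpace.1 (isClosed_orbitClosure α).isCompact

instance (α : K) : SecondCountableTopology (orbitClosure α) :=
  TopologicalSpace.Subtype.secondCountableTopology _

/-- A measurable equivariant map into a compact rotation takes values in a single coset of the
orbit closure. -/
theorem exists_orbitClosure_coset {T : X → X} (hT : Ergodic T μ) {p : X → K} (hp : Measurable p)
    {α : K} (hrot : ∀ᵐ x ∂μ, p (T x) = α * p x) :
    ∃ (k : K) (π : X → orbitClosure α), Measurable π ∧ (∀ᵐ x ∂μ, p x = k * (π x : K)) ∧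
      ∀ᵐ x ∂μ, π (T x) = orbitGen α * π x := by
  have hcl : IsClosed (orbitClosure α : Set K) := isClosed_orbitClosure α
  have := TopologicalSpace.metrizableSpace_of_t3_secondCountable (K ⧸ orbitClosure α)
  have hmk : Continuous (fun k : K => (k : K ⧸ orbitClosure α)) := continuous_quotient_mk'
  have hg : AEStronglyMeasurable (fun x => (p x : K ⧸ orbitClosure α)) μ :=
    hmk.comp_aestronglyMeasurable hp.aestronglyMeasurable
  obtain ⟨c, hc⟩ := hT.ae_eq_const_of_ae_eq_comp_ae hg (by
    filter_upwards [hrot] with x hx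
    change ((p (T x) : K) : K ⧸ orbitClosure α) = (p x : K ⧸ orbitClosure α)
    rw [hx, mul_comm, eq_comm, QuotientGroup.eq, inv_mul_cancel_left]
    exact mem_orbitClosure α)
  obtain ⟨k, rfl⟩ := QuotientGroup.mk_surjective c
  classical
  set f : X → K := fun x => if k⁻¹ * p x ∈ orbitClosure α then k⁻¹ * p x else 1 with hf
  have hmem : ∀ x, f x ∈ orbitClosure α := by
    intro x
    simp only [hf]
    split_ifs with h
    · exact h
    · exact one_mem _
  have hm : Measurable fun x => k⁻¹ * p x := hp.const_mul _
  have hfm : Measurable f := Measurable.ite (hm hcl.measurableSet) hm measurable_const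
  have hpk : ∀ᵐ x ∂μ, p x = k * f x := by
    filter_upwards [hc] with x hx
    have : k⁻¹ * p x ∈ orbitClosure α := QuotientGroup.eq.1 hx.symm
    simp only [hf, if_pos this, mul_inv_cancel_left]
  refine ⟨k, fun x => ⟨f x, hmem x⟩, hfm.subtype_mk, hpk, ?_⟩
  filter_upwards [hrot, hpk, hT.toMeasurePreserving.quasiMeasurePreserving.ae hpk] with x h1 h2 h3
  refine Subtype.ext (mul_left_cancel (a := k) ?_)
  change k * f (T x) = k * (α * f x)
  rw [← h3, h1, h2, mul_left_comm]

/-- A measure invariant under a rotation with dense orbit is invariant. -/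
theorem isMulLeftInvariant_of_dense {m : Measure K} [IsProbabilityMeasure m] {α : K}
    (hα : Dense (Set.range fun n : ℤ => α ^ n)) (h : MeasurePreserving (fun z => α * z) m m) :
    m.IsMulLeftInvariant := by
  have := TopologicalSpace.metrizableSpace_of_t3_secondCountable K
  have hz : ∀ n : ℤ, MeasurePreserving (fun z => α ^ n * z) m m := by
    have hnat : ∀ n : ℕ, MeasurePreserving (fun z => α ^ n * z) m m := by
      intro n
      induction n with
      | zero => simp only [pow_zero, one_mul]; exact MeasurePreserving.id m
      | succ n ih =>
        have := h.comp ih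
        simpa [Function.comp_def, pow_succ', mul_assoc] using this
    intro n
    obtain ⟨k, rfl | rfl⟩ := n.eq_nat_or_neg
    · simpa using hnat k
    · have h1 := (hnat k).symm (MeasurableEquiv.mulLeft (α ^ k))
      simpa [MeasurableEquiv.mulLeft] using h1
  refine ⟨fun g => ?_⟩
  have hgm : Measurable fun z => g * z := measurable_const_mul g
  have := Measure.isProbabilityMeasure_map (μ := m) hgm.aemeasurable
  refine ext_of_forall_integral_eq_of_IsFiniteMeasure fun f => ?_
  rw [integral_map hgm.aemeasurable f.continuous.aestronglyMeasurable]
  have hcont : Continuous fun g : K => ∫ z, f (g * z) ∂m := by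
    refine continuous_of_dominated (bound := fun _ => ‖f‖) (fun g => ?_) (fun g => ?_)
      (integrable_const _) (ae_of_all _ fun z => by fun_prop)
    · exact (f.continuous.comp (continuous_const_mul g)).aestronglyMeasurable
    · exact ae_of_all _ fun z => f.norm_coe_le_norm _
  have heq := Continuous.ext_on hα hcont (continuous_const (y := ∫ z, f z ∂m)) (by
    rintro _ ⟨n, rfl⟩
    exact integral_comp_mp_real (hz n) f.continuous.measurable)
  exact congrFun heq g

end OrbitClosure

section Existence

variable {X : Type*} [MeasurableSpace X] {μ : Measure X} [IsProbabilityMeasure μ]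

theorem ae_norm_eq_const {T : X → X} (hT : Ergodic T μ) {ψ : X → ℂ} (hψ : Bd 1 ψ) {l : ℂ}
    (hl : ‖l‖ = 1) (h : ∀ᵐ x ∂μ, ψ (T x) = l * ψ x) : ∃ c : ℝ, ∀ᵐ x ∂μ, ‖ψ x‖ = c := by
  refine hT.ae_eq_const_of_ae_eq_comp_ae (g := fun x => ‖ψ x‖) hψ.meas.norm.aestronglyMeasurable ?_
  filter_upwards [h] with x hx
  simp only [Function.comp_apply]
  rw [hx, norm_mul, hl, one_mul]

/-- An eigenfunction is a multiple of any unimodular eigenfunction with the same eigenvalue. -/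
theorem ae_eq_const_mul_eig {T : X → X} (hT : Ergodic T μ) {ψ : X → ℂ} (hψ : Bd 1 ψ) {l : Circle}
    (h : ∀ᵐ x ∂μ, ψ (T x) = l * ψ x) {χ : X → Circle} (hχ : Measurable χ)
    (hχT : ∀ᵐ x ∂μ, χ (T x) = l * χ x) : ∃ c : ℂ, ∀ᵐ x ∂μ, ψ x = c * χ x := by
  have hm := (hψ.mul (Bd.circle hχ).conj).meas
  obtain ⟨c, hc⟩ := hT.ae_eq_const_of_ae_eq_comp_ae (g := fun x => ψ x * conj (χ x : ℂ))
    hm.aestronglyMeasurable (by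
      filter_upwards [h, hχT] with x h1 h2
      simp only [Function.comp_apply]
      rw [h1, h2, Circle.coe_mul, map_mul, mul_mul_mul_comm, conj_circle l, ← Circle.coe_mul,
        mul_inv_cancel, Circle.coe_one, one_mul])
  refine ⟨c, ?_⟩
  filter_upwards [hc] with x hx
  have hx' : ψ x * conj (χ x : ℂ) = c := hx
  rw [← hx', mul_assoc, conj_circle, ← Circle.coe_mul, inv_mul_cancel, Circle.coe_one, mul_one]

theorem isEig_of_eigenfunction {T : X → X} (hT : Ergodic T μ) {ψ : X → ℂ} (hψ : Bd 1 ψ)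
    {l : Circle} (h : ∀ᵐ x ∂μ, ψ (T x) = l * ψ x) (h0 : ¬ ∀ᵐ x ∂μ, ψ x = 0) : IsEig T μ l := by
  obtain ⟨c, hc⟩ := ae_norm_eq_const hT hψ (Circle.norm_coe l) h
  have hc0 : c ≠ 0 := by
    rintro rfl
    exact h0 (hc.mono fun x hx => norm_eq_zero.1 hx)
  have hph : Measurable fun x => phase (ψ x) := measurable_phase.comp hψ.meas
  refine ⟨fun x => ⟨phase (ψ x), mem_sphere_zero_iff_norm.2 (norm_phase _)⟩, ?_, ?_⟩
  · have hind : Topology.IsInducing (fun c : Circle => (c : ℂ)) := Topology.IsInducing.subtypeVal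
    intro s hs
    rw [BorelSpace.measurable_eq (α := Circle), hind.eq_induced, borel_comap] at hs
    obtain ⟨t, ht, rfl⟩ := hs
    rw [← BorelSpace.measurable_eq (α := ℂ)] at ht
    exact hph ht
  · filter_upwards [h, hc] with x h1 h2
    have hx0 : ψ x ≠ 0 := fun h => hc0 (by rw [← h2, h, norm_zero])
    have := mul_phase_eq (ρ := (l : ℂ)) (k := 1) (a := ψ x) (b := ψ (T x)) (Circle.coe_ne_zero l)
      (by rw [norm_one, Circle.norm_coe]) (by rw [one_mul, h1]) hx0
    rw [one_mul] at this
    exact Circle.ext this.symm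

/-- An ergodic action on a standard Borel probability space has a Kronecker factor. -/
theorem exists_kron [StandardBorelSpace X] {τ : ℤ → X → X} (hτ : ZAct τ μ) {q : ℕ} (hq : 0 < q)
    (herg : Ergodic (τ q) μ) {P : Prop}
    (h : ∀ (Z : Type) [CommGroup Z] [TopologicalSpace Z] [IsTopologicalGroup Z] [CompactSpace Z]
      [T2Space Z] [SecondCountableTopology Z] [MeasurableSpace Z] [BorelSpace Z]
      (m : Measure Z) [IsProbabilityMeasure m] [m.IsMulLeftInvariant] (π : X → Z) (α : Z)
      (κ : Kernel Z X) [IsMarkovKernel κ], Kron τ μ q π m α κ → P) : P := by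
  have hT : Ergodic (τ 1) μ := by
    refine ⟨hτ.mp 1, PreErgodic.of_iterate q ?_⟩
    have : (τ 1)^[q] = τ q := by
      funext x; rw [hτ.iterate, one_mul]
    rw [this]; exact herg.toPreErgodic
  have hne : Nonempty X := μ.nonempty_of_neZero
  have := (countable_isEig (hτ.mp 1)).to_subtype
  choose χ hχ hχT using fun l : {l | IsEig (τ 1) μ l} => l.2
  set p : X → ({l | IsEig (τ 1) μ l} → Circle) := fun x l => χ l x with hp
  set α : {l | IsEig (τ 1) μ l} → Circle := fun l => l with hα
  have hpm : Measurable p := measurable_pi_lambda _ hχ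
  obtain ⟨k, π, hπ, hpk, hrot⟩ := exists_orbitClosure_coset hT hpm (α := α) (by
    filter_upwards [ae_all_iff.2 hχT] with x hx
    funext l
    exact hx l)
  have hmp : MeasurePreserving π μ (μ.map π) := ⟨hπ, rfl⟩
  have := Measure.isProbabilityMeasure_map (μ := μ) hπ.aemeasurable
  have hinv : (μ.map π).IsMulLeftInvariant := by
    refine isMulLeftInvariant_of_dense (dense_zpow_orbitGen α) ⟨measurable_const_mul _, ?_⟩
    rw [Measure.map_map (measurable_const_mul _) hπ]
    have : (fun z => orbitGen α * z) ∘ π =ᵐ[μ] π ∘ τ 1 := by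
      filter_upwards [hrot] with x hx using hx.symm
    rw [Measure.map_congr this, ← Measure.map_map hπ (hτ.meas 1), (hτ.mp 1).map_eq]
  have hdis : μ.map (fun x => (π x, x)) = (μ.map π) ⊗ₘ condDistrib id π μ :=
    (compProd_map_condDistrib aemeasurable_id).symm
  refine h (orbitClosure α) (μ.map π) π (orbitGen α) (condDistrib id π μ)
    { hτ with
      qpos := hq
      erg := herg
      sep := ?_
      pi := hmp
      rot := hrot
      disint := hdis
      weak := ?_ }
  · intro z hz
    by_contra! hcon
    refine hz (Subtype.ext (funext fun l => ?_))
    exact hcon ⟨⟨⟨fun z => z.1 l, rfl⟩, fun _ _ => rfl⟩,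
      (continuous_apply l).comp continuous_subtype_val⟩
  · intro F hF hF0
    by_contra hces
    obtain ⟨ψ, l, hψ, hl, hψT, hFψ⟩ := exists_eigenfunction (hτ.mp 1) hF (by
      convert hces using 6 with n
      simp only [D, hτ.iterate, one_mul])
    obtain ⟨l, rfl⟩ : ∃ l' : Circle, (l' : ℂ) = l :=
      ⟨⟨l, mem_sphere_zero_iff_norm.2 hl⟩, rfl⟩
    have hE : IsEig (τ 1) μ l := by
      refine isEig_of_eigenfunction hT hψ hψT fun h0 => hFψ ?_
      rw [integral_eq_zero_of_ae]
      filter_upwards [h0] with x hx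
      simp [hx]
    obtain ⟨c, hc⟩ := ae_eq_const_mul_eig hT hψ hψT (hχ ⟨l, hE⟩) (hχT ⟨l, hE⟩)
    apply hFψ
    have hcoord : Measurable fun z : orbitClosure α => z.1 ⟨l, hE⟩ :=
      (measurable_pi_apply _).comp measurable_subtype_coe
    have hb : Bd 1 fun w : orbitClosure α × X => conj ((w.1.1 ⟨l, hE⟩ : Circle) : ℂ) * F w.2 :=
      ((Bd.circle (hcoord.comp measurable_fst)).conj).mul (hF.comp measurable_snd)
    have hm : Measurable fun x => (π x, x) := hπ.prodMk measurable_id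
    have e1 : ∫ x, conj (((π x).1 ⟨l, hE⟩ : Circle) : ℂ) * F x ∂μ = 0 := by
      have e2 : ∫ x, conj (((π x).1 ⟨l, hE⟩ : Circle) : ℂ) * F x ∂μ
          = ∫ w, conj ((w.1.1 ⟨l, hE⟩ : Circle) : ℂ) * F w.2 ∂(μ.map fun x => (π x, x)) :=
        (integral_map hm.aemeasurable hb.meas.aestronglyMeasurable).symm
      rw [e2, hdis, Measure.integral_compProd hb.integrable]
      refine integral_eq_zero_of_ae ?_
      filter_upwards [hF0] with z hz
      simp only [Pi.zero_apply]
      rw [integral_const_mul]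
      exact mul_eq_zero_of_right _ hz
    have e3 : ∫ x, F x * conj (ψ x) ∂μ = ∫ x, conj (c * (k ⟨l, hE⟩ : ℂ)) *
        (conj (((π x).1 ⟨l, hE⟩ : Circle) : ℂ) * F x) ∂μ := by
      refine integral_congr_ae ?_
      filter_upwards [hc, hpk] with x h1 h2
      have h3 : χ ⟨l, hE⟩ x = k ⟨l, hE⟩ * (π x).1 ⟨l, hE⟩ := congrFun h2 ⟨l, hE⟩
      rw [h1, h3, Circle.coe_mul, map_mul, map_mul, map_mul]
      ring
    rw [e3, integral_const_mul, e1, mul_zero]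

end Existence

section Recurrence

variable {X : Type*} [MeasurableSpace X] {μ : Measure X} [IsProbabilityMeasure μ]

theorem integral_indicator_ofReal {s : Set X} (hs : MeasurableSet s) :
    ∫ x, ((s.indicator (fun _ => (1 : ℝ)) x : ℝ) : ℂ) ∂μ = ((μ s).toReal : ℂ) := by
  rw [integral_complex_ofReal]
  congr 1
  exact integral_indicator_one hs

theorem indicator_mul_indicator (s t : Set X) (x : X) :
    ((s.indicator (fun _ => (1 : ℝ)) x : ℝ) : ℂ) * ((t.indicator (fun _ => (1 : ℝ)) x : ℝ) : ℂ) =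
      (((s ∩ t).indicator (fun _ => (1 : ℝ)) x : ℝ) : ℂ) := by
  by_cases h1 : x ∈ s <;> by_cases h2 : x ∈ t <;> simp [h1, h2]

theorem indicator_apply_comp {Y : Type*} (s : Set Y) (g : X → Y) (x : X) :
    s.indicator (fun _ => (1 : ℝ)) (g x) = (g ⁻¹' s).indicator (fun _ => (1 : ℝ)) x := rfl

theorem ZAct.syndetic_recurrence [StandardBorelSpace X] {τ : ℤ → X → X} (hτ : ZAct τ μ) {q : ℕ}
    (hq : 0 < q) (herg : Ergodic (τ q) μ) (r : ℤ) {C : Set X} (hC : MeasurableSet C) {ε : ℝ}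
    (hε : 0 < ε) {k : ℕ} (hk : k = 1 ∨ k = 2 ∨ k = 3) :
    Syndetic {n : ℕ | (μ (⋂ i ∈ Finset.range (k + 1), τ ((i : ℤ) * (q * n + r)) ⁻¹' C)).toReal >
      (μ C).toReal ^ (k + 1) - ε} := by
  refine exists_kron hτ hq herg fun Z _ _ _ _ _ _ _ _ m _ _ π α κ _ hK => ?_
  have hm : Measurable (C.indicator fun _ => (1 : ℝ)) := measurable_const.indicator hC
  have h0 : ∀ x, 0 ≤ C.indicator (fun _ => (1 : ℝ)) x :=
    fun x => Set.indicator_nonneg (fun _ _ => zero_le_one) x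
  have h1 : ∀ x, C.indicator (fun _ => (1 : ℝ)) x ≤ 1 :=
    fun x => Set.indicator_le_self' (fun _ _ => zero_le_one) x
  have hi : ∫ x, C.indicator (fun _ => (1 : ℝ)) x ∂μ = (μ C).toReal := integral_indicator_one hC
  have hp : ∀ j : ℤ, MeasurableSet (τ j ⁻¹' C) := fun j => hτ.meas j hC
  have h0C : τ 0 ⁻¹' C = C := by ext x; simp [hτ.zero]
  have hset : ∀ j : ℤ,
      (⋂ i ∈ Finset.range 2, τ ((i : ℤ) * j) ⁻¹' C) = C ∩ τ j ⁻¹' C ∧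
      (⋂ i ∈ Finset.range 3, τ ((i : ℤ) * j) ⁻¹' C) = C ∩ τ j ⁻¹' C ∩ τ (2 * j) ⁻¹' C ∧
      (⋂ i ∈ Finset.range 4, τ ((i : ℤ) * j) ⁻¹' C) =
        C ∩ τ j ⁻¹' C ∩ τ (2 * j) ⁻¹' C ∩ τ (3 * j) ⁻¹' C := by
    intro j
    refine ⟨?_, ?_, ?_⟩ <;>
    simp [Finset.range_add_one, h0C, Set.inter_comm, Set.inter_assoc]
  rcases hk with rfl | rfl | rfl
  · obtain ⟨v, hv, he⟩ := hK.lower_two r hm h0 h1 (show 0 < ε / 4 by positivity)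
    rw [hi] at hv
    refine hK.syndetic (r := r) hε hv ?_
    convert he using 2 with n
    rw [(hset _).1, ← integral_indicator_ofReal (hC.inter (hp _)), corr3]
    refine integral_congr_ae (ae_of_all _ fun x => ?_)
    simp only [mul_one, indicator_apply_comp, indicator_mul_indicator]
  · obtain ⟨v, hv, he⟩ := hK.lower_three r hm h0 h1 (show 0 < ε / 4 by positivity)
    rw [hi] at hv
    refine hK.syndetic (r := r) hε hv ?_
    convert he using 2 with n
    rw [(hset _).2.1, ← integral_indicator_ofReal ((hC.inter (hp _)).inter (hp _)), corr3]
    refine integral_congr_ae (ae_of_all _ fun x => ?_)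
    simp only [indicator_apply_comp, indicator_mul_indicator]
  · obtain ⟨v, hv, he⟩ := hK.lower_four r hm h0 h1 (show 0 < ε / 4 by positivity)
    rw [hi] at hv
    refine hK.syndetic (r := r) hε hv ?_
    convert he using 2 with n
    rw [(hset _).2.2, ← integral_indicator_ofReal (((hC.inter (hp _)).inter (hp _)).inter (hp _)),
      corr4]
    refine integral_congr_ae (ae_of_all _ fun x => ?_)
    simp only [indicator_apply_comp, indicator_mul_indicator]

/-- The symbolic coding of the orbit of a point with respect to a set. -/
noncomputable def coding (τ : ℤ → X → X) (A : Set X) (x : X) (i : ℤ) : Bool :=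
  open Classical in decide (τ i x ∈ A)

theorem measurable_coding {τ : ℤ → X → X} (hτ : ZAct τ μ) {A : Set X} (hA : MeasurableSet A) :
    Measurable (coding τ A) := by
  refine measurable_pi_lambda _ fun i => measurable_to_bool ?_
  have : (fun x => coding τ A x i) ⁻¹' {true} = τ i ⁻¹' A := by
    ext x; simp [coding]
  rw [this]
  exact hτ.meas i hA

theorem ZAct.syndetic_recurrence_of_measurableSpace {τ : ℤ → X → X} (hτ : ZAct τ μ) {q : ℕ}
    (hq : 0 < q) (herg : Ergodic (τ q) μ) (r : ℤ) {A : Set X} (hA : MeasurableSet A) {ε : ℝ}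
    (hε : 0 < ε) {k : ℕ} (hk : k = 1 ∨ k = 2 ∨ k = 3) :
    Syndetic {n : ℕ | (μ (⋂ i ∈ Finset.range (k + 1), τ ((i : ℤ) * (q * n + r)) ⁻¹' A)).toReal >
      (μ A).toReal ^ (k + 1) - ε} := by
  have hΦ := measurable_coding hτ hA
  have := Measure.isProbabilityMeasure_map (μ := μ) hΦ.aemeasurable
  set σ : ℤ → (ℤ → Bool) → ℤ → Bool := fun n ω i => ω (i + n) with hσ
  have hσm : ∀ n, Measurable (σ n) := fun n => measurable_pi_lambda _ fun i => measurable_pi_apply _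
  have hcomm : ∀ n, Function.Semiconj (coding τ A) (τ n) (σ n) := by
    intro n x
    funext i
    simp only [coding, hσ]
    rw [decide_eq_decide, hτ.add]
  have hmp : MeasurePreserving (coding τ A) μ (μ.map (coding τ A)) := ⟨hΦ, rfl⟩
  have hσa : ZAct σ (μ.map (coding τ A)) :=
    ⟨fun ω => by simp [hσ], fun a b ω => by funext i; simp only [hσ]; congr 1; ring,
      fun n => hmp.of_semiconj (hτ.mp n) (hcomm n) (hσm n)⟩
  have hσe : Ergodic (σ q) (μ.map (coding τ A)) :=
    hmp.ergodic_of_ergodic_semiconj herg (hσm _) (hcomm _)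
  have hC : MeasurableSet {ω : ℤ → Bool | ω 0 = true} :=
    (measurable_pi_apply (X := fun _ : ℤ => Bool) 0) (measurableSet_singleton true)
  have hpre : ∀ n, coding τ A ⁻¹' (σ n ⁻¹' {ω : ℤ → Bool | ω 0 = true}) = τ n ⁻¹' A := by
    intro n
    ext x
    simp [coding, hσ]
  have hCA : μ.map (coding τ A) {ω : ℤ → Bool | ω 0 = true} = μ A := by
    rw [Measure.map_apply hΦ hC]
    congr 1
    ext x
    simp [coding, hτ.zero]
  have key := hσa.syndetic_recurrence hq hσe r hC hε hk
  convert key using 5 with n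
  · rw [Measure.map_apply hΦ (Finset.measurableSet_biInter _ fun i _ => hσm _ hC)]
    simp only [Set.preimage_iInter, hpre]
  · rw [hCA]

theorem zact_zpow (e : Equiv.Perm X) (h : MeasurePreserving e μ μ)
    (hs : Measurable e.symm) : ZAct (fun n : ℤ => ⇑(e ^ n)) μ := by
  have hnat : ∀ n : ℕ, MeasurePreserving (⇑(e ^ n)) μ μ := by
    intro n
    rw [Equiv.Perm.coe_pow]
    exact h.iterate n
  have hsymm : MeasurePreserving e.symm μ μ := h.symm ⟨e, h.measurable, hs⟩
  have hnat' : ∀ n : ℕ, MeasurePreserving (⇑((e⁻¹) ^ n)) μ μ := by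
    intro n
    rw [Equiv.Perm.coe_pow]
    exact hsymm.iterate n
  refine ⟨fun x => by simp, fun m n x => by rw [zpow_add, Equiv.Perm.mul_apply], fun n => ?_⟩
  obtain ⟨k, rfl | rfl⟩ := n.eq_nat_or_neg
  · rw [zpow_natCast]; exact hnat k
  · rw [zpow_neg, zpow_natCast, ← inv_pow]; exact hnat' k

end Recurrence

end Recurrence

theorem zpreimage_eq_preimage_zpow {X : Type*} (e : Equiv.Perm X) (n : ℤ) (A : Set X) :
    zpreimage e e.symm n A = ⇑(e ^ n) ⁻¹' A := by
  unfold zpreimage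
  split_ifs with h
  · lift n to ℕ using h
    rw [zpow_natCast, Equiv.Perm.coe_pow, Int.toNat_natCast]
  · obtain ⟨k, rfl⟩ : ∃ k : ℕ, n = -k := ⟨(-n).toNat, by omega⟩
    rw [zpow_neg, zpow_natCast, ← inv_pow, Equiv.Perm.coe_pow, neg_neg, Int.toNat_natCast]
    rfl

theorem optimal_recurrence_along_progressions
    {X : Type*} [MeasurableSpace X] (μ : Measure X) [IsProbabilityMeasure μ]
    (T S : X → X) (hT : Measurable T) (hS : Measurable S)
    (hTS : Function.LeftInverse S T) (hST : Function.RightInverse S T)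
    (hMP : MeasurePreserving T μ μ)
    (q r : ℤ) (hq : 0 < q)
    (hErg : Ergodic (T^[q.toNat]) μ)
    (A : Set X) (hA : MeasurableSet A) (ε : ℝ) (hε : 0 < ε)
    (k : ℕ) (hk : k = 1 ∨ k = 2 ∨ k = 3) :
    Syndetic {n : ℕ |
      (μ (⋂ i ∈ Finset.range (k + 1),
        zpreimage T S ((i : ℤ) * (q * n + r)) A)).toReal
        > (μ A).toReal ^ (k + 1) - ε} := by
  let e : Equiv.Perm X := ⟨T, S, hTS, hST⟩
  have hz : ∀ n : ℤ, zpreimage T S n A = ⇑(e ^ n) ⁻¹' A :=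
    fun n => zpreimage_eq_preimage_zpow e n A
  lift q to ℕ using hq.le
  have hErg' : Ergodic (⇑(e ^ (q : ℤ))) μ := by
    rw [zpow_natCast, Equiv.Perm.coe_pow]
    exact hErg
  simp only [hz]
  exact (Recurrence.zact_zpow e hMP hS).syndetic_recurrence_of_measurableSpace
      (by exact_mod_cast hq)
    hErg' r hA hε hk
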